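/- Assume (B0)–(B3), and let u be a c-convex solution of: λ ≤ |∂ᶜu| ≤ 1/λ on an open set U^λ ⊂ U and |∂ᶜu| ≤ Λ on cl U. Fix x̄ ∈ U^λ and ȳ ∈ ∂ᶜu(x̄), and define the contact set S := {x ∈ cl U : u(x) = u(x̄) − c(x, ȳ) + c(x̄, ȳ)}. If S ≠ {x̄} (i.e. it is not a singleton), then S intersects ∂U. -/

import Mathlib

open Set MeasureTheory Metric Bornology
open scoped ENNReal NNReal Pointwise

noncomputable section

abbrev Euc (n : ℕ) := EuclideanSpace ℝ (Fin n)

/-- Partial gradient of the cost in the first variable: `D_x c(x,y)`. -/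
noncomputable def gradX (n : ℕ) (c : Euc n → Euc n → ℝ) (x y : Euc n) : Euc n :=
  gradient (fun x' => c x' y) x

/-- Partial gradient of the cost in the second variable: `D_y c(x,y)`. -/
noncomputable def gradY (n : ℕ) (c : Euc n → Euc n → ℝ) (x y : Euc n) : Euc n :=
  gradient (fun y' => c x y') y

/-- Mixed second derivative `D²_{xy} c` as a continuous linear map. -/
noncomputable def DxyC (n : ℕ) (c : Euc n → Euc n → ℝ) (x y : Euc n) : Euc n →L[ℝ] Euc n :=
  fderiv ℝ (fun x' => gradY n c x' y) x

/-- Second derivative `D²_{xx} c`. -/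
noncomputable def DxxC (n : ℕ) (c : Euc n → Euc n → ℝ) (x y : Euc n) : Euc n →L[ℝ] Euc n :=
  fderiv ℝ (fun x' => gradX n c x' y) x

/-- Third derivative `D²_{xx} D_y c`. -/
noncomputable def DxxyC (n : ℕ) (c : Euc n → Euc n → ℝ) (x y : Euc n) :
    Euc n →L[ℝ] Euc n →L[ℝ] Euc n :=
  fderiv ℝ (fun x' => DxyC n c x' y) x

/-- `β⁺_c = ‖D²_{xy} c‖_{L∞(U×V)}`. -/
noncomputable def betaPlus (n : ℕ) (c : Euc n → Euc n → ℝ) (U V : Set (Euc n)) : ℝ :=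
  sSup ((fun p : Euc n × Euc n => ‖DxyC n c p.1 p.2‖) '' (U ×ˢ V))

/-- `β⁻_c = ‖(D²_{xy} c)⁻¹‖_{L∞(U×V)}`. -/
noncomputable def betaMinus (n : ℕ) (c : Euc n → Euc n → ℝ) (U V : Set (Euc n)) : ℝ :=
  sSup ((fun p : Euc n × Euc n => ‖(DxyC n c p.1 p.2).inverse‖) '' (U ×ˢ V))

/-- `γ⁺_c = ‖det D²_{xy} c‖_{L∞(U×V)}`. -/
noncomputable def gammaPlus (n : ℕ) (c : Euc n → Euc n → ℝ) (U V : Set (Euc n)) : ℝ :=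
  sSup ((fun p : Euc n × Euc n =>
    |LinearMap.det ((DxyC n c p.1 p.2 : Euc n →L[ℝ] Euc n) : Euc n →ₗ[ℝ] Euc n)|) '' (U ×ˢ V))

/-- `γ⁻_c = ‖(det D²_{xy} c)⁻¹‖_{L∞(U×V)}`. -/
noncomputable def gammaMinus (n : ℕ) (c : Euc n → Euc n → ℝ) (U V : Set (Euc n)) : ℝ :=
  sSup ((fun p : Euc n × Euc n =>
    |LinearMap.det ((DxyC n c p.1 p.2 : Euc n →L[ℝ] Euc n) : Euc n →ₗ[ℝ] Euc n)|⁻¹) '' (U ×ˢ V))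

noncomputable def supDxx (n : ℕ) (c : Euc n → Euc n → ℝ) (U V : Set (Euc n)) : ℝ :=
  sSup ((fun p : Euc n × Euc n => ‖DxxC n c p.1 p.2‖) '' (U ×ˢ V))

noncomputable def supDx (n : ℕ) (c : Euc n → Euc n → ℝ) (U V : Set (Euc n)) : ℝ :=
  sSup ((fun p : Euc n × Euc n => ‖gradX n c p.1 p.2‖) '' (U ×ˢ V))

noncomputable def supDxxy (n : ℕ) (c : Euc n → Euc n → ℝ) (U V : Set (Euc n)) : ℝ :=
  sSup ((fun p : Euc n × Euc n => ‖DxxyC n c p.1 p.2‖) '' (U ×ˢ V))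

/-- The constant `M_c` from Theorem 4.3. -/
noncomputable def Mconst (n : ℕ) (c : Euc n → Euc n → ℝ) (U V : Set (Euc n)) : ℝ :=
  (betaMinus n c U V) ^ 2 * supDxx n c U V +
    (betaMinus n c U V) ^ 3 * supDx n c U V * supDxxy n c U V

/-- The constant `ε_c` of Lemma 6.1: `1/ε_c = 2 (β⁺)⁴ (β⁻)⁶ ‖D³_{xxy} c‖_∞`. -/
noncomputable def epsC (n : ℕ) (c : Euc n → Euc n → ℝ) (U V : Set (Euc n)) : ℝ :=
  (2 * (betaPlus n c U V) ^ 4 * (betaMinus n c U V) ^ 6 * supDxxy n c U V)⁻¹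

/-- Condition (B0). -/
def B0cond (n : ℕ) (c : Euc n → Euc n → ℝ) (U V : Set (Euc n)) : Prop :=
  IsOpen U ∧ IsBounded U ∧ IsOpen V ∧ IsBounded V ∧
    ContDiffOn ℝ 4 (Function.uncurry c) (closure U ×ˢ closure V)

/-- `f` is a (C¹-) diffeomorphism from `S` onto its range. -/
def DiffeoOnto (n : ℕ) (f : Euc n → Euc n) (S : Set (Euc n)) : Prop :=
  Set.InjOn f S ∧ ContDiffOn ℝ 1 f S ∧ ContDiffOn ℝ 1 (Function.invFunOn f S) (f '' S)

/-- Condition (B1) (bi-twist). -/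
def B1cond (n : ℕ) (c : Euc n → Euc n → ℝ) (U V : Set (Euc n)) : Prop :=
  (∀ y ∈ closure V, DiffeoOnto n (fun x => -gradY n c x y) (closure U)) ∧
  (∀ x ∈ closure U, DiffeoOnto n (fun y => -gradX n c x y) (closure V))

/-- `U_ȳ := -D_y c(U, ȳ)`. -/
def Uyset (n : ℕ) (c : Euc n → Euc n → ℝ) (U : Set (Euc n)) (ybar : Euc n) : Set (Euc n) :=
  (fun x => -gradY n c x ybar) '' U

/-- `V_x̄ := -D_x c(x̄, V)`. -/
def Vxset (n : ℕ) (c : Euc n → Euc n → ℝ) (V : Set (Euc n)) (xbar : Euc n) : Set (Euc n) :=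
  (fun y => -gradX n c xbar y) '' V

/-- Condition (B2) (bi-convexity). -/
def B2cond (n : ℕ) (c : Euc n → Euc n → ℝ) (U V : Set (Euc n)) : Prop :=
  (∀ y ∈ closure V, Convex ℝ (Uyset n c U y)) ∧ (∀ x ∈ closure U, Convex ℝ (Vxset n c V x))

/-- A strongly convex set: each boundary point is touched from outside by a sphere of
radius `R` enclosing the set. -/
def StronglyConvexSet (n : ℕ) (Q : Set (Euc n)) : Prop :=
  Convex ℝ Q ∧ ∃ R : ℝ, 0 < R ∧ ∀ x ∈ frontier Q, ∃ z : Euc n, dist x z = R ∧ Q ⊆ closedBall z R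

/-- Condition (B2s). -/
def B2scond (n : ℕ) (c : Euc n → Euc n → ℝ) (U V : Set (Euc n)) : Prop :=
  (∀ y ∈ closure V, StronglyConvexSet n (Uyset n c U y)) ∧
  (∀ x ∈ closure U, StronglyConvexSet n (Vxset n c V x))

/-- An affinely parameterized line segment on `[-1,1]`. -/
def IsAffineSeg (n : ℕ) (F : ℝ → Euc n × Euc n) : Prop :=
  ∃ a b : Euc n × Euc n, ∀ t ∈ Icc (-1 : ℝ) 1, F t = a + t • b

/-- `∂²/∂s∂t c(x(s), y(t))` at `(0,0)`. -/
noncomputable def crossDiff2 (n : ℕ) (c : Euc n → Euc n → ℝ) (x y : ℝ → Euc n) : ℝ :=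
  deriv (fun s => deriv (fun t => c (x s) (y t)) 0) 0

/-- `∂⁴/∂s²∂t² c(x(s), y(t))` at `(0,0)`. -/
noncomputable def crossDiff4 (n : ℕ) (c : Euc n → Euc n → ℝ) (x y : ℝ → Euc n) : ℝ :=
  deriv (deriv (fun s => deriv (deriv (fun t => c (x s) (y t))) 0)) 0

/-- Condition (B3) (= A3w). -/
def B3cond (n : ℕ) (c : Euc n → Euc n → ℝ) (U V : Set (Euc n)) : Prop :=
  ∀ x y : ℝ → Euc n, (∀ t ∈ Icc (-1 : ℝ) 1, x t ∈ closure U) →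
    (∀ t ∈ Icc (-1 : ℝ) 1, y t ∈ closure V) →
    IsAffineSeg n (fun t => (gradY n c (x t) (y 0), gradX n c (x 0) (y t))) →
    crossDiff2 n c x y = 0 → crossDiff4 n c x y ≤ 0

/-- Condition (B4) (non-negative cross-curvature). -/
def B4cond (n : ℕ) (c : Euc n → Euc n → ℝ) (U V : Set (Euc n)) : Prop :=
  ∀ x y : ℝ → Euc n, (∀ t ∈ Icc (-1 : ℝ) 1, x t ∈ closure U) →
    (∀ t ∈ Icc (-1 : ℝ) 1, y t ∈ closure V) →
    IsAffineSeg n (fun t => (gradY n c (x t) (y 0), gradX n c (x 0) (y t))) →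
    crossDiff4 n c x y ≤ 0

/-- The `c*`-transform `u^{c*}(y) = sup_{x ∈ A} (-c(x,y) - u(x))`. -/
noncomputable def cStarT (n : ℕ) (c : Euc n → Euc n → ℝ) (A : Set (Euc n)) (u : Euc n → ℝ)
    (y : Euc n) : ℝ :=
  sSup ((fun x => -c x y - u x) '' A)

/-- `u` is `c`-convex on `A` (relative to the target set `B`): `u = (u^{c*})^c`. -/
def CConvexOn (n : ℕ) (c : Euc n → Euc n → ℝ) (A B : Set (Euc n)) (u : Euc n → ℝ) : Prop :=
  ∀ x ∈ A, u x = sSup ((fun y => -c x y - cStarT n c A u y) '' B)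

/-- The `c`-subdifferential `∂ᶜu ⊂ A × B`. -/
def cSubdiff (n : ℕ) (c : Euc n → Euc n → ℝ) (A B : Set (Euc n)) (u : Euc n → ℝ) :
    Set (Euc n × Euc n) :=
  {p | p.1 ∈ A ∧ p.2 ∈ B ∧ u p.1 + cStarT n c A u p.2 + c p.1 p.2 = 0}

def cSubdiffAt (n : ℕ) (c : Euc n → Euc n → ℝ) (A B : Set (Euc n)) (u : Euc n → ℝ)
    (x : Euc n) : Set (Euc n) :=
  {y | (x, y) ∈ cSubdiff n c A B u}

def cSubdiffImg (n : ℕ) (c : Euc n → Euc n → ℝ) (A B : Set (Euc n)) (u : Euc n → ℝ)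
    (X : Set (Euc n)) : Set (Euc n) :=
  ⋃ x ∈ X, cSubdiffAt n c A B u x

/-- `∂^{c*}u^{c*}(Y) = {x : ∃ y ∈ Y, (x,y) ∈ ∂ᶜu}`. -/
def cSubdiffPre (n : ℕ) (c : Euc n → Euc n → ℝ) (A B : Set (Euc n)) (u : Euc n → ℝ)
    (Y : Set (Euc n)) : Set (Euc n) :=
  {x | ∃ y ∈ Y, (x, y) ∈ cSubdiff n c A B u}

/-- `|∂ᶜu| ≥ lam` on `S`. -/
def MAge (n : ℕ) (c : Euc n → Euc n → ℝ) (A B : Set (Euc n)) (u : Euc n → ℝ) (lam : ℝ)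
    (S : Set (Euc n)) : Prop :=
  ∀ X : Set (Euc n), X ⊆ S → MeasurableSet X →
    ENNReal.ofReal lam * volume X ≤ volume (cSubdiffImg n c A B u X)

/-- `|∂ᶜu| ≤ lam` on `S`. -/
def MAle (n : ℕ) (c : Euc n → Euc n → ℝ) (A B : Set (Euc n)) (u : Euc n → ℝ) (lam : ℝ)
    (S : Set (Euc n)) : Prop :=
  ∀ X : Set (Euc n), X ⊆ S → MeasurableSet X →
    volume (cSubdiffImg n c A B u X) ≤ ENNReal.ofReal lam * volume X

/-- The inverse of the cost-exponential coordinate change `q(x) = -D_y c(x, ȳ)`. -/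
noncomputable def xOf (n : ℕ) (c : Euc n → Euc n → ℝ) (U : Set (Euc n)) (ybar : Euc n) :
    Euc n → Euc n :=
  Function.invFunOn (fun x => -gradY n c x ybar) (closure U)

/-- `cl U_ȳ := -D_y c(cl U, ȳ)`. -/
def clUy (n : ℕ) (c : Euc n → Euc n → ℝ) (U : Set (Euc n)) (ybar : Euc n) : Set (Euc n) :=
  (fun x => -gradY n c x ybar) '' closure U

/-- The modified cost `c̃(q,y) = c(x(q), y) - c(x(q), ȳ)`. -/
noncomputable def modCost (n : ℕ) (c : Euc n → Euc n → ℝ) (U : Set (Euc n)) (ybar : Euc n)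
    (q y : Euc n) : ℝ :=
  c (xOf n c U ybar q) y - c (xOf n c U ybar q) ybar

/-- The modified potential `ũ(q) = u(x(q)) + c(x(q), ȳ)`. -/
noncomputable def modPot (n : ℕ) (c : Euc n → Euc n → ℝ) (U : Set (Euc n)) (ybar : Euc n)
    (u : Euc n → ℝ) (q : Euc n) : ℝ :=
  u (xOf n c U ybar q) + c (xOf n c U ybar q) ybar

/-- The `c̃`-cone generated by `qt` and `Q` with height `-h0 > 0`. -/
noncomputable def cConeFun (n : ℕ) (ct : Euc n → Euc n → ℝ) (B Q : Set (Euc n)) (qt : Euc n)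
    (h0 : ℝ) (q : Euc n) : ℝ :=
  sSup {r : ℝ | ∃ y ∈ B, r = -ct q y + ct qt y + h0 ∧
    ∀ p ∈ frontier Q, -ct p y + ct qt y + h0 ≤ 0}

/-- The ordinary subdifferential `∂u(x)` relative to a domain `A`. -/
def subdiffAt (n : ℕ) (A : Set (Euc n)) (u : Euc n → ℝ) (x : Euc n) : Set (Euc n) :=
  {p | ∀ ε > 0, ∃ δ > 0, ∀ x' ∈ A, ‖x' - x‖ < δ →
    u x + @inner ℝ _ _ p (x' - x) - ε * ‖x' - x‖ ≤ u x'}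

/-- The dual norm `‖v‖*_K = sup_{w ∈ K} ⟨w, v⟩`. -/
noncomputable def dualNorm (n : ℕ) (K : Set (Euc n)) (v : Euc n) : ℝ :=
  sSup ((fun w => (@inner ℝ _ _ w v : ℝ)) '' K)

/-- The section `S(x̄, ȳ, τ)`. -/
def sectS (n : ℕ) (c : Euc n → Euc n → ℝ) (U : Set (Euc n)) (u : Euc n → ℝ)
    (xbar ybar : Euc n) (τ : ℝ) : Set (Euc n) :=
  {x ∈ U | u x ≤ u xbar - c x ybar + c xbar ybar + τ}

/-- The measure with density `f` restricted to `A`. -/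
noncomputable def densMeasure (n : ℕ) (A : Set (Euc n)) (f : Euc n → ℝ) : Measure (Euc n) :=
  (volume.restrict A).withDensity fun x => ENNReal.ofReal (f x)

end

/-- One-dimensional three point inequality. -/
theorem one_dim_three_point {C : ℝ} {f f1 f2 : ℝ → ℝ}
    (hf : ∀ t ∈ Icc (0:ℝ) 1, HasDerivAt f (f1 t) t)
    (hf1 : ∀ t ∈ Icc (0:ℝ) 1, HasDerivAt f1 (f2 t) t)
    (hC : ∀ t ∈ Icc (0:ℝ) 1, -C * |f1 t| ≤ f2 t) (hC0 : 0 ≤ C)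
    {t : ℝ} (ht0 : 0 < t) (ht1 : t < 1) (hlt : f 0 < f t) :
    Real.exp (-C) * (1 - t) * (f t - f 0) ≤ t * (f 1 - f t) := by
  have hcf : ContinuousOn f (Icc 0 1) := fun s hs => (hf s hs).continuousAt.continuousWithinAt
  have hcf1 : ContinuousOn f1 (Icc 0 1) := fun s hs => (hf1 s hs).continuousAt.continuousWithinAt
  obtain ⟨s, hs, hsm⟩ := exists_hasDerivAt_eq_slope f f1 ht0
    (hcf.mono (Icc_subset_Icc le_rfl ht1.le)) (fun x hx => hf x ⟨hx.1.le, hx.2.le.trans ht1.le⟩)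
  set m := f1 s with hm
  have hmpos : 0 < m := by rw [hsm]; exact div_pos (by linarith) (by linarith)
  have hs1 : s < 1 := hs.2.trans ht1
  -- on an interval where f1 is nonnegative, exp(C r) f1 is monotone
  have mono : ∀ r ∈ Icc s 1, (∀ p ∈ Ioo s r, 0 ≤ f1 p) → m * Real.exp (-C * (r - s)) ≤ f1 r := by
    intro r hr hpos
    have hmo : MonotoneOn (fun p => Real.exp (C * p) * f1 p) (Icc s r) := by
      apply monotoneOn_of_deriv_nonneg (convex_Icc s r)
      · apply ContinuousOn.mul (by fun_prop)
        exact hcf1.mono (Icc_subset_Icc hs.1.le hr.2)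
      · intro p hp
        rw [interior_Icc] at hp
        have hp' : p ∈ Icc (0:ℝ) 1 := ⟨by linarith [hs.1, hp.1], by linarith [hp.2, hr.2]⟩
        have h1 : HasDerivAt (fun p => Real.exp (C * p)) (Real.exp (C * p) * C) p := by
          simpa using ((hasDerivAt_id p).const_mul C).exp
        exact ((h1.mul (hf1 p hp')).differentiableAt).differentiableWithinAt
      · intro p hp
        rw [interior_Icc] at hp
        have hp' : p ∈ Icc (0:ℝ) 1 := ⟨by linarith [hs.1, hp.1], by linarith [hp.2, hr.2]⟩
        have h1 : HasDerivAt (fun p => Real.exp (C * p)) (Real.exp (C * p) * C) p := by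
          simpa using ((hasDerivAt_id p).const_mul C).exp
        have h2 := (h1.mul (hf1 p hp')).deriv
        have h3 : deriv (fun p => Real.exp (C * p) * f1 p) p = _ := h2
        rw [h3]
        have := hC p hp'
        rw [abs_of_nonneg (hpos p hp)] at this
        have he := Real.exp_pos (C * p)
        nlinarith
    have := hmo (left_mem_Icc.2 hr.1) (right_mem_Icc.2 hr.1) hr.1
    simp only at this
    have e1 : Real.exp (-C * (r - s)) = Real.exp (C * s) * (Real.exp (C * r))⁻¹ := by
      rw [← Real.exp_neg, ← Real.exp_add]; congr 1; ring
    rw [e1]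
    have he := Real.exp_pos (C * r)
    rw [show m * (Real.exp (C * s) * (Real.exp (C * r))⁻¹) = (Real.exp (C * s) * m) / Real.exp (C * r) by
      field_simp]
    rw [div_le_iff₀ he]
    linarith
  have hpos : ∀ r ∈ Icc s 1, 0 < f1 r := by
    by_contra hcon
    push Not at hcon
    obtain ⟨r, hr, hr0⟩ := hcon
    set A := {p ∈ Icc s r | f1 p ≤ 0} with hA
    have hAc : IsCompact A := by
      have : A = Icc s r ∩ f1 ⁻¹' Iic 0 := by ext; simp [hA]
      rw [this]
      exact isCompact_Icc.of_isClosed_subset ((hcf1.mono (Icc_subset_Icc hs.1.le hr.2)).preimage_isClosed_of_isClosed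
        isClosed_Icc isClosed_Iic) inter_subset_left
    obtain ⟨p, hp, hpmin⟩ := hAc.exists_isLeast ⟨r, ⟨hr.1, le_rfl⟩, hr0⟩
    have := mono p ⟨hp.1.1, hp.1.2.trans hr.2⟩ (fun q hq => by
      by_contra hq0
      exact absurd (hpmin ⟨⟨hq.1.le, hq.2.le.trans hp.1.2⟩, (not_le.1 hq0).le⟩) (not_le.2 hq.2))
    have h2 := mul_pos hmpos (Real.exp_pos (-C * (p - s)))
    linarith [hp.2]
  have hbound : ∀ r ∈ Icc s 1, m * Real.exp (-C) ≤ f1 r := by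
    intro r hr
    refine le_trans ?_ (mono r hr fun p hp => (hpos p ⟨hp.1.le, hp.2.le.trans hr.2⟩).le)
    apply mul_le_mul_of_nonneg_left _ hmpos.le
    apply Real.exp_le_exp.2
    have : r - s ≤ 1 := by linarith [hr.2, hs.1]
    nlinarith
  obtain ⟨r, hr, hrm⟩ := exists_hasDerivAt_eq_slope f f1 ht1
    (hcf.mono (Icc_subset_Icc ht0.le le_rfl)) (fun x hx => hf x ⟨ht0.le.trans hx.1.le, hx.2.le⟩)
  have hb := hbound r ⟨by linarith [hs.2, hr.1], hr.2.le⟩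
  rw [hrm, hsm] at hb
  rw [le_div_iff₀ (by linarith), sub_zero] at hb
  have : (f t - f 0) / t * Real.exp (-C) * (1 - t) * t = Real.exp (-C) * (1 - t) * (f t - f 0) := by
    field_simp
  nlinarith

theorem one_dim_taylor {A : ℝ} {f f1 f2 : ℝ → ℝ}
    (hf : ∀ t ∈ Icc (0:ℝ) 1, HasDerivAt f (f1 t) t)
    (hf1 : ∀ t ∈ Icc (0:ℝ) 1, HasDerivAt f1 (f2 t) t)
    (hA : ∀ t ∈ Icc (0:ℝ) 1, -A ≤ f2 t) (hA0 : 0 ≤ A) (h0 : f1 0 = 0) :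
    -A ≤ f 1 - f 0 := by
  obtain ⟨s, hs, hsm⟩ := exists_hasDerivAt_eq_slope f f1 one_pos
    (fun s hs => (hf s hs).continuousAt.continuousWithinAt)
    (fun x hx => hf x ⟨hx.1.le, hx.2.le⟩)
  obtain ⟨r, hr, hrm⟩ := exists_hasDerivAt_eq_slope f1 f2 hs.1
    (fun r hr => (hf1 r ⟨hr.1, hr.2.trans hs.2.le⟩).continuousAt.continuousWithinAt)
    (fun x hx => hf1 x ⟨hx.1.le, hx.2.le.trans hs.2.le⟩)
  have := hA r ⟨hr.1.le, hr.2.le.trans hs.2.le⟩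
  rw [hrm, le_div_iff₀ (by linarith [hs.1])] at this
  have h2 := hs.2
  have h1 := hs.1
  have : f 1 - f 0 = f1 s := by rw [hsm]; ring
  rw [this]
  nlinarith

/-- directional derivative -/
noncomputable def pd {W : Type*} [NormedAddCommGroup W] [NormedSpace ℝ W] (a : W) (f : W → ℝ) (z : W) : ℝ :=
  fderiv ℝ f z a

section pdsec
variable {W : Type*} [NormedAddCommGroup W] [NormedSpace ℝ W]

theorem pd_add_vec (a b : W) (f : W → ℝ) : pd (a + b) f = pd a f + pd b f := by
  ext z; simp [pd]

theorem pd_smul_vec (r : ℝ) (a : W) (f : W → ℝ) : pd (r • a) f = fun z => r * pd a f z := by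
  ext z; simp [pd]

theorem pd_contDiffOn {f : W → ℝ} {O : Set W} {m k : WithTop ℕ∞} (hO : IsOpen O)
    (hf : ContDiffOn ℝ m f O) (hk : k + 1 ≤ m) (a : W) : ContDiffOn ℝ k (pd a f) O :=
  (hf.fderiv_of_isOpen hO hk).clm_apply contDiffOn_const

theorem pd_pd_add {f : W → ℝ} {O : Set W} (hO : IsOpen O)
    (hf : ContDiffOn ℝ 2 f O) {z : W} (hz : z ∈ O) (a b c : W) :
    pd a (pd (b + c) f) z = pd a (pd b f) z + pd a (pd c f) z := by
  have h (b) : DifferentiableAt ℝ (pd b f) z :=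
    ((pd_contDiffOn hO hf (k := 1) (by norm_num) b).contDiffAt (hO.mem_nhds hz)).differentiableAt
      (by norm_num)
  rw [pd_add_vec, pd, fderiv_add (h b) (h c)]; rfl

theorem pd_congr {f g : W → ℝ} {O : Set W} (hO : IsOpen O) (h : EqOn f g O) (a : W) :
    EqOn (pd a f) (pd a g) O := by
  intro z hz
  have : f =ᶠ[nhds z] g := Filter.eventuallyEq_of_mem (hO.mem_nhds hz) h
  simp [pd, this.fderiv_eq]

theorem pd_eq_snd {f : W → ℝ} {O : Set W} (hO : IsOpen O)
    (hf : ContDiffOn ℝ 2 f O) {z : W} (hz : z ∈ O) (a b : W) :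
    pd a (pd b f) z = fderiv ℝ (fderiv ℝ f) z a b := by
  have h : DifferentiableAt ℝ (fderiv ℝ f) z :=
    ((hf.fderiv_of_isOpen hO (m := 1) (by norm_num)).contDiffAt (hO.mem_nhds hz)).differentiableAt
      (by norm_num)
  have := (h.hasFDerivAt.clm_apply (hasFDerivAt_const b z)).fderiv
  simp only [pd]
  change fderiv ℝ (fun z => fderiv ℝ f z b) z a = _
  rw [this]; simp

theorem pd_comm {f : W → ℝ} {O : Set W} (hO : IsOpen O)
    (hf : ContDiffOn ℝ 2 f O) (a b : W) :
    EqOn (pd a (pd b f)) (pd b (pd a f)) O := by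
  intro z hz
  rw [pd_eq_snd hO hf hz, pd_eq_snd hO hf hz]
  exact ((hf.contDiffAt (hO.mem_nhds hz)).isSymmSndFDerivAt (by simp)).eq a b

theorem pd_comp_equiv {W' : Type*} [NormedAddCommGroup W'] [NormedSpace ℝ W']
    (L : W' ≃L[ℝ] W) (f : W → ℝ) (a : W') : pd a (f ∘ L) = pd (L a) f ∘ L := by
  ext z
  simp only [pd, Function.comp]
  have := L.comp_right_fderiv (f := f) (x := z)
  change fderiv ℝ (f ∘ L) z a = _
  rw [this]; rfl

/-- first and second derivative along a curve -/
theorem curve_deriv1 {f : W → ℝ} {O : Set W} (hO : IsOpen O)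
    (hf : ContDiffOn ℝ 1 f O) {z z1 : ℝ → W} {s : ℝ} (hz : z s ∈ O)
    (h1 : HasDerivAt z (z1 s) s) : HasDerivAt (fun r => f (z r)) (pd (z1 s) f (z s)) s := by
  have h : DifferentiableAt ℝ f (z s) :=
    (hf.contDiffAt (hO.mem_nhds hz)).differentiableAt (by norm_num)
  exact h.hasFDerivAt.comp_hasDerivAt s h1

theorem curve_deriv2 {f : W → ℝ} {O : Set W} (hO : IsOpen O)
    (hf : ContDiffOn ℝ 2 f O) {z z1 z2 : ℝ → W} {s : ℝ} (hz : z s ∈ O)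
    (h1 : HasDerivAt z (z1 s) s) (h2 : HasDerivAt z1 (z2 s) s) :
    HasDerivAt (fun r => pd (z1 r) f (z r))
      (pd (z1 s) (pd (z1 s) f) (z s) + pd (z2 s) f (z s)) s := by
  have h : DifferentiableAt ℝ (fderiv ℝ f) (z s) :=
    ((hf.fderiv_of_isOpen hO (m := 1) (by norm_num)).contDiffAt (hO.mem_nhds hz)).differentiableAt
      (by norm_num)
  rw [pd_eq_snd hO hf hz]
  exact (h.hasFDerivAt.comp_hasDerivAt s h1).clm_apply h2
end pdsec

theorem exists_equiv_of_injective {n : ℕ} (A : Euc n →L[ℝ] Euc n)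
    (h : Function.Injective A) : ∃ e : Euc n ≃L[ℝ] Euc n, (e : Euc n →L[ℝ] Euc n) = A := by
  have h1 : Function.Injective (A : Euc n →ₗ[ℝ] Euc n) := h
  let e := LinearEquiv.ofInjectiveEndo (A : Euc n →ₗ[ℝ] Euc n) h1
  refine ⟨e.toContinuousLinearEquiv, ?_⟩
  ext x
  simp [e]

theorem chart_local {n : ℕ} {k : WithTop ℕ∞} (hk : k ≠ 0) {g : Euc n → Euc n} {U : Set (Euc n)}
    (oU : IsOpen U) (hg : ContDiffOn ℝ k g U) (hinj : InjOn g U)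
    (hder : ∀ x ∈ U, Function.Injective (fderiv ℝ g x)) :
    IsOpen (g '' U) ∧ ContDiffOn ℝ k (Function.invFunOn g U) (g '' U) := by
  have key : ∀ x ∈ U, g '' U ∈ nhds (g x) ∧ ContDiffAt ℝ k (Function.invFunOn g U) (g x) := by
    intro x hx
    obtain ⟨e, he⟩ := exists_equiv_of_injective _ (hder x hx)
    have hcd : ContDiffAt ℝ k g x := hg.contDiffAt (oU.mem_nhds hx)
    have hf' : HasFDerivAt g (e : Euc n →L[ℝ] Euc n) x := by
      rw [he]; exact (hcd.differentiableAt hk).hasFDerivAt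
    have hs := hcd.hasStrictFDerivAt' hf' hk
    have h1 : g '' U ∈ nhds (g x) := by
      rw [← hs.map_nhds_eq_of_equiv]
      exact Filter.image_mem_map (oU.mem_nhds hx)
    refine ⟨h1, (hcd.to_localInverse hf' hk).congr_of_eventuallyEq ?_⟩
    have h2 := hs.eventually_right_inverse
    have h3 : ∀ᶠ y in nhds (g x), hs.localInverse g e x y ∈ U := by
      have := hs.localInverse_continuousAt
      apply this.eventually
      rw [hs.localInverse_apply_image]
      exact oU.mem_nhds hx
    filter_upwards [h1, h2, h3] with y hy h2 h3
    apply hinj (Function.invFunOn_mem hy) h3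
    rw [Function.invFunOn_eq hy]
    exact h2.symm
  constructor
  · rw [isOpen_iff_mem_nhds]
    rintro _ ⟨x, hx, rfl⟩
    exact (key x hx).1
  · rintro _ ⟨x, hx, rfl⟩
    exact (key x hx).2.contDiffWithinAt

theorem chart_inv_fderiv {n : ℕ} {k : WithTop ℕ∞} (hk : k ≠ 0) {g : Euc n → Euc n} {U : Set (Euc n)}
    (oU : IsOpen U) (hg : ContDiffOn ℝ k g U) (hinj : InjOn g U) {μ : ℝ} (hμ : 0 < μ)
    (hder : ∀ x ∈ U, ∀ v, μ * ‖v‖ ≤ ‖fderiv ℝ g x v‖) :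
    ∀ q ∈ g '' U, ‖fderiv ℝ (Function.invFunOn g U) q‖ ≤ μ⁻¹ := by
  have hder' : ∀ x ∈ U, Function.Injective (fderiv ℝ g x) := by
    intro x hx
    refine (injective_iff_map_eq_zero _).2 fun v hv => ?_
    have := hder x hx v
    rw [hv, norm_zero] at this
    have h : ‖v‖ ≤ 0 := by by_contra h; push Not at h; nlinarith [mul_pos hμ h]
    simpa using h
  obtain ⟨ho, hc⟩ := chart_local hk oU hg hinj hder'
  intro q hq
  set X := Function.invFunOn g U
  have hXq : X q ∈ U := Function.invFunOn_mem hq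
  have h1 : DifferentiableAt ℝ X q := (hc.contDiffAt (ho.mem_nhds hq)).differentiableAt hk
  have h2 : DifferentiableAt ℝ g (X q) := (hg.contDiffAt (oU.mem_nhds hXq)).differentiableAt hk
  have h3 : HasFDerivAt (g ∘ X) ((fderiv ℝ g (X q)).comp (fderiv ℝ X q)) q :=
    h2.hasFDerivAt.comp q h1.hasFDerivAt
  have h4 : HasFDerivAt (g ∘ X) (ContinuousLinearMap.id ℝ (Euc n)) q := by
    apply (hasFDerivAt_id q).congr_of_eventuallyEq
    filter_upwards [ho.mem_nhds hq] with y hy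
    exact Function.invFunOn_eq hy
  have h5 := h3.unique h4
  apply ContinuousLinearMap.opNorm_le_bound _ (by positivity)
  intro v
  have h6 := hder (X q) hXq (fderiv ℝ X q v)
  have h7 : fderiv ℝ g (X q) (fderiv ℝ X q v) = v := by
    simpa using congrArg (fun L : Euc n →L[ℝ] Euc n => L v) h5
  rw [h7] at h6
  rw [← div_eq_inv_mul, le_div_iff₀ hμ]
  linarith

theorem exists_det_bound (n : ℕ) (L : ℝ) : ∃ D : ℝ, 0 < D ∧
    ∀ A : Euc n →L[ℝ] Euc n, ‖A‖ ≤ L → |A.det| ≤ D := by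
  have hc : Continuous (fun A : Euc n →L[ℝ] Euc n => |A.det|) :=
    ContinuousLinearMap.continuous_det.abs
  obtain ⟨D, hD⟩ := (isCompact_closedBall (0 : Euc n →L[ℝ] Euc n) L).exists_bound_of_continuousOn
    hc.continuousOn
  refine ⟨max D 1, by positivity, fun A hA => ?_⟩
  have := hD A (by simpa using hA)
  simp only [Real.norm_eq_abs, abs_abs] at this
  exact this.trans (le_max_left _ _)

theorem exists_vol_bound (n : ℕ) (L : ℝ) : ∃ D : ℝ≥0, 0 < D ∧
    ∀ (g : Euc n → Euc n) (O s : Set (Euc n)), IsOpen O → s ⊆ O → DifferentiableOn ℝ g O →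
      (∀ x ∈ O, ‖fderiv ℝ g x‖ ≤ L) → volume (g '' s) ≤ D * volume s := by
  obtain ⟨D, hD, hdet⟩ := exists_det_bound n L
  refine ⟨D.toNNReal, by simpa using hD, fun g O s oO hs hg hL => ?_⟩
  set t := toMeasurable volume s ∩ O
  have ht : MeasurableSet t := (measurableSet_toMeasurable _ _).inter oO.measurableSet
  have hst : s ⊆ t := subset_inter (subset_toMeasurable _ _) hs
  calc volume (g '' s) ≤ volume (g '' t) := measure_mono (image_mono hst)
    _ ≤ ∫⁻ x in t, ENNReal.ofReal |(fderiv ℝ g x).det| := by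
        apply addHaar_image_le_lintegral_abs_det_fderiv _ ht
        intro x hx
        exact ((hg x hx.2).differentiableAt (oO.mem_nhds hx.2)).hasFDerivAt.hasFDerivWithinAt
    _ ≤ ∫⁻ x in t, ENNReal.ofReal D := by
        apply setLIntegral_mono measurable_const
        intro x hx
        exact ENNReal.ofReal_le_ofReal (hdet _ (hL x hx.2))
    _ = ENNReal.ofReal D * volume t := by simp
    _ ≤ ENNReal.ofReal D * volume s := by
        exact mul_le_mul' le_rfl ((measure_mono inter_subset_left).trans (measure_toMeasurable s).le)

/-- The partial gradient in the second variable of a joint function. -/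
noncomputable def gY {n : ℕ} (f : Euc n × Euc n → ℝ) (x y : Euc n) : Euc n :=
  (InnerProductSpace.toDual ℝ (Euc n)).symm
    ((fderiv ℝ f (x, y)).comp (ContinuousLinearMap.inr ℝ (Euc n) (Euc n)))

noncomputable def sw (n : ℕ) : (Euc n × Euc n) ≃L[ℝ] (Euc n × Euc n) :=
  ContinuousLinearEquiv.prodComm ℝ (Euc n) (Euc n)

theorem sw_mk {n : ℕ} (a b : Euc n) : sw n (a, b) = (b, a) := rfl

noncomputable def gX {n : ℕ} (f : Euc n × Euc n → ℝ) (x y : Euc n) : Euc n := gY (f ∘ sw n) y x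

theorem inner_gY {n : ℕ} (f : Euc n × Euc n → ℝ) (x y w : Euc n) :
    inner ℝ (gY f x y) w = pd (0, w) f (x, y) := by
  rw [gY, InnerProductSpace.toDual_symm_apply]; rfl

theorem inner_gX {n : ℕ} (f : Euc n × Euc n → ℝ) (x y v : Euc n) :
    inner ℝ (gX f x y) v = pd (v, 0) f (x, y) := by
  rw [gX, inner_gY, pd_comp_equiv]; rfl

theorem fs_fs {n : ℕ} (f : Euc n × Euc n → ℝ) : (f ∘ sw n) ∘ sw n = f := by
  ext z; rfl

theorem gX_fs {n : ℕ} (f : Euc n × Euc n → ℝ) (x y : Euc n) : gX (f ∘ sw n) x y = gY f y x := by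
  rw [gX, fs_fs]

/-- Structural hypotheses on a cost (symmetric in the two variables), without curvature. -/
structure Pre (n : ℕ) (f : Euc n × Euc n → ℝ) (U V : Set (Euc n)) (B μ : ℝ) : Prop where
  oU : IsOpen U
  oV : IsOpen V
  sm : ContDiffOn ℝ 4 f (U ×ˢ V)
  hB : 0 < B
  hμ : 0 < μ
  b1 : ∀ z ∈ U ×ˢ V, ∀ a, |pd a f z| ≤ B * ‖a‖
  b2 : ∀ z ∈ U ×ˢ V, ∀ a b, |pd a (pd b f) z| ≤ B * ‖a‖ * ‖b‖
  b3 : ∀ z ∈ U ×ˢ V, ∀ a b c, |pd a (pd b (pd c f)) z| ≤ B * ‖a‖ * ‖b‖ * ‖c‖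
  b4 : ∀ z ∈ U ×ˢ V, ∀ a b c d, |pd a (pd b (pd c (pd d f))) z| ≤ B * ‖a‖ * ‖b‖ * ‖c‖ * ‖d‖
  inv1 : ∀ z ∈ U ×ˢ V, ∀ v : Euc n, ∃ w : Euc n, ‖w‖ ≤ 1 ∧ μ * ‖v‖ ≤ pd (v, 0) (pd (0, w) f) z
  inv2 : ∀ z ∈ U ×ˢ V, ∀ w : Euc n, ∃ v : Euc n, ‖v‖ ≤ 1 ∧ μ * ‖w‖ ≤ pd (v, 0) (pd (0, w) f) z
  injY : ∀ y ∈ V, InjOn (fun x => gY f x y) U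
  convY : ∀ y ∈ V, Convex ℝ ((fun x => gY f x y) '' U)
  injX : ∀ x ∈ U, InjOn (fun y => gX f x y) V
  convX : ∀ x ∈ U, Convex ℝ ((fun y => gX f x y) '' V)

/-- The tensor form of the curvature condition. -/
def T1cond (n : ℕ) (f : Euc n × Euc n → ℝ) (U V : Set (Euc n)) : Prop :=
  ∀ z ∈ U ×ˢ V, ∀ v w a : Euc n, pd (v, 0) (pd (0, w) f) z = 0 →
    (∀ w' : Euc n, pd (v, 0) (pd (v, 0) (pd (0, w') f)) z + pd (a, 0) (pd (0, w') f) z = 0) →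
    pd (v, 0) (pd (v, 0) (pd (0, w) (pd (0, w) f))) z + pd (a, 0) (pd (0, w) (pd (0, w) f)) z ≤ 0

structure Good (n : ℕ) (f : Euc n × Euc n → ℝ) (U V : Set (Euc n)) (B μ : ℝ) : Prop
    extends Pre n f U V B μ where
  T1 : T1cond n f U V

section
variable {n : ℕ} {f : Euc n × Euc n → ℝ} {U V : Set (Euc n)} {B μ : ℝ}

theorem norm_inl_pair (v : Euc n) : ‖((v, 0) : Euc n × Euc n)‖ = ‖v‖ := by simp [Prod.norm_def]
theorem norm_inr_pair (v : Euc n) : ‖((0, v) : Euc n × Euc n)‖ = ‖v‖ := by simp [Prod.norm_def]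

theorem Pre.oUV (h : Pre n f U V B μ) : IsOpen (U ×ˢ V) := h.oU.prod h.oV

theorem Pre.pd1 (h : Pre n f U V B μ) (a) : ContDiffOn ℝ 3 (pd a f) (U ×ˢ V) :=
  pd_contDiffOn h.oUV h.sm (by norm_num) a
theorem Pre.pd2 (h : Pre n f U V B μ) (a b) : ContDiffOn ℝ 2 (pd a (pd b f)) (U ×ˢ V) :=
  pd_contDiffOn h.oUV (h.pd1 b) (by norm_num) a
theorem Pre.pd3 (h : Pre n f U V B μ) (a b c) : ContDiffOn ℝ 1 (pd a (pd b (pd c f))) (U ×ˢ V) :=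
  pd_contDiffOn h.oUV (h.pd2 b c) (by norm_num) a

theorem Pre.comm2 (h : Pre n f U V B μ) (a b) : EqOn (pd a (pd b f)) (pd b (pd a f)) (U ×ˢ V) :=
  pd_comm h.oUV (h.sm.of_le (by norm_num)) a b
/-- `abc -> bca`. -/
theorem Pre.comm3 (h : Pre n f U V B μ) (a b c) :
    EqOn (pd a (pd b (pd c f))) (pd b (pd c (pd a f))) (U ×ˢ V) :=
  (pd_comm h.oUV ((h.pd1 c).of_le (by norm_num)) a b).trans
    (pd_congr h.oUV (h.comm2 a c) b)
theorem Pre.comm4 (h : Pre n f U V B μ) (a b c d) :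
    EqOn (pd a (pd b (pd c (pd d f)))) (pd b (pd c (pd d (pd a f)))) (U ×ˢ V) :=
  (pd_comm h.oUV (h.pd2 c d) a b).trans (pd_congr h.oUV (h.comm3 a c d) b)

/-- existence of second order correction vectors -/
theorem Pre.exists_corr (h : Pre n f U V B μ) {z} (hz : z ∈ U ×ˢ V) (b : Euc n) :
    ∃ a : Euc n, ∀ w : Euc n, pd (a, 0) (pd (0, w) f) z = inner ℝ b w := by
  have hd : DifferentiableAt ℝ (fderiv ℝ f) z :=
    ((h.sm.fderiv_of_isOpen h.oUV (m := 1) (by norm_num)).contDiffAt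
      (h.oUV.mem_nhds hz)).differentiableAt (by norm_num)
  let L : Euc n →ₗ[ℝ] Euc n :=
    { toFun := fun a => (InnerProductSpace.toDual ℝ (Euc n)).symm
        ((fderiv ℝ (fderiv ℝ f) z (a, 0)).comp (ContinuousLinearMap.inr ℝ (Euc n) (Euc n)))
      map_add' := by
        intro a b
        rw [← map_add, ← ContinuousLinearMap.add_comp, ← map_add]; simp
      map_smul' := by
        intro r a
        rw [show ((r • a, (0 : Euc n)) : Euc n × Euc n) = r • (a, 0) by simp]
        rw [map_smul, ContinuousLinearMap.smul_comp]
        exact map_smul (InnerProductSpace.toDual ℝ (Euc n)).symm.toLinearEquiv _ _ }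
  have hL : ∀ a w, inner ℝ (L a) w = pd (a, 0) (pd (0, w) f) z := by
    intro a w
    rw [pd_eq_snd h.oUV (h.sm.of_le (by norm_num)) hz]
    simp only [L, LinearMap.coe_mk, AddHom.coe_mk]
    rw [InnerProductSpace.toDual_symm_apply]; rfl
  have hi : Function.Injective L := by
    refine (injective_iff_map_eq_zero _).2 fun v hv => ?_
    obtain ⟨w, _, hw⟩ := h.inv1 z hz v
    rw [← hL, hv, inner_zero_left] at hw
    have := h.hμ
    have h : ‖v‖ ≤ 0 := by by_contra h; push Not at h; nlinarith [mul_pos this h]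
    simpa using h
  obtain ⟨a, ha⟩ := (LinearMap.injective_iff_surjective.1 hi) b
  exact ⟨a, fun w => by rw [← hL, ha]⟩

/-- A linear functional is an inner product: third-order version. -/
theorem Pre.exists_third (h : Pre n f U V B μ) {z} (hz : z ∈ U ×ˢ V) (v : Euc n) :
    ∃ b : Euc n, ∀ w : Euc n, pd (v, 0) (pd (v, 0) (pd (0, w) f)) z = inner ℝ b w := by
  refine ⟨gY (pd (v, 0) (pd (v, 0) f)) z.1 z.2, fun w => ?_⟩
  rw [inner_gY]
  rw [(h.comm3 (0, w) (v, 0) (v, 0)) hz]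

theorem Pre.swap (h : Pre n f U V B μ) : Pre n (f ∘ sw n) V U B μ := by
  have hmem : ∀ z, z ∈ V ×ˢ U → sw n z ∈ U ×ˢ V := fun z hz => ⟨hz.2, hz.1⟩
  have hn : ∀ z, ‖sw n z‖ = ‖z‖ := fun z => by
    change ‖(z.2, z.1)‖ = ‖z‖
    simp [Prod.norm_def, max_comm]
  refine ⟨h.oV, h.oU, ?_, h.hB, h.hμ, ?_, ?_, ?_, ?_, ?_, ?_, ?_, ?_, ?_, ?_⟩
  · exact h.sm.comp (sw n).contDiff.contDiffOn hmem
  · intro z hz a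
    simp only [pd_comp_equiv]
    simpa only [hn, Function.comp] using h.b1 _ (hmem z hz) (sw n a)
  · intro z hz a b
    simp only [pd_comp_equiv]
    simpa only [hn, Function.comp] using h.b2 _ (hmem z hz) (sw n a) (sw n b)
  · intro z hz a b c
    simp only [pd_comp_equiv]
    simpa only [hn, Function.comp] using h.b3 _ (hmem z hz) (sw n a) (sw n b) (sw n c)
  · intro z hz a b c d
    simp only [pd_comp_equiv]
    simpa only [hn, Function.comp] using h.b4 _ (hmem z hz) (sw n a) (sw n b) (sw n c) (sw n d)
  · intro z hz v
    obtain ⟨w, h1, h2⟩ := h.inv2 _ (hmem z hz) v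
    refine ⟨w, h1, ?_⟩
    simp only [pd_comp_equiv, sw_mk, Function.comp]
    rwa [h.comm2 _ _ (hmem z hz)]
  · intro z hz v
    obtain ⟨w, h1, h2⟩ := h.inv1 _ (hmem z hz) v
    refine ⟨w, h1, ?_⟩
    simp only [pd_comp_equiv, sw_mk, Function.comp]
    rwa [h.comm2 _ _ (hmem z hz)]
  · exact h.injX
  · exact h.convX
  · simpa only [gX_fs] using h.injY
  · simpa only [gX_fs] using h.convY

theorem Good.swap (h : Good n f U V B μ) : Good n (f ∘ sw n) V U B μ := by
  refine ⟨h.toPre.swap, ?_⟩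
  have hP := h.toPre
  intro z hz w v a h0 hc
  have hz' : sw n z ∈ U ×ˢ V := ⟨hz.2, hz.1⟩
  simp only [pd_comp_equiv, sw_mk, Function.comp] at *
  obtain ⟨b, hb⟩ := hP.exists_third hz' v
  obtain ⟨a1, ha1⟩ := hP.exists_corr hz' (-b)
  have hT := h.T1 _ hz' v w a1 (by rw [hP.comm2 _ _ hz', h0]) (fun w' => by
    rw [hb, ha1, inner_neg_left]; ring)
  have e1 : pd (0, w) (pd (0, w) (pd (v, 0) (pd (v, 0) f))) (sw n z)
      = pd (v, 0) (pd (v, 0) (pd (0, w) (pd (0, w) f))) (sw n z) := by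
    rw [hP.comm4 _ _ _ _ hz', hP.comm4 _ _ _ _ hz']
  have e2 := hc a1
  have e3 := ha1 a
  rw [inner_neg_left, ← hb] at e3
  have e4 : pd (0, w) (pd (0, w) (pd (a1, 0) f)) (sw n z) =
     pd (a1, 0) (pd (0, w) (pd (0, w) f)) (sw n z) := by
    rw [hP.comm3 _ _ _ hz', hP.comm3 _ _ _ hz']
  have e5 : pd (0, a) (pd (v, 0) (pd (v, 0) f)) (sw n z) =
     pd (v, 0) (pd (v, 0) (pd (0, a) f)) (sw n z) := by
    rw [hP.comm3 _ _ _ hz']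
  have e6 : pd (0, a) (pd (a1, 0) f) (sw n z) = pd (a1, 0) (pd (0, a) f) (sw n z) := by
    rw [hP.comm2 _ _ hz']
  rw [e1, e5]
  rw [e4, e6] at e2
  linarith
end

section
variable {n : ℕ} {f : Euc n × Euc n → ℝ} {U V : Set (Euc n)} {B μ : ℝ}

theorem Pre.gY_contDiff2 (h : Pre n f U V B μ) :
    ContDiffOn ℝ 3 (fun z : Euc n × Euc n => gY f z.1 z.2) (U ×ˢ V) := by
  have h1 : ContDiffOn ℝ 3 (fderiv ℝ f) (U ×ˢ V) :=
    h.sm.fderiv_of_isOpen h.oUV (by norm_num)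
  have h2 : ContDiffOn ℝ 3 (fun z => (fderiv ℝ f z).comp (ContinuousLinearMap.inr ℝ (Euc n) (Euc n)))
      (U ×ˢ V) := h1.clm_comp contDiffOn_const
  exact ((InnerProductSpace.toDual ℝ (Euc n)).symm.toContinuousLinearEquiv.contDiff (n := 3)).comp_contDiffOn h2

theorem Pre.gY_contDiff (h : Pre n f U V B μ) {y : Euc n} (hy : y ∈ V) :
    ContDiffOn ℝ 3 (fun x => gY f x y) U :=
  h.gY_contDiff2.comp (f := fun x => (x, y)) (contDiff_prodMk_left y).contDiffOn
    (fun x hx => ⟨hx, hy⟩)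

theorem Pre.gY_fderiv (h : Pre n f U V B μ) {x y : Euc n} (hx : x ∈ U) (hy : y ∈ V) (v w : Euc n) :
    inner ℝ (fderiv ℝ (fun x => gY f x y) x v) w = pd (v, 0) (pd (0, w) f) (x, y) := by
  have hd : DifferentiableAt ℝ (fun x => gY f x y) x :=
    ((h.gY_contDiff hy).contDiffAt (h.oU.mem_nhds hx)).differentiableAt (by norm_num)
  have h1 : HasFDerivAt (fun x => inner ℝ (gY f x y) w) _ x :=
    hd.hasFDerivAt.inner ℝ (hasFDerivAt_const w x)
  have h2 : DifferentiableAt ℝ (pd (0, w) f) (x, y) :=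
    ((h.pd1 (0, w)).contDiffAt (h.oUV.mem_nhds ⟨hx, hy⟩)).differentiableAt (by norm_num)
  have h3 : HasFDerivAt (fun x => pd (0, w) f (x, y))
      ((fderiv ℝ (pd (0, w) f) (x, y)).comp (ContinuousLinearMap.inl ℝ (Euc n) (Euc n))) x :=
    HasFDerivAt.comp (g := pd (0, w) f) (f := fun x => (x, y)) x h2.hasFDerivAt
      (hasFDerivAt_prodMk_left (𝕜 := ℝ) x y)
  simp only [inner_gY] at h1
  have h4 := congrArg (fun L : Euc n →L[ℝ] ℝ => L v) (h1.unique h3)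
  simpa [fderivInnerCLM_apply, pd] using h4

theorem Pre.gY_lower (h : Pre n f U V B μ) {x y : Euc n} (hx : x ∈ U) (hy : y ∈ V) (v : Euc n) :
    μ * ‖v‖ ≤ ‖fderiv ℝ (fun x => gY f x y) x v‖ := by
  obtain ⟨w, hw, h1⟩ := h.inv1 (x, y) ⟨hx, hy⟩ v
  rw [← h.gY_fderiv hx hy] at h1
  refine h1.trans ((real_inner_le_norm _ _).trans ?_)
  nlinarith [norm_nonneg (fderiv ℝ (fun x => gY f x y) x v)]

theorem Pre.gY_upper (h : Pre n f U V B μ) {x y : Euc n} (hx : x ∈ U) (hy : y ∈ V) :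
    ‖fderiv ℝ (fun x => gY f x y) x‖ ≤ B := by
  apply ContinuousLinearMap.opNorm_le_bound _ h.hB.le
  intro v
  set b := fderiv ℝ (fun x => gY f x y) x v with hb
  have h1 := h.gY_fderiv hx hy v b
  rw [← hb, real_inner_self_eq_norm_sq] at h1
  have h2 := h.b2 (x, y) ⟨hx, hy⟩ (v, 0) (0, b)
  rw [← h1, norm_inl_pair, norm_inr_pair, abs_of_nonneg (by positivity)] at h2
  by_contra hcon
  push Not at hcon
  have : 0 ≤ B * ‖v‖ := mul_nonneg h.hB.le (norm_nonneg _)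
  nlinarith

noncomputable def Xi {n : ℕ} (f : Euc n × Euc n → ℝ) (U : Set (Euc n)) (y : Euc n) : Euc n → Euc n :=
  Function.invFunOn (fun x => gY f x y) U

theorem Pre.gY_inj' (h : Pre n f U V B μ) {y : Euc n} (hy : y ∈ V) :
    ∀ x ∈ U, Function.Injective (fderiv ℝ (fun x => gY f x y) x) := by
  intro x hx
  refine (injective_iff_map_eq_zero _).2 fun v hv => ?_
  have := h.gY_lower hx hy v
  rw [hv, norm_zero] at this
  have hμ := h.hμ
  have h : ‖v‖ ≤ 0 := by by_contra h; push Not at h; nlinarith [mul_pos hμ h]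
  simpa using h

theorem Pre.open_image (h : Pre n f U V B μ) {y : Euc n} (hy : y ∈ V) :
    IsOpen ((fun x => gY f x y) '' U) :=
  (chart_local (by norm_num) h.oU (h.gY_contDiff hy) (h.injY y hy) (h.gY_inj' hy)).1

theorem Pre.Xi_contDiff (h : Pre n f U V B μ) {y : Euc n} (hy : y ∈ V) :
    ContDiffOn ℝ 3 (Xi f U y) ((fun x => gY f x y) '' U) :=
  (chart_local (by norm_num) h.oU (h.gY_contDiff hy) (h.injY y hy) (h.gY_inj' hy)).2

theorem Pre.Xi_fderiv (h : Pre n f U V B μ) {y : Euc n} (hy : y ∈ V) :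
    ∀ q ∈ (fun x => gY f x y) '' U, ‖fderiv ℝ (Xi f U y) q‖ ≤ μ⁻¹ :=
  chart_inv_fderiv (by norm_num) h.oU (h.gY_contDiff hy) (h.injY y hy) h.hμ
    (fun x hx v => h.gY_lower hx hy v)

theorem Xi_mem {y q : Euc n} (hq : q ∈ (fun x => gY f x y) '' U) : Xi f U y q ∈ U :=
  Function.invFunOn_mem hq
theorem gY_Xi {y q : Euc n} (hq : q ∈ (fun x => gY f x y) '' U) : gY f (Xi f U y q) y = q :=
  Function.invFunOn_eq hq
theorem Pre.Xi_gY (h : Pre n f U V B μ) {x y : Euc n} (hx : x ∈ U) (hy : y ∈ V) :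
    Xi f U y (gY f x y) = x :=
  h.injY y hy (Xi_mem (mem_image_of_mem _ hx)) hx (gY_Xi (mem_image_of_mem _ hx))

/-- Properties of a `c`-segment. -/
structure IsSeg {n : ℕ} (f : Euc n × Euc n → ℝ) (U : Set (Euc n)) (y q d : Euc n)
    (X X1 X2 : ℝ → Euc n) (s : ℝ) : Prop where
  mem : X s ∈ U
  eq : gY f (X s) y = q + s • d
  h1 : HasDerivAt X (X1 s) s
  h2 : HasDerivAt X1 (X2 s) s
  c1 : ∀ w, pd (X1 s, 0) (pd (0, w) f) (X s, y) = inner ℝ d w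
  c2 : ∀ w, pd (X1 s, 0) (pd (X1 s, 0) (pd (0, w) f)) (X s, y)
    + pd (X2 s, 0) (pd (0, w) f) (X s, y) = 0

theorem Pre.isSeg (h : Pre n f U V B μ) {y : Euc n} (hy : y ∈ V) (q d : Euc n) (s : ℝ)
    (hs : q + s • d ∈ (fun x => gY f x y) '' U) :
    IsSeg f U y q d (fun s => Xi f U y (q + s • d)) (deriv (fun s => Xi f U y (q + s • d)))
      (deriv (deriv (fun s => Xi f U y (q + s • d)))) s := by
  set X : ℝ → Euc n := fun s => Xi f U y (q + s • d) with hX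
  set O : Set ℝ := (fun s => q + s • d) ⁻¹' ((fun x => gY f x y) '' U) with hO
  have oO : IsOpen O := (h.open_image hy).preimage (by fun_prop)
  have hXs : ContDiffOn ℝ 3 X O :=
    (h.Xi_contDiff hy).comp (f := fun s : ℝ => q + s • d) (by fun_prop) (fun s hs => hs)
  have hX1s : ContDiffOn ℝ 2 (deriv X) O := hXs.deriv_of_isOpen oO (by norm_num)
  have hD1 : ∀ r ∈ O, HasDerivAt X (deriv X r) r := fun r hr =>
    ((hXs.contDiffAt (oO.mem_nhds hr)).differentiableAt (by norm_num)).hasDerivAt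
  have hD2 : ∀ r ∈ O, HasDerivAt (deriv X) (deriv (deriv X) r) r := fun r hr =>
    ((hX1s.contDiffAt (oO.mem_nhds hr)).differentiableAt (by norm_num)).hasDerivAt
  have hmem : ∀ r ∈ O, X r ∈ U := fun r hr => Xi_mem hr
  have heq : ∀ r ∈ O, gY f (X r) y = q + r • d := fun r hr => gY_Xi hr
  have hz1 : ∀ r ∈ O, HasDerivAt (fun r => (X r, y)) (deriv X r, 0) r := fun r hr =>
    (hD1 r hr).prodMk (hasDerivAt_const r y)
  have hz2 : ∀ r ∈ O, HasDerivAt (fun r => (deriv X r, (0 : Euc n))) (deriv (deriv X) r, 0) r :=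
    fun r hr => (hD2 r hr).prodMk (hasDerivAt_const r 0)
  have hc1 : ∀ r ∈ O, ∀ w, pd (deriv X r, 0) (pd (0, w) f) (X r, y) = inner ℝ d w := by
    intro r hr w
    have e1 := curve_deriv1 h.oUV ((h.pd1 (0, w)).of_le (by norm_num))
      (z := fun r => (X r, y)) (z1 := fun r => (deriv X r, 0)) (s := r) ⟨hmem r hr, hy⟩ (hz1 r hr)
    have e2 : HasDerivAt (fun r : ℝ => inner ℝ (q + r • d) w) (inner ℝ d w) r := by
      have : HasDerivAt (fun r : ℝ => q + r • d) d r := by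
        simpa using ((hasDerivAt_id r).smul_const d).const_add q
      simpa using this.inner ℝ (hasDerivAt_const r w)
    refine e1.unique (e2.congr_of_eventuallyEq ?_)
    filter_upwards [oO.mem_nhds hr] with p hp
    rw [← heq p hp, inner_gY]
  refine ⟨hmem s hs, heq s hs, hD1 s hs, hD2 s hs, hc1 s hs, fun w => ?_⟩
  have e1 := curve_deriv2 h.oUV ((h.pd1 (0, w)).of_le (by norm_num))
      (z := fun r => (X r, y)) (z1 := fun r => (deriv X r, 0))
      (z2 := fun r => (deriv (deriv X) r, 0)) (s := s) ⟨hmem s hs, hy⟩ (hz1 s hs) (hz2 s hs)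
  refine e1.unique ((hasDerivAt_const s (inner ℝ d w)).congr_of_eventuallyEq ?_)
  filter_upwards [oO.mem_nhds hs] with p hp
  exact hc1 p hp w

/-- Bounds along segments -/
theorem IsSeg.norm_X1 (h : Pre n f U V B μ) {y q d : Euc n} (hy : y ∈ V) {X X1 X2 : ℝ → Euc n}
    {s : ℝ} (hs : IsSeg f U y q d X X1 X2 s) : μ * ‖X1 s‖ ≤ ‖d‖ := by
  obtain ⟨w, hw, h1⟩ := h.inv1 (X s, y) ⟨hs.mem, hy⟩ (X1 s)
  rw [hs.c1] at h1
  refine h1.trans ((real_inner_le_norm _ _).trans ?_)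
  nlinarith [norm_nonneg d]

theorem Pre.norm_corr (h : Pre n f U V B μ) {z} (hz : z ∈ U ×ˢ V) {v a : Euc n}
    (hc : ∀ w' : Euc n, pd (v, 0) (pd (v, 0) (pd (0, w') f)) z + pd (a, 0) (pd (0, w') f) z = 0) :
    μ * ‖a‖ ≤ B * ‖v‖ * ‖v‖ := by
  obtain ⟨w, hw, h1⟩ := h.inv1 z hz a
  have h2 := h.b3 z hz (v, 0) (v, 0) (0, w)
  rw [norm_inl_pair, norm_inr_pair] at h2
  have h3 := (abs_le.1 h2).1
  have h4 := hc w
  have h5 : B * ‖v‖ * ‖v‖ * ‖w‖ ≤ B * ‖v‖ * ‖v‖ :=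
    mul_le_of_le_one_right (mul_nonneg (mul_nonneg h.hB.le (norm_nonneg _)) (norm_nonneg _)) hw
  linarith

theorem Pre.norm_gY_le (h : Pre n f U V B μ) {x y : Euc n} (hx : x ∈ U) (hy : y ∈ V) :
    ‖gY f x y‖ ≤ B := by
  have h1 := h.b1 (x, y) ⟨hx, hy⟩ (0, gY f x y)
  rw [← inner_gY, real_inner_self_eq_norm_sq, norm_inr_pair, abs_of_nonneg (by positivity)] at h1
  by_contra hcon
  push Not at hcon
  have := h.hB
  nlinarith
end

section
variable {n : ℕ} {f : Euc n × Euc n → ℝ} {U V : Set (Euc n)} {B μ : ℝ}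

noncomputable def Crel (B μ : ℝ) : ℝ := 3 * (B + B ^ 2 / μ) / μ

theorem Good.relaxed (h : Good n f U V B μ) {z} (hz : z ∈ U ×ˢ V) {v a : Euc n} (w : Euc n)
    (hc : ∀ w' : Euc n, pd (v, 0) (pd (v, 0) (pd (0, w') f)) z + pd (a, 0) (pd (0, w') f) z = 0) :
    pd (v, 0) (pd (v, 0) (pd (0, w) (pd (0, w) f))) z + pd (a, 0) (pd (0, w) (pd (0, w) f)) z
      ≤ Crel B μ * ‖v‖ * ‖w‖ * |pd (v, 0) (pd (0, w) f) z| := by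
  have hP := h.toPre
  have hB := hP.hB
  have hμ := hP.hμ
  set G : Euc n → Euc n → ℝ := fun w w' => pd (0, w) (pd (0, w') (pd (v, 0) (pd (v, 0) f))) z
    + pd (0, w) (pd (0, w') (pd (a, 0) f)) z with hG
  have hGeq : ∀ w, pd (v, 0) (pd (v, 0) (pd (0, w) (pd (0, w) f))) z
      + pd (a, 0) (pd (0, w) (pd (0, w) f)) z = G w w := by
    intro w
    simp only [hG]
    rw [hP.comm4 (v, 0) (v, 0) _ _ hz, hP.comm4 (v, 0) _ _ _ hz, hP.comm3 (a, 0) _ _ hz]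
  have hadd : ∀ w1 w2 w', G (w1 + w2) w' = G w1 w' + G w2 w' := by
    intro w1 w2 w'
    simp only [hG]
    rw [show ((0, w1 + w2) : Euc n × Euc n) = (0, w1) + (0, w2) by simp, pd_add_vec, pd_add_vec]
    simp only [Pi.add_apply]; ring
  have hsymm : ∀ w1 w2, G w1 w2 = G w2 w1 := by
    intro w1 w2
    simp only [hG]
    rw [pd_comm hP.oUV (hP.pd2 _ _) _ _ hz, pd_comm hP.oUV ((hP.pd1 _).of_le (by norm_num)) _ _ hz]
  set K : ℝ := B * ‖v‖ * ‖v‖ + B * ‖a‖ with hK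
  have hbd : ∀ w1 w2, G w1 w2 ≤ K * ‖w1‖ * ‖w2‖ := by
    intro w1 w2
    have h1 := (abs_le.1 (hP.b4 z hz (0, w1) (0, w2) (v, 0) (v, 0))).2
    have h2 := (abs_le.1 (hP.b3 z hz (0, w1) (0, w2) (a, 0))).2
    simp only [norm_inl_pair, norm_inr_pair] at h1 h2
    simp only [hG, hK]
    nlinarith
  have hcorr := hP.norm_corr hz hc
  have hK2 : K ≤ (B + B ^ 2 / μ) * ‖v‖ ^ 2 := by
    have : ‖a‖ ≤ B * ‖v‖ * ‖v‖ / μ := by rw [le_div_iff₀ hμ]; linarith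
    calc K ≤ B * ‖v‖ * ‖v‖ + B * (B * ‖v‖ * ‖v‖ / μ) := by
          simp only [hK]; gcongr
      _ = _ := by ring
  have hK0 : 0 ≤ K := by simp only [hK]; positivity
  rw [hGeq]
  set b := fderiv ℝ (fun x => gY f x z.2) z.1 v with hb
  have hbw : ∀ w, inner ℝ b w = pd (v, 0) (pd (0, w) f) z := fun w => hP.gY_fderiv hz.1 hz.2 v w
  have hbl : μ * ‖v‖ ≤ ‖b‖ := hP.gY_lower hz.1 hz.2 v
  rcases eq_or_ne v 0 with hv | hv
  · have h1 := hbd w w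
    have : K ≤ 0 := by simpa [hv] using hK2
    have hK' : K = 0 := le_antisymm this hK0
    simpa [hv, hK'] using h1
  have hvp : 0 < ‖v‖ := norm_pos_iff.2 hv
  have hbp : 0 < ‖b‖ := lt_of_lt_of_le (by positivity) hbl
  set β := inner ℝ b w with hβ
  set r := (β / ‖b‖ ^ 2) • b with hr
  have hrn : ‖r‖ * ‖b‖ = |β| := by
    rw [hr, norm_smul, Real.norm_eq_abs, abs_div, abs_of_nonneg (sq_nonneg ‖b‖)]
    field_simp
  have hrw : ‖r‖ ≤ ‖w‖ := by
    have := abs_real_inner_le_norm b w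
    rw [← hβ, ← hrn] at this
    by_contra hcon
    push Not at hcon
    nlinarith
  set w0 := w - r with hw0
  have hw0n : ‖w0‖ ≤ 2 * ‖w‖ := (norm_sub_le _ _).trans (by linarith)
  have hw0b : pd (v, 0) (pd (0, w0) f) z = 0 := by
    rw [← hbw, hw0, inner_sub_right, hr, inner_smul_right, real_inner_self_eq_norm_sq, ← hβ]
    field_simp; ring
  have hT := h.T1 z hz v w0 a hw0b hc
  rw [hGeq] at hT
  have hw : w = w0 + r := by simp [hw0]
  have hexp : G w w = G w0 w0 + G r w0 + G r w := by
    have e1 : G w w = G w0 w + G r w := by rw [← hadd, ← hw]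
    have e2 : G w w0 = G w0 w0 + G r w0 := by rw [← hadd, ← hw]
    rw [e1, hsymm w0 w, e2]
  have h1 := hbd r w0
  have h2 := hbd r w
  have h3 : K * ‖r‖ * ‖w0‖ ≤ K * ‖r‖ * (2 * ‖w‖) := by gcongr
  have h4 : G w w ≤ 3 * K * ‖r‖ * ‖w‖ := by rw [hexp]; linarith
  refine h4.trans ?_
  rw [← hbw, ← hβ, Crel]
  have h5 : ‖v‖ * ‖r‖ ≤ |β| / μ := by
    rw [le_div_iff₀ hμ, ← hrn]
    nlinarith [norm_nonneg r]
  calc 3 * K * ‖r‖ * ‖w‖ ≤ 3 * ((B + B ^ 2 / μ) * ‖v‖ ^ 2) * ‖r‖ * ‖w‖ := by gcongr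
    _ = 3 * (B + B ^ 2 / μ) * ‖v‖ * ‖w‖ * (‖v‖ * ‖r‖) := by ring
    _ ≤ 3 * (B + B ^ 2 / μ) * ‖v‖ * ‖w‖ * (|β| / μ) := by gcongr
    _ = _ := by ring

noncomputable def Ckey (B μ : ℝ) : ℝ := Crel B μ * (2 * B / μ) * (2 * B / μ)

theorem Ckey_nonneg (h : Pre n f U V B μ) : 0 ≤ Ckey B μ := by
  have := h.hB; have := h.hμ
  unfold Ckey Crel; positivity

theorem Pre.diff_bound (h : Pre n f U V B μ) {x x' y : Euc n} (hx : x ∈ U) (hx' : x' ∈ U) (hy : y ∈ V) :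
    ‖gY f x y - gY f x' y‖ ≤ 2 * B :=
  (norm_sub_le _ _).trans (by linarith [h.norm_gY_le hx hy, h.norm_gY_le hx' hy])

/-- The c-segment in the first variable. -/
noncomputable def segX {n : ℕ} (f : Euc n × Euc n → ℝ) (U : Set (Euc n)) (y x0 x1 : Euc n) (s : ℝ) : Euc n :=
  Xi f U y (gY f x0 y + s • (gY f x1 y - gY f x0 y))

theorem Pre.segX_isSeg (h : Pre n f U V B μ) {x0 x1 y : Euc n} (hx0 : x0 ∈ U) (hx1 : x1 ∈ U)
    (hy : y ∈ V) {s : ℝ} (hs : s ∈ Icc (0:ℝ) 1) :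
    IsSeg f U y (gY f x0 y) (gY f x1 y - gY f x0 y) (segX f U y x0 x1)
      (deriv (segX f U y x0 x1)) (deriv (deriv (segX f U y x0 x1))) s := by
  apply h.isSeg hy
  have := (h.convY y hy) (mem_image_of_mem (fun x => gY f x y) hx0) (mem_image_of_mem _ hx1)
    (sub_nonneg.2 hs.2) hs.1 (by ring)
  convert this using 1
  module

theorem Pre.segX_zero (h : Pre n f U V B μ) {x0 x1 y : Euc n} (hx0 : x0 ∈ U) (hy : y ∈ V) :
    segX f U y x0 x1 0 = x0 := by simp [segX, h.Xi_gY hx0 hy]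
theorem Pre.segX_one (h : Pre n f U V B μ) {x0 x1 y : Euc n} (hx1 : x1 ∈ U) (hy : y ∈ V) :
    segX f U y x0 x1 1 = x1 := by simp [segX, h.Xi_gY hx1 hy]

theorem curve_fst {g : Euc n × Euc n → ℝ} {O : Set (Euc n × Euc n)} (hO : IsOpen O)
    (hg : ContDiffOn ℝ 1 g O) {X X1 : ℝ → Euc n} {y : Euc n} {s : ℝ} (hz : (X s, y) ∈ O)
    (h1 : HasDerivAt X (X1 s) s) :
    HasDerivAt (fun r => g (X r, y)) (pd (X1 s, 0) g (X s, y)) s :=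
  curve_deriv1 hO hg (z := fun r => (X r, y)) (z1 := fun r => (X1 r, 0)) hz
    (h1.prodMk (hasDerivAt_const s y))

theorem curve_fst2 {g : Euc n × Euc n → ℝ} {O : Set (Euc n × Euc n)} (hO : IsOpen O)
    (hg : ContDiffOn ℝ 2 g O) {X X1 X2 : ℝ → Euc n} {y : Euc n} {s : ℝ} (hz : (X s, y) ∈ O)
    (h1 : HasDerivAt X (X1 s) s) (h2 : HasDerivAt X1 (X2 s) s) :
    HasDerivAt (fun r => pd (X1 r, 0) g (X r, y))
      (pd (X1 s, 0) (pd (X1 s, 0) g) (X s, y) + pd (X2 s, 0) g (X s, y)) s :=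
  curve_deriv2 hO hg (z := fun r => (X r, y)) (z1 := fun r => (X1 r, 0))
    (z2 := fun r => (X2 r, 0)) hz
    (h1.prodMk (hasDerivAt_const s y)) (h2.prodMk (hasDerivAt_const s 0))

/-- Key inequality: `g(s) = f(x_s, y0) - f(x_s, y1)` along a segment with respect to `y0`. -/
theorem Good.key (h : Good n f U V B μ) {x0 x1 y0 y1 : Euc n} (hx0 : x0 ∈ U) (hx1 : x1 ∈ U)
    (hy0 : y0 ∈ V) (hy1 : y1 ∈ V) : ∃ k1 k2 : ℝ → ℝ,
    (∀ s ∈ Icc (0:ℝ) 1, HasDerivAt (fun s => f (segX f U y0 x0 x1 s, y0)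
        - f (segX f U y0 x0 x1 s, y1)) (k1 s) s) ∧
    (∀ s ∈ Icc (0:ℝ) 1, HasDerivAt k1 (k2 s) s) ∧
    (∀ s ∈ Icc (0:ℝ) 1, -Ckey B μ * |k1 s| ≤ k2 s) := by
  have hP := h.toPre
  have hB := hP.hB
  have hμ := hP.hμ
  set X := segX f U y0 x0 x1 with hX
  set X1 := deriv X with hX1
  set X2 := deriv X1 with hX2
  set d := gY f x1 y0 - gY f x0 y0 with hd
  have hseg : ∀ s ∈ Icc (0:ℝ) 1, IsSeg f U y0 (gY f x0 y0) d X X1 X2 s := fun s hs =>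
    hP.segX_isSeg hx0 hx1 hy0 hs
  refine ⟨fun s => pd (X1 s, 0) f (X s, y0) - pd (X1 s, 0) f (X s, y1),
    fun s => (pd (X1 s, 0) (pd (X1 s, 0) f) (X s, y0) + pd (X2 s, 0) f (X s, y0))
      - (pd (X1 s, 0) (pd (X1 s, 0) f) (X s, y1) + pd (X2 s, 0) f (X s, y1)), ?_, ?_, ?_⟩
  · intro s hs
    have := hseg s hs
    exact (curve_fst hP.oUV (hP.sm.of_le (by norm_num)) ⟨this.mem, hy0⟩ this.h1).sub
      (curve_fst hP.oUV (hP.sm.of_le (by norm_num)) ⟨this.mem, hy1⟩ this.h1)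
  · intro s hs
    have := hseg s hs
    exact (curve_fst2 hP.oUV (hP.sm.of_le (by norm_num)) ⟨this.mem, hy0⟩ this.h1 this.h2).sub
      (curve_fst2 hP.oUV (hP.sm.of_le (by norm_num)) ⟨this.mem, hy1⟩ this.h1 this.h2)
  · intro s hs
    have hs' := hseg s hs
    set x := X s with hx
    have hxU : x ∈ U := hs'.mem
    set v := X1 s with hv
    set a := X2 s with ha
    -- now the y-segment with respect to x, for the swapped cost
    have hS := h.swap
    have hSP := hS.toPre
    set f' := f ∘ sw n with hf'
    set Y := segX f' V x y0 y1 with hY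
    set Y1 := deriv Y with hY1
    set Y2 := deriv Y1 with hY2
    have hYs : ∀ t ∈ Icc (0:ℝ) 1, IsSeg f' V x (gY f' y0 x) (gY f' y1 x - gY f' y0 x) Y Y1 Y2 t :=
      fun t ht => hSP.segX_isSeg hy0 hy1 hxU ht
    have hY0 : Y 0 = y0 := hSP.segX_zero hy0 hxU
    have hY1' : Y 1 = y1 := hSP.segX_one hy1 hxU
    set H : Euc n × Euc n → ℝ := fun z => -(pd (0, v) (pd (0, v) f') z + pd (0, a) f' z) with hH
    have hHs : ContDiffOn ℝ 2 H (V ×ˢ U) :=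
      ((hSP.pd2 _ _).add ((hSP.pd1 _).of_le (by norm_num))).neg
    have hpdH : ∀ b z, z ∈ V ×ˢ U → pd b H z = -(pd b (pd (0, v) (pd (0, v) f')) z
        + pd b (pd (0, a) f') z) := by
      intro b z hz
      have d1 := (((hSP.pd2 (0, v) (0, v)).contDiffAt (hSP.oUV.mem_nhds hz)).differentiableAt
        (by norm_num)).hasFDerivAt
      have d2 := (((hSP.pd1 (0, a)).contDiffAt (hSP.oUV.mem_nhds hz)).differentiableAt
        (by norm_num)).hasFDerivAt
      have := (d1.add d2).neg.fderiv
      simp only [hH]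
      change fderiv ℝ (-(pd (0, v) (pd (0, v) f') + pd (0, a) f')) z b = _
      rw [this]; simp [pd]
    have hpdH2 : ∀ b b' z, z ∈ V ×ˢ U → pd b' (pd b H) z = -(pd b' (pd b (pd (0, v) (pd (0, v) f'))) z
        + pd b' (pd b (pd (0, a) f')) z) := by
      intro b b' z hz
      have e : EqOn (pd b H) (-(pd b (pd (0, v) (pd (0, v) f')) + pd b (pd (0, a) f'))) (V ×ˢ U) :=
        fun z hz => hpdH b z hz
      rw [pd_congr hSP.oUV e b' hz]
      have d1 := (((hSP.pd3 b (0, v) (0, v)).contDiffAt (hSP.oUV.mem_nhds hz)).differentiableAt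
        (by norm_num)).hasFDerivAt
      have d2 := (((hSP.pd2 b (0, a)).contDiffAt (hSP.oUV.mem_nhds hz)).differentiableAt
        (by norm_num)).hasFDerivAt
      have := (d1.add d2).neg.fderiv
      rw [pd, this]; simp [pd]
    have T := one_dim_taylor (A := Ckey B μ * |pd (v, 0) f (x, y0) - pd (v, 0) f (x, y1)|)
      (f := fun t => H (Y t, x)) (f1 := fun t => pd (Y1 t, 0) H (Y t, x))
      (f2 := fun t => pd (Y1 t, 0) (pd (Y1 t, 0) H) (Y t, x) + pd (Y2 t, 0) H (Y t, x))
      (fun t ht => curve_fst hSP.oUV (hHs.of_le (by norm_num)) ⟨(hYs t ht).mem, hxU⟩ (hYs t ht).h1)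
      (fun t ht => curve_fst2 hSP.oUV hHs ⟨(hYs t ht).mem, hxU⟩ (hYs t ht).h1 (hYs t ht).h2)
      ?_ (mul_nonneg (Ckey_nonneg hP) (abs_nonneg _)) ?_
    · simp only [hY0, hY1', hH, hf', pd_comp_equiv, Function.comp, sw_mk] at T
      linarith
    · intro t ht
      have hyt := hYs t ht
      have hz : (Y t, x) ∈ V ×ˢ U := ⟨hyt.mem, hxU⟩
      rw [hpdH2 _ _ _ hz, hpdH _ _ hz]
      have R := hS.relaxed hz v hyt.c2
      have hc2 := hyt.c2 a
      have hc1 := hyt.c1 v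
      have e1 : inner ℝ (gY f' y1 x - gY f' y0 x) v = pd (v, 0) f (x, y1) - pd (v, 0) f (x, y0) := by
        rw [inner_sub_left, inner_gY, inner_gY]
        simp only [hf', pd_comp_equiv, Function.comp, sw_mk]
      rw [hc1, e1, abs_sub_comm] at R
      have n1 : ‖v‖ ≤ 2 * B / μ := by
        rw [le_div_iff₀ hμ]
        have := hs'.norm_X1 hP hy0
        linarith [hP.diff_bound hx1 hx0 hy0]
      have n2 : ‖Y1 t‖ ≤ 2 * B / μ := by
        rw [le_div_iff₀ hμ]
        have := hyt.norm_X1 hSP hxU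
        linarith [hSP.diff_bound hy1 hy0 hxU]
      have hCr : 0 ≤ Crel B μ := by unfold Crel; positivity
      have R2 : Crel B μ * ‖Y1 t‖ * ‖v‖ * |pd (v, 0) f (x, y0) - pd (v, 0) f (x, y1)|
          ≤ Ckey B μ * |pd (v, 0) f (x, y0) - pd (v, 0) f (x, y1)| := by
        unfold Ckey; gcongr
      linarith
    · have h0 : (0:ℝ) ∈ Icc (0:ℝ) 1 := ⟨le_rfl, zero_le_one⟩
      have hz : (Y 0, x) ∈ V ×ˢ U := ⟨(hYs 0 h0).mem, hxU⟩
      have hz' : (x, y0) ∈ U ×ˢ V := ⟨hxU, hy0⟩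
      have := hs'.c2 (Y1 0)
      rw [hpdH _ _ hz]
      simp only [hY0, hf', pd_comp_equiv, Function.comp, sw_mk]
      rw [hP.comm3 _ _ _ hz', hP.comm2 _ _ hz', this, neg_zero]
end

theorem convex_neg_image {n : ℕ} {g : Euc n → Euc n} {V : Set (Euc n)}
    (h : Convex ℝ ((fun x => -g x) '' V)) : Convex ℝ (g '' V) := by
  have := h.neg
  have e : -((fun x => -g x) '' V) = g '' V := by
    ext x; simp [Set.mem_neg]
  rwa [e] at this

theorem body_lemma {n : ℕ} {g : Euc n → Euc n} {V : Set (Euc n)} (oV : IsOpen V)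
    (hb : IsBounded V) (hne : V.Nonempty) (hg : DiffeoOnto n g (closure V)) (hc : Convex ℝ (g '' V)) :
    UniqueDiffOn ℝ (closure V) ∧ volume (frontier V) = 0 ∧
      ∃ m > 0, ∀ x ∈ closure V, ∀ x' ∈ closure V, m * ‖x - x'‖ ≤ ‖g x - g x'‖ := by
  obtain ⟨hinj, hgs, hhs⟩ := hg
  set h := Function.invFunOn g (closure V) with hh
  set K := g '' closure V with hK
  have hsub : V ⊆ closure V := subset_closure
  have hhg : ∀ x ∈ closure V, h (g x) = x := fun x hx => hinj.leftInvOn_invFunOn hx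
  have hgh : ∀ p ∈ K, g (h p) = p := fun p hp => Function.invFunOn_eq hp
  have hgV : ContDiffOn ℝ 1 g V := hgs.mono hsub
  have hcV : IsCompact (closure V) := hb.isCompact_closure
  have hKc : IsCompact K := hcV.image_of_continuousOn hgs.continuousOn
  have hder : ∀ x ∈ V, Function.Injective (fderiv ℝ g x) := by
    intro x hx
    have h1 : HasFDerivAt g (fderiv ℝ g x) x :=
      ((hgV.contDiffAt (oV.mem_nhds hx)).differentiableAt (by norm_num)).hasFDerivAt
    have h2 : HasFDerivWithinAt h (fderivWithin ℝ h K (g x)) K (g x) :=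
      ((hhs (g x) ⟨x, hsub hx, rfl⟩).differentiableWithinAt (by norm_num)).hasFDerivWithinAt
    have h3 : HasFDerivWithinAt (h ∘ g) ((fderivWithin ℝ h K (g x)).comp (fderiv ℝ g x)) V x :=
      h2.comp x h1.hasFDerivWithinAt (fun z hz => ⟨z, hsub hz, rfl⟩)
    have h4 : HasFDerivWithinAt (h ∘ g) (ContinuousLinearMap.id ℝ (Euc n)) V x :=
      (hasFDerivWithinAt_id x V).congr (fun z hz => hhg z (hsub hz)) (hhg x (hsub hx))
    have h5 := (oV.uniqueDiffWithinAt hx).eq h3 h4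
    intro a b hab
    have := congrArg (fun L : Euc n →L[ℝ] Euc n => L a) h5
    have h6 := congrArg (fun L : Euc n →L[ℝ] Euc n => L b) h5
    simp only [ContinuousLinearMap.comp_apply, ContinuousLinearMap.id_apply] at this h6
    rw [← this, ← h6, hab]
  have hopen : IsOpen (g '' V) :=
    (chart_local one_ne_zero oV hgV (hinj.mono hsub) hder).1
  have hKcl : K = closure (g '' V) := by
    apply Subset.antisymm
    · exact hgs.continuousOn.image_closure
    · exact closure_minimal (image_mono hsub) hKc.isClosed
  have hKconv : Convex ℝ K := by rw [hKcl]; exact hc.closure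
  have hKint : (interior K).Nonempty := by
    refine (hne.image g).mono ?_
    exact interior_maximal (image_mono hsub) hopen
  have hKu : UniqueDiffOn ℝ K := uniqueDiffOn_convex hKconv hKint
  have hhd : ∀ p ∈ K, HasFDerivWithinAt h (fderivWithin ℝ h K p) K p := fun p hp =>
    ((hhs p hp).differentiableWithinAt (by norm_num)).hasFDerivWithinAt
  have himg : h '' K = closure V := by
    ext x; constructor
    · rintro ⟨p, hp, rfl⟩; exact Function.invFunOn_mem hp
    · intro hx; exact ⟨g x, ⟨x, hx, rfl⟩, hhg x hx⟩
  refine ⟨?_, ?_, ?_⟩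
  · intro x hx
    have hp : g x ∈ K := ⟨x, hx, rfl⟩
    have h2 := hhd (g x) hp
    have h1 : HasFDerivWithinAt g (fderivWithin ℝ g (closure V) x) (closure V) x :=
      ((hgs x hx).differentiableWithinAt (by norm_num)).hasFDerivWithinAt
    have h3 : HasFDerivWithinAt (g ∘ h)
        ((fderivWithin ℝ g (closure V) x).comp (fderivWithin ℝ h K (g x))) K (g x) := by
      have h1' : HasFDerivWithinAt g (fderivWithin ℝ g (closure V) x) (closure V) (h (g x)) := by
        rw [hhg x hx]; exact h1
      exact h1'.comp (g x) h2 (fun p hp => Function.invFunOn_mem hp)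
    have h4 : HasFDerivWithinAt (g ∘ h) (ContinuousLinearMap.id ℝ (Euc n)) K (g x) :=
      (hasFDerivWithinAt_id (g x) K).congr (fun z hz => hgh z hz) (hgh _ hp)
    have h5 := (hKu (g x) hp).eq h3 h4
    have hinj' : Function.Injective (fderivWithin ℝ h K (g x)) := by
      intro a b hab
      have e1 := congrArg (fun L : Euc n →L[ℝ] Euc n => L a) h5
      have e2 := congrArg (fun L : Euc n →L[ℝ] Euc n => L b) h5
      simp only [ContinuousLinearMap.comp_apply, ContinuousLinearMap.id_apply] at e1 e2
      rw [← e1, ← e2, hab]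
    obtain ⟨e, he⟩ := exists_equiv_of_injective _ hinj'
    have := h2.uniqueDiffWithinAt (hKu (g x) hp) (by rw [← he]; exact e.surjective.denseRange)
    rwa [himg, hhg x hx] at this
  · have hsub2 : frontier V ⊆ h '' (frontier (g '' V)) := by
      intro x hx
      have hxc : x ∈ closure V := frontier_subset_closure hx
      refine ⟨g x, ?_, hhg x hxc⟩
      rw [hopen.frontier_eq, ← hKcl]
      refine ⟨⟨x, hxc, rfl⟩, ?_⟩
      rintro ⟨x', hx', he⟩
      have := hinj (hsub hx') hxc he
      rw [oV.frontier_eq] at hx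
      exact hx.2 (this ▸ hx')
    refine measure_mono_null hsub2 ?_
    apply addHaar_image_eq_zero_of_differentiableOn_of_addHaar_eq_zero
    · intro p hp
      have hpK : p ∈ K := by rw [hKcl]; exact frontier_subset_closure hp
      refine ((hhd p hpK).differentiableWithinAt).mono ?_
      rw [hKcl]; exact frontier_subset_closure
    · exact hc.addHaar_frontier _
  · have hcont : ContinuousOn (fderivWithin ℝ h K) K :=
      hhs.continuousOn_fderivWithin hKu (by norm_num)
    obtain ⟨C, hC⟩ := hKc.exists_bound_of_continuousOn hcont
    refine ⟨(max C 1)⁻¹, by positivity, fun x hx x' hx' => ?_⟩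
    have := hKconv.norm_image_sub_le_of_norm_fderivWithin_le (f := h) (C := max C 1)
      (fun p hp => (hhd p hp).differentiableWithinAt)
      (fun p hp => (hC p hp).trans (le_max_left _ _)) (x := g x') (y := g x)
      ⟨x', hx', rfl⟩ ⟨x, hx, rfl⟩
    rw [hhg x hx, hhg x' hx'] at this
    rw [← div_eq_inv_mul, div_le_iff₀ (by positivity)]
    linarith

theorem lower_of_hasFDerivAt {n : ℕ} {F : Type*} [NormedAddCommGroup F] [NormedSpace ℝ F]
    {g : Euc n → F} {g' : Euc n →L[ℝ] F} {U : Set (Euc n)} {x : Euc n}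
    (hU : U ∈ nhds x) (hg : HasFDerivAt g g' x) {m : ℝ}
    (hm : ∀ z ∈ U, m * ‖z - x‖ ≤ ‖g z - g x‖) (v : Euc n) : m * ‖v‖ ≤ ‖g' v‖ := by
  have h1 : HasDerivAt (fun t : ℝ => g (x + t • v)) (g' v) 0 := by
    have h2 : HasDerivAt (fun t : ℝ => x + t • v) v 0 := by
      simpa using ((hasDerivAt_id (0:ℝ)).smul_const v).const_add x
    have h3 : HasFDerivAt g g' (x + (0:ℝ) • v) := by simpa using hg
    exact h3.comp_hasDerivAt (0:ℝ) h2
  have h2 := (hasDerivAt_iff_tendsto_slope.1 h1).norm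
  refine ge_of_tendsto h2 ?_
  have h4 : ∀ᶠ t : ℝ in nhdsWithin 0 {0}ᶜ, x + t • v ∈ U := by
    apply Filter.Eventually.filter_mono nhdsWithin_le_nhds
    have : ContinuousAt (fun t : ℝ => x + t • v) 0 := by fun_prop
    apply this.eventually
    simpa using hU
  filter_upwards [h4, self_mem_nhdsWithin] with t ht ht0
  have ht0 : t ≠ 0 := ht0
  have := hm _ ht
  rw [slope_def_module]
  simp only [sub_zero, zero_smul, add_zero, norm_smul, norm_inv]
  rw [add_sub_cancel_left, norm_smul] at this
  have hp : 0 < ‖t‖ := norm_pos_iff.2 ht0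
  rw [← div_eq_inv_mul, le_div_iff₀ hp]
  linarith

theorem gradY_eq_of_diff {n : ℕ} {c : Euc n → Euc n → ℝ} {x y : Euc n}
    {L : Euc n × Euc n →L[ℝ] ℝ} {W : Set (Euc n)} {Q : Set (Euc n × Euc n)}
    (hW : UniqueDiffWithinAt ℝ W y) (hL : HasFDerivWithinAt (Function.uncurry c) L Q (x, y))
    (hQ : ∀ y' ∈ W, (x, y') ∈ Q) (hd : DifferentiableAt ℝ (fun y' => c x y') y) :
    gradY n c x y = (InnerProductSpace.toDual ℝ (Euc n)).symm
      (L.comp (ContinuousLinearMap.inr ℝ (Euc n) (Euc n))) := by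
  unfold gradY gradient
  congr 1
  have h1 : HasFDerivWithinAt (fun y' => c x y') (L.comp (ContinuousLinearMap.inr ℝ (Euc n) (Euc n))) W y :=
    HasFDerivWithinAt.comp (g := Function.uncurry c) (f := fun y' => (x, y')) y hL
      (hasFDerivAt_prodMk_right (𝕜 := ℝ) x y).hasFDerivWithinAt hQ
  exact hW.eq hd.hasFDerivAt.hasFDerivWithinAt h1

theorem gradY_eq_gY {n : ℕ} {c : Euc n → Euc n → ℝ} {x y : Euc n}
    (hd : DifferentiableAt ℝ (Function.uncurry c) (x, y)) : gradY n c x y = gY (Function.uncurry c) x y := by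
  refine gradY_eq_of_diff (W := univ) (Q := univ) uniqueDiffWithinAt_univ
    hd.hasFDerivAt.hasFDerivWithinAt (fun _ _ => mem_univ _) ?_
  exact DifferentiableAt.comp (g := Function.uncurry c) (f := fun y' => (x, y')) y hd
    (by fun_prop)

theorem gradX_eq_gX {n : ℕ} {c : Euc n → Euc n → ℝ} {x y : Euc n}
    (hd : DifferentiableAt ℝ (Function.uncurry c) (x, y)) : gradX n c x y = gX (Function.uncurry c) x y := by
  have : gradX n c x y = gradY n (fun a b => c b a) y x := rfl
  rw [this, gradY_eq_gY]
  · rfl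
  · exact DifferentiableAt.comp (g := Function.uncurry c) (f := sw n) (y, x) hd
      (sw n).differentiableAt

theorem norm_iter_pd {W : Type*} [NormedAddCommGroup W] [NormedSpace ℝ W] {f : W → ℝ} {O : Set W}
    (hO : IsOpen O) {i : ℕ} (hf : ContDiffOn ℝ (i + 1 : ℕ) f O) {z : W} (hz : z ∈ O) (a : W) :
    ‖iteratedFDeriv ℝ i (pd a f) z‖ ≤ ‖a‖ * ‖iteratedFDeriv ℝ (i + 1) f z‖ := by
  have h1 : ContDiffAt ℝ i (fderiv ℝ f) z :=
    (hf.fderiv_of_isOpen hO (by norm_cast)).contDiffAt (hO.mem_nhds hz)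
  have h2 : pd a f = (ContinuousLinearMap.apply ℝ ℝ a) ∘ (fderiv ℝ f) := by
    ext z; simp [pd]
  rw [h2, ContinuousLinearMap.iteratedFDeriv_comp_left _ h1 le_rfl, ← norm_iteratedFDeriv_fderiv]
  refine (ContinuousLinearMap.norm_compContinuousMultilinearMap_le _ _).trans ?_
  gcongr
  apply ContinuousLinearMap.opNorm_le_bound _ (norm_nonneg _)
  intro L
  simpa [mul_comm] using L.le_opNorm a

theorem exists_pre (n : ℕ) (hn : 1 ≤ n) (c : Euc n → Euc n → ℝ) (U V : Set (Euc n))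
    (hB0 : B0cond n c U V) (hB1 : B1cond n c U V) (hB2 : B2cond n c U V)
    (hUne : U.Nonempty) (hVne : V.Nonempty) :
    (∃ B μ, Pre n (Function.uncurry c) U V B μ) ∧ volume (frontier V) = 0 := by
  obtain ⟨oU, bU, oV, bV, hc⟩ := hB0
  obtain ⟨x0, hx0⟩ := hUne
  obtain ⟨y0, hy0⟩ := hVne
  set f := Function.uncurry c with hf
  have hsU : U ⊆ closure U := subset_closure
  have hsV : V ⊆ closure V := subset_closure
  have bodyU : ∀ y ∈ closure V, _ := fun y hy =>
    body_lemma oU bU ⟨x0, hx0⟩ (hB1.1 y hy) (hB2.1 y hy)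
  have bodyV : ∀ x ∈ closure U, _ := fun x hx =>
    body_lemma oV bV ⟨y0, hy0⟩ (hB1.2 x hx) (hB2.2 x hx)
  have uU : UniqueDiffOn ℝ (closure U) := (bodyU y0 (hsV hy0)).1
  have uV : UniqueDiffOn ℝ (closure V) := (bodyV x0 (hsU hx0)).1
  set Q := closure U ×ˢ closure V with hQ
  have uQ : UniqueDiffOn ℝ Q := uU.prod uV
  have cQ : IsCompact Q := bU.isCompact_closure.prod bV.isCompact_closure
  have hO : IsOpen (U ×ˢ V) := oU.prod oV
  have hOQ : U ×ˢ V ⊆ Q := prod_mono hsU hsV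
  have hfO : ContDiffOn ℝ 4 f (U ×ˢ V) := hc.mono hOQ
  refine ⟨?_, (bodyV x0 (hsU hx0)).2.1⟩
  -- bounds
  have hbd : ∀ i : ℕ, i ≤ 4 → ∃ C : ℝ, ∀ z ∈ U ×ˢ V, ‖iteratedFDeriv ℝ i f z‖ ≤ C := by
    intro i hi
    have h1 : ContinuousOn (iteratedFDerivWithin ℝ i f Q) Q :=
      hc.continuousOn_iteratedFDerivWithin (by exact_mod_cast hi) uQ
    obtain ⟨C, hC⟩ := cQ.exists_bound_of_continuousOn h1
    refine ⟨C, fun z hz => ?_⟩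
    have h2 := hC z (hOQ hz)
    rwa [iteratedFDerivWithin_eq_iteratedFDeriv uQ _ (hOQ hz)] at h2
    exact (hfO.contDiffAt (hO.mem_nhds hz)).of_le (by exact_mod_cast hi)
  obtain ⟨C1, hC1⟩ := hbd 1 (by norm_num)
  obtain ⟨C2, hC2⟩ := hbd 2 (by norm_num)
  obtain ⟨C3, hC3⟩ := hbd 3 (by norm_num)
  obtain ⟨C4, hC4⟩ := hbd 4 (by norm_num)
  set B := max (max C1 C2) (max C3 (max C4 1)) with hBdef
  have hB : 0 < B := lt_of_lt_of_le one_pos (by simp [hBdef])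
  replace hC1 : ∀ z ∈ U ×ˢ V, ‖iteratedFDeriv ℝ 1 f z‖ ≤ B := fun z hz =>
    (hC1 z hz).trans (by simp [hBdef])
  replace hC2 : ∀ z ∈ U ×ˢ V, ‖iteratedFDeriv ℝ 2 f z‖ ≤ B := fun z hz =>
    (hC2 z hz).trans (by simp [hBdef])
  replace hC3 : ∀ z ∈ U ×ˢ V, ‖iteratedFDeriv ℝ 3 f z‖ ≤ B := fun z hz =>
    (hC3 z hz).trans (by simp [hBdef])
  replace hC4 : ∀ z ∈ U ×ˢ V, ‖iteratedFDeriv ℝ 4 f z‖ ≤ B := fun z hz =>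
    (hC4 z hz).trans (by simp [hBdef])
  have h0 : ∀ (g : Euc n × Euc n → ℝ) z, |g z| = ‖iteratedFDeriv ℝ 0 g z‖ := fun g z => by
    rw [norm_iteratedFDeriv_zero, Real.norm_eq_abs]
  have hf1 : ContDiffOn ℝ 1 f (U ×ˢ V) := hfO.of_le (by norm_num)
  have hf2 : ContDiffOn ℝ 2 f (U ×ˢ V) := hfO.of_le (by norm_num)
  have hf3 : ContDiffOn ℝ 3 f (U ×ˢ V) := hfO.of_le (by norm_num)
  have hp3 : ∀ a, ContDiffOn ℝ 3 (pd a f) (U ×ˢ V) := fun a =>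
    pd_contDiffOn hO hfO (by norm_num) a
  have hp2 : ∀ a b, ContDiffOn ℝ 2 (pd a (pd b f)) (U ×ˢ V) := fun a b =>
    pd_contDiffOn hO (hp3 b) (by norm_num) a
  have hp1 : ∀ a b d, ContDiffOn ℝ 1 (pd a (pd b (pd d f))) (U ×ˢ V) := fun a b d =>
    pd_contDiffOn hO (hp2 b d) (by norm_num) a
  -- lower bound for the mixed derivative
  set F1 := fderivWithin ℝ f Q with hF1
  set F2 := fderivWithin ℝ F1 Q with hF2
  have hF1c : ContDiffOn ℝ 3 F1 Q := hc.fderivWithin uQ (by norm_num)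
  have hF2c : ContDiffOn ℝ 2 F2 Q := hF1c.fderivWithin uQ (by norm_num)
  have hdf : ∀ z ∈ Q, HasFDerivWithinAt f (F1 z) Q z := fun z hz =>
    ((hc z hz).differentiableWithinAt (by norm_num)).hasFDerivWithinAt
  have hdF1 : ∀ z ∈ Q, HasFDerivWithinAt F1 (F2 z) Q z := fun z hz =>
    ((hF1c z hz).differentiableWithinAt (by norm_num)).hasFDerivWithinAt
  have hF2eq : ∀ z ∈ U ×ˢ V, F2 z = fderiv ℝ (fderiv ℝ f) z := by
    intro z hz
    have e1 : ∀ z ∈ U ×ˢ V, F1 z = fderiv ℝ f z := fun z hz =>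
      fderivWithin_of_mem_nhds (Filter.mem_of_superset (hO.mem_nhds hz) hOQ)
    rw [hF2, fderivWithin_of_mem_nhds (Filter.mem_of_superset (hO.mem_nhds hz) hOQ)]
    apply Filter.EventuallyEq.fderiv_eq
    filter_upwards [hO.mem_nhds hz] with z hz using e1 z hz
  set inrE := ContinuousLinearMap.inr ℝ (Euc n) (Euc n)
  set tD := (InnerProductSpace.toDual ℝ (Euc n)).symm with htD
  set ext : Euc n → Euc n → Euc n := fun x y => tD ((F1 (x, y)).comp inrE) with hext
  have hextd : ∀ x ∈ U, ∀ y ∈ closure V, HasFDerivAt (fun x => (F1 (x, y)).comp inrE)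
      (((ContinuousLinearMap.compL ℝ (Euc n) (Euc n × Euc n) ℝ).flip inrE).comp
        ((F2 (x, y)).comp (ContinuousLinearMap.inl ℝ (Euc n) (Euc n)))) x := by
    intro x hx y hy
    have h1 : HasFDerivWithinAt (fun x => F1 (x, y))
        ((F2 (x, y)).comp (ContinuousLinearMap.inl ℝ (Euc n) (Euc n))) U x :=
      HasFDerivWithinAt.comp (g := F1) (f := fun x' => (x', y)) x (hdF1 _ ⟨hsU hx, hy⟩)
      (hasFDerivAt_prodMk_left (𝕜 := ℝ) x y).hasFDerivWithinAt (fun x' hx' => ⟨hsU hx', hy⟩)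
    have h2 := h1.hasFDerivAt (oU.mem_nhds hx)
    exact (((ContinuousLinearMap.compL ℝ (Euc n) (Euc n × Euc n) ℝ).flip inrE).hasFDerivAt
      (x := F1 (x, y))).comp x h2
  have hgr : ∀ x ∈ U, ∀ y ∈ closure V, gradY n c x y = ext x y := by
    intro x hx y hy
    have hdiff : ∀ x ∈ U, DifferentiableAt ℝ (fun y' => c x y') y → gradY n c x y = ext x y :=
      fun x hx hd => gradY_eq_of_diff (uV y hy) (hdf (x, y) ⟨hsU hx, hy⟩) (fun y' hy' => ⟨hsU hx, hy'⟩) hd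
    by_cases hd : DifferentiableAt ℝ (fun y' => c x y') y
    · exact hdiff x hx hd
    · have hz : gradY n c x y = 0 := gradient_eq_zero_of_not_differentiableAt hd
      have hother : ∀ x' ∈ U, x' ≠ x → gradY n c x' y = ext x' y := by
        intro x' hx' hne
        apply hdiff x' hx'
        by_contra hd'
        have hz' : gradY n c x' y = 0 := gradient_eq_zero_of_not_differentiableAt hd'
        exact hne ((hB1.1 y hy).1 (hsU hx') (hsU hx) (by simp [hz, hz']))
      have c1 : ContinuousAt (fun x => gradY n c x y) x := by
        have hh := ((hB1.1 y hy).2.1.continuousOn.mono hsU).continuousAt (oU.mem_nhds hx)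
        have hh2 := hh.neg
        have e : (-fun x => -gradY n c x y) = fun x => gradY n c x y := by funext x; simp
        rw [e] at hh2
        exact hh2
      have c2 : ContinuousAt (fun x => ext x y) x :=
        tD.continuous.continuousAt.comp (hextd x hx y hy).continuousAt
      have : Nonempty (Fin n) := ⟨⟨0, hn⟩⟩
      have : (nhdsWithin x {x}ᶜ).NeBot := inferInstance
      refine tendsto_nhds_unique (c1.tendsto.mono_left nhdsWithin_le_nhds)
        ((c2.tendsto.mono_left (nhdsWithin_le_nhds (s := {x}ᶜ))).congr' ?_)
      filter_upwards [self_mem_nhdsWithin, nhdsWithin_le_nhds (oU.mem_nhds hx)] with x' h1 h2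
      exact (hother x' h2 h1).symm
  have hlow : ∀ y ∈ closure V, ∃ m > 0, ∀ x ∈ closure U, ∀ v,
      m * ‖v‖ ≤ ‖(F2 (x, y) (v, 0)).comp inrE‖ := by
    intro y hy
    obtain ⟨m, hm, hml⟩ := (bodyU y hy).2.2
    refine ⟨m, hm, ?_⟩
    have h1 : ∀ x ∈ U, ∀ v, m * ‖v‖ ≤ ‖(F2 (x, y) (v, 0)).comp inrE‖ := by
      intro x hx v
      refine lower_of_hasFDerivAt (oU.mem_nhds hx) (hextd x hx y hy) (m := m) ?_ v
      intro z hz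
      have := hml z (hsU hz) x (hsU hx)
      rw [hgr z hz y hy, hgr x hx y hy] at this
      refine this.trans (le_of_eq ?_)
      simp only [hext]
      rw [← norm_neg, neg_sub, sub_neg_eq_add, neg_add_eq_sub, ← map_sub, LinearIsometryEquiv.norm_map]
    intro x hx v
    have hcont : ContinuousOn (fun x => ‖(F2 (x, y) (v, 0)).comp inrE‖) (closure U) := by
      have e1 : ContinuousOn (fun x => F2 (x, y)) (closure U) :=
        hF2c.continuousOn.comp (by fun_prop) (fun x hx => ⟨hx, hy⟩)
      exact ((e1.clm_apply continuousOn_const).clm_comp continuousOn_const).norm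
    have hcl := ContinuousWithinAt.closure_le hx (f := fun _ => m * ‖v‖)
      continuousWithinAt_const ((hcont x hx).mono hsU) (fun z hz => h1 z hz v)
    exact hcl
  have hμ : ∃ μ > 0, ∀ z ∈ Q, ∀ v : Euc n, μ * ‖v‖ ≤ ‖(F2 z (v, 0)).comp inrE‖ := by
    have hcomp : IsCompact (Q ×ˢ sphere (0 : Euc n) 1) := cQ.prod (isCompact_sphere _ _)
    have : Nonempty (Fin n) := ⟨⟨0, hn⟩⟩
    have hne : (Q ×ˢ sphere (0 : Euc n) 1).Nonempty :=
      Set.Nonempty.prod ⟨(x0, y0), hsU hx0, hsV hy0⟩ (NormedSpace.sphere_nonempty.2 zero_le_one)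
    have hcont : ContinuousOn (fun p : (Euc n × Euc n) × Euc n => ‖(F2 p.1 (p.2, 0)).comp inrE‖)
        (Q ×ˢ sphere (0 : Euc n) 1) := by
      have e1 : ContinuousOn (fun p : (Euc n × Euc n) × Euc n => F2 p.1) (Q ×ˢ sphere (0 : Euc n) 1) :=
        hF2c.continuousOn.comp (by fun_prop) (fun p hp => hp.1)
      exact ((e1.clm_apply (by fun_prop)).clm_comp continuousOn_const).norm
    obtain ⟨p, hp, hmin⟩ := hcomp.exists_isMinOn hne hcont
    refine ⟨‖(F2 p.1 (p.2, 0)).comp inrE‖, ?_, fun z hz v => ?_⟩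
    · obtain ⟨m, hm, hml⟩ := hlow p.1.2 hp.1.2
      have := hml p.1.1 hp.1.1 p.2
      have h1 : ‖p.2‖ = 1 := by simpa using hp.2
      rw [h1, mul_one] at this
      exact lt_of_lt_of_le hm this
    · rcases eq_or_ne v 0 with hv | hv
      · subst hv; simp
      have hvp : 0 < ‖v‖ := norm_pos_iff.2 hv
      have := hmin (show (z, ‖v‖⁻¹ • v) ∈ Q ×ˢ sphere (0 : Euc n) 1 from
        ⟨hz, by simp [norm_smul, hvp.ne']⟩)
      have h2 : ‖(F2 p.1 (p.2, 0)).comp inrE‖ ≤ ‖(F2 z (‖v‖⁻¹ • v, 0)).comp inrE‖ := this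
      rw [show ((‖v‖⁻¹ • v, (0 : Euc n)) : Euc n × Euc n) = ‖v‖⁻¹ • (v, 0) by simp,
        map_smul, ContinuousLinearMap.smul_comp, norm_smul, norm_inv, norm_norm,
        ← div_eq_inv_mul, le_div_iff₀ hvp] at h2
      exact h2
  obtain ⟨μ, hμ0, hμl⟩ := hμ
  have inv1 : ∀ z ∈ U ×ˢ V, ∀ v : Euc n, ∃ w : Euc n, ‖w‖ ≤ 1 ∧ μ * ‖v‖ ≤ pd (v, 0) (pd (0, w) f) z := by
    intro z hz v
    set φ := (F2 z (v, 0)).comp inrE with hφ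
    have e : ∀ w, pd (v, 0) (pd (0, w) f) z = φ w := by
      intro w
      rw [pd_eq_snd hO hf2 hz, ← hF2eq z hz]; rfl
    have h1 := hμl z (hOQ hz) v
    rcases eq_or_ne φ 0 with h2 | h2
    · refine ⟨0, by simp, ?_⟩
      rw [e, map_zero]; rw [← hφ, h2, norm_zero] at h1; exact h1
    · have hp : 0 < ‖φ‖ := norm_pos_iff.2 h2
      refine ⟨‖φ‖⁻¹ • tD φ, ?_, ?_⟩
      · rw [norm_smul, LinearIsometryEquiv.norm_map, norm_inv, norm_norm, inv_mul_cancel₀ hp.ne']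
      · rw [e, map_smul]
        have : φ (tD φ) = ‖φ‖ ^ 2 := by
          rw [← InnerProductSpace.toDual_symm_apply, real_inner_self_eq_norm_sq, LinearIsometryEquiv.norm_map]
        rw [this, smul_eq_mul]
        refine h1.trans (le_of_eq ?_)
        field_simp
        rfl
  have hdiffO : ∀ x ∈ U, ∀ y ∈ V, DifferentiableAt ℝ f (x, y) := fun x hx y hy =>
    (hfO.contDiffAt (hO.mem_nhds ⟨hx, hy⟩)).differentiableAt (by norm_num)
  refine ⟨B, μ, ⟨oU, oV, hfO, hB, hμ0, ?_, ?_, ?_, ?_, inv1, ?_, ?_, ?_, ?_, ?_⟩⟩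
  · intro z hz a
    rw [h0]
    refine (norm_iter_pd hO (i := 0) (by simpa using hf1) hz a).trans ?_
    have := hC1 z hz
    rw [mul_comm]; gcongr
  · intro z hz a b
    rw [h0]
    have e1 := norm_iter_pd hO (i := 0) (f := pd b f) (by simpa using (hp3 b).of_le (by norm_num)) hz a
    have e2 := norm_iter_pd hO (i := 1) (f := f) (by simpa using hf2) hz b
    have := hC2 z hz
    calc _ ≤ _ := e1
      _ ≤ ‖a‖ * (‖b‖ * B) := by gcongr; exact e2.trans (by gcongr)
      _ = _ := by ring
  · intro z hz a b d
    rw [h0]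
    have e0 := norm_iter_pd hO (i := 0) (f := pd b (pd d f)) (by simpa using (hp2 b d).of_le (by norm_num)) hz a
    have e1 := norm_iter_pd hO (i := 1) (f := pd d f) (by simpa using (hp3 d).of_le (by norm_num)) hz b
    have e2 := norm_iter_pd hO (i := 2) (f := f) (by simpa using hf3) hz d
    have := hC3 z hz
    calc _ ≤ _ := e0
      _ ≤ ‖a‖ * (‖b‖ * (‖d‖ * B)) := by
        gcongr; refine e1.trans ?_; gcongr; exact e2.trans (by gcongr)
      _ = _ := by ring
  · intro z hz a b d e
    rw [h0]
    have e0 := norm_iter_pd hO (i := 0) (f := pd b (pd d (pd e f))) (by simpa using (hp1 b d e)) hz a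
    have e1 := norm_iter_pd hO (i := 1) (f := pd d (pd e f)) (by simpa using (hp2 d e).of_le (by norm_num)) hz b
    have e2 := norm_iter_pd hO (i := 2) (f := pd e f) (by simpa using (hp3 e).of_le (by norm_num)) hz d
    have e3 := norm_iter_pd hO (i := 3) (f := f) (by simpa using hfO) hz e
    have := hC4 z hz
    calc _ ≤ _ := e0
      _ ≤ ‖a‖ * (‖b‖ * (‖d‖ * (‖e‖ * B))) := by
        gcongr; refine e1.trans ?_; gcongr; refine e2.trans ?_; gcongr; exact e3.trans (by gcongr)
      _ = _ := by ring
  · intro z hz w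
    -- transpose
    let L : Euc n →ₗ[ℝ] Euc n :=
      { toFun := fun a => tD ((F2 z (a, 0)).comp inrE)
        map_add' := by
          intro a b
          rw [← map_add, ← ContinuousLinearMap.add_comp, ← map_add]; simp
        map_smul' := by
          intro r a
          rw [show ((r • a, (0 : Euc n)) : Euc n × Euc n) = r • (a, 0) by simp]
          rw [map_smul, ContinuousLinearMap.smul_comp]
          exact map_smul tD.toLinearEquiv _ _ }
    have hL : ∀ a w, inner ℝ (L a) w = pd (a, 0) (pd (0, w) f) z := by
      intro a w
      rw [pd_eq_snd hO hf2 hz, ← hF2eq z hz]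
      simp only [L, LinearMap.coe_mk, AddHom.coe_mk, htD]
      rw [InnerProductSpace.toDual_symm_apply]; rfl
    have hLn : ∀ a, μ * ‖a‖ ≤ ‖L a‖ := by
      intro a
      have := hμl z (hOQ hz) a
      simpa only [L, LinearMap.coe_mk, AddHom.coe_mk, LinearIsometryEquiv.norm_map] using this
    have hi : Function.Injective L := by
      refine (injective_iff_map_eq_zero _).2 fun v hv => ?_
      have := hLn v
      rw [hv, norm_zero] at this
      have h : ‖v‖ ≤ 0 := by by_contra h; push Not at h; nlinarith [mul_pos hμ0 h]
      simpa using h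
    obtain ⟨a, ha⟩ := (LinearMap.injective_iff_surjective.1 hi) w
    rcases eq_or_ne w 0 with hw | hw
    · refine ⟨0, by simp, ?_⟩
      rw [← hL]; simp [hw]
    have hwp : 0 < ‖w‖ := norm_pos_iff.2 hw
    refine ⟨(μ / ‖w‖) • a, ?_, ?_⟩
    · have := hLn a
      rw [ha] at this
      rw [norm_smul, Real.norm_eq_abs, abs_of_pos (by positivity), div_mul_eq_mul_div, div_le_one hwp]
      exact this
    · rw [← hL, map_smul, ha, inner_smul_left, real_inner_self_eq_norm_sq]
      simp only [conj_trivial]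
      apply le_of_eq; field_simp
  · intro y hy x hx x' hx' he
    refine (hB1.1 y (hsV hy)).1 (hsU hx) (hsU hx') ?_
    simp only
    rw [gradY_eq_gY (hdiffO x hx y hy), gradY_eq_gY (hdiffO x' hx' y hy)]
    exact congrArg Neg.neg he
  · intro y hy
    have := convex_neg_image (hB2.1 y (hsV hy))
    convert this using 1
    exact image_congr fun x hx => (gradY_eq_gY (hdiffO x hx y hy)).symm
  · intro x hx y hy y' hy' he
    refine (hB1.2 x (hsU hx)).1 (hsV hy) (hsV hy') ?_
    simp only
    rw [gradX_eq_gX (hdiffO x hx y hy), gradX_eq_gX (hdiffO x hx y' hy')]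
    exact congrArg Neg.neg he
  · intro x hx
    have := convex_neg_image (hB2.2 x (hsU hx))
    convert this using 1
    exact image_congr fun y hy => (gradX_eq_gX (hdiffO x hx y hy)).symm

section
variable {n : ℕ} {f : Euc n × Euc n → ℝ} {U V : Set (Euc n)} {B μ : ℝ}

theorem pd_const_mul {W : Type*} [NormedAddCommGroup W] [NormedSpace ℝ W] (r : ℝ) (a : W) (f : W → ℝ) :
    pd a (fun z => r * f z) = fun z => r * pd a f z := by
  ext z
  have : (fun z => r * f z) = r • f := rfl
  simp only [pd]
  rw [this, fderiv_const_smul_field]; rfl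

theorem Pre.inj1 (h : Pre n f U V B μ) {z} (hz : z ∈ U ×ˢ V) {a a' : Euc n}
    (he : ∀ w, pd (a, 0) (pd (0, w) f) z = pd (a', 0) (pd (0, w) f) z) : a = a' := by
  obtain ⟨w, hw, h1⟩ := h.inv1 z hz (a - a')
  have e : pd (a - a', 0) (pd (0, w) f) z = pd (a, 0) (pd (0, w) f) z - pd (a', 0) (pd (0, w) f) z := by
    have : ((a - a', 0) : Euc n × Euc n) = (a, 0) - (a', 0) := by simp
    simp only [pd]; rw [this, map_sub]
  rw [e, he w, sub_self] at h1
  have := h.hμ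
  have h2 : ‖a - a'‖ ≤ 0 := by by_contra h; push Not at h; nlinarith [mul_pos this h]
  exact sub_eq_zero.1 (norm_le_zero_iff.1 h2)

theorem Pre.base_seg (h : Pre n f U V B μ) {x y : Euc n} (hx : x ∈ U) (hy : y ∈ V) (v : Euc n) :
    ∃ r > (0:ℝ), ∀ ρ : ℝ, 0 < ρ → ρ ≤ r → ∃ q d : Euc n, ∃ X X1 X2 : ℝ → Euc n,
      (∀ s ∈ Icc (-1:ℝ) 1, IsSeg f U y q d X X1 X2 s) ∧ X 0 = x ∧ X1 0 = ρ • v := by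
  set b := fderiv ℝ (fun x => gY f x y) x v with hb
  obtain ⟨r, hr, hball⟩ := Metric.isOpen_iff.1 (h.open_image hy) (gY f x y) (mem_image_of_mem _ hx)
  refine ⟨r / (‖b‖ + 1), by positivity, fun ρ hρ hρr => ?_⟩
  have hin : ∀ s ∈ Icc (-1:ℝ) 1, gY f x y + s • (ρ • b) ∈ (fun x => gY f x y) '' U := by
    intro s hs
    apply hball
    rw [mem_ball, dist_eq_norm, add_sub_cancel_left, norm_smul, norm_smul]
    have h1 : ‖s‖ ≤ 1 := abs_le.2 hs
    have h2 : ‖ρ‖ = ρ := abs_of_pos hρ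
    rw [h2]
    rw [le_div_iff₀ (by positivity)] at hρr
    have := norm_nonneg b
    have : ‖s‖ * (ρ * ‖b‖) ≤ ρ * ‖b‖ := mul_le_of_le_one_left (by positivity) h1
    nlinarith
  have hseg := fun s hs => h.isSeg hy (gY f x y) (ρ • b) s (hin s hs)
  refine ⟨_, _, _, _, _, hseg, by simp [h.Xi_gY hx hy], ?_⟩
  have h0 : (0:ℝ) ∈ Icc (-1:ℝ) 1 := by constructor <;> norm_num
  have hX0 : Xi f U y (gY f x y + (0:ℝ) • (ρ • b)) = x := by simp [h.Xi_gY hx hy]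
  refine h.inj1 (z := (x, y)) ⟨hx, hy⟩ fun w => ?_
  have := (hseg 0 h0).c1 w
  simp only [hX0] at this
  rw [this, inner_smul_left, hb, h.gY_fderiv hx hy,
    show ((ρ • v, 0) : Euc n × Euc n) = ρ • (v, 0) by simp, pd_smul_vec]
  simp

theorem T1_of_B3 (n : ℕ) (c : Euc n → Euc n → ℝ) (U V : Set (Euc n)) {B μ : ℝ}
    (h : Pre n (Function.uncurry c) U V B μ) (hB3 : B3cond n c U V) :
    T1cond n (Function.uncurry c) U V := by
  set f := Function.uncurry c with hf
  rintro ⟨x, y⟩ ⟨hx, hy⟩ v w a h0 ha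
  simp only at hx hy
  obtain ⟨r1, hr1, H1⟩ := h.base_seg hx hy v
  obtain ⟨r2, hr2, H2⟩ := h.swap.base_seg hy hx w
  set ρ := min r1 r2 with hρ
  have hρ0 : 0 < ρ := lt_min hr1 hr2
  obtain ⟨q, d, X, X1, X2, hX, hX0, hX10⟩ := H1 ρ hρ0 (min_le_left _ _)
  obtain ⟨q', d', Y, Y1, Y2, hY, hY0, hY10⟩ := H2 ρ hρ0 (min_le_right _ _)
  have hI : (0:ℝ) ∈ Icc (-1:ℝ) 1 := by constructor <;> norm_num
  have hev : ∀ᶠ s in nhds (0:ℝ), s ∈ Ioo (-1:ℝ) 1 := Ioo_mem_nhds (by norm_num) (by norm_num)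
  have hm : ∀ s ∈ Icc (-1:ℝ) 1, ∀ t ∈ Icc (-1:ℝ) 1, (X s, Y t) ∈ U ×ˢ V :=
    fun s hs t ht => ⟨(hX s hs).mem, (hY t ht).mem⟩
  have hdiff : ∀ z ∈ U ×ˢ V, DifferentiableAt ℝ f z := fun z hz =>
    (h.sm.contDiffAt (h.oUV.mem_nhds hz)).differentiableAt (by norm_num)
  have I := @Ioo_subset_Icc_self ℝ _ (-1) 1
  -- derivatives in t
  have t1 : ∀ s ∈ Icc (-1:ℝ) 1, ∀ t ∈ Icc (-1:ℝ) 1,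
      HasDerivAt (fun t => c (X s) (Y t)) (pd (0, Y1 t) f (X s, Y t)) t := by
    intro s hs t ht
    exact curve_deriv1 h.oUV (h.sm.of_le (by norm_num)) (z := fun t => (X s, Y t))
      (z1 := fun t => (0, Y1 t)) (hm s hs t ht) ((hasDerivAt_const t _).prodMk (hY t ht).h1)
  have t2 : ∀ s ∈ Icc (-1:ℝ) 1, ∀ t ∈ Icc (-1:ℝ) 1,
      HasDerivAt (fun t => pd (0, Y1 t) f (X s, Y t)) (pd (0, Y1 t) (pd (0, Y1 t) f) (X s, Y t)
        + pd (0, Y2 t) f (X s, Y t)) t := by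
    intro s hs t ht
    exact curve_deriv2 h.oUV (h.sm.of_le (by norm_num)) (z := fun t => (X s, Y t))
      (z1 := fun t => (0, Y1 t)) (z2 := fun t => (0, Y2 t)) (hm s hs t ht)
      ((hasDerivAt_const t _).prodMk (hY t ht).h1) ((hasDerivAt_const t _).prodMk (hY t ht).h2)
  have t3 : ∀ s ∈ Icc (-1:ℝ) 1, deriv (deriv (fun t => c (X s) (Y t))) 0 =
      pd (0, Y1 0) (pd (0, Y1 0) f) (X s, y) + pd (0, Y2 0) f (X s, y) := by
    intro s hs
    have : deriv (fun t => c (X s) (Y t)) =ᶠ[nhds 0] fun t => pd (0, Y1 t) f (X s, Y t) := by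
      filter_upwards [hev] with t ht using (t1 s hs t (I ht)).deriv
    rw [this.deriv_eq, (t2 s hs 0 hI).deriv, hY0]
  have hmy : ∀ s ∈ Icc (-1:ℝ) 1, (X s, y) ∈ U ×ˢ V := fun s hs => ⟨(hX s hs).mem, hy⟩
  have hB := hB3 X Y (fun t ht => subset_closure (hX t ht).mem)
    (fun t ht => subset_closure (hY t ht).mem) ⟨(q, q'), (d, d'), fun t ht => by
      have e1 := (hX t ht).eq
      have e2 := (hY t ht).eq
      beta_reduce
      rw [hY0, hX0, gradY_eq_gY (hdiff _ (hmy t ht)), gradX_eq_gX (hdiff _ ⟨hx, (hY t ht).mem⟩)]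
      simp only [gX, ← hf]
      rw [e1, e2]; rfl⟩
  have c2 : crossDiff2 n c X Y = 0 := by
    have e : (fun s => deriv (fun t => c (X s) (Y t)) 0) =ᶠ[nhds 0]
        fun s => pd (0, Y1 0) f (X s, y) := by
      filter_upwards [hev] with s hs
      rw [(t1 s (I hs) 0 hI).deriv, hY0]
    have e2 := curve_fst h.oUV ((h.pd1 (0, Y1 0)).of_le (by norm_num)) (hmy 0 hI) (hX 0 hI).h1
    rw [crossDiff2, e.deriv_eq, e2.deriv, hX0, hX10, hY10,
      show ((0, ρ • w) : Euc n × Euc n) = ρ • (0, w) by simp,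
      show ((ρ • v, 0) : Euc n × Euc n) = ρ • (v, 0) by simp, pd_smul_vec, pd_smul_vec,
      pd_const_mul]
    simp only [h0, mul_zero]
  have hB4 := hB c2
  have hX20 : X2 0 = (ρ * ρ) • a := by
    refine h.inj1 (z := (x, y)) ⟨hx, hy⟩ fun w' => ?_
    have e1 := (hX 0 hI).c2 w'
    have e2 := ha w'
    rw [hX0, hX10, show ((ρ • v, 0) : Euc n × Euc n) = ρ • (v, 0) by simp] at e1
    simp only [pd_smul_vec, pd_const_mul] at e1
    rw [show (((ρ * ρ) • a, 0) : Euc n × Euc n) = (ρ * ρ) • (a, 0) by simp]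
    simp only [pd_smul_vec]
    linear_combination e1 - ρ * ρ * e2
  have c4 : crossDiff4 n c X Y = pd (X1 0, 0) (pd (X1 0, 0) (pd (0, Y1 0) (pd (0, Y1 0) f))) (x, y)
      + pd (X2 0, 0) (pd (0, Y1 0) (pd (0, Y1 0) f)) (x, y) := by
    have e : (fun s => deriv (deriv (fun t => c (X s) (Y t))) 0) =ᶠ[nhds 0]
        fun s => pd (0, Y1 0) (pd (0, Y1 0) f) (X s, y) + pd (0, Y2 0) f (X s, y) := by
      filter_upwards [hev] with s hs using t3 s (I hs)
    have e1 : ∀ s ∈ Icc (-1:ℝ) 1, HasDerivAt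
        (fun s => pd (0, Y1 0) (pd (0, Y1 0) f) (X s, y) + pd (0, Y2 0) f (X s, y))
        (pd (X1 s, 0) (pd (0, Y1 0) (pd (0, Y1 0) f)) (X s, y)
          + pd (X1 s, 0) (pd (0, Y2 0) f) (X s, y)) s := fun s hs =>
      (curve_fst h.oUV ((h.pd2 _ _).of_le (by norm_num)) (hmy s hs) (hX s hs).h1).add
      (curve_fst h.oUV ((h.pd1 _).of_le (by norm_num)) (hmy s hs) (hX s hs).h1)
    have e2 : deriv (fun s => deriv (deriv (fun t => c (X s) (Y t))) 0) =ᶠ[nhds 0]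
        fun s => pd (X1 s, 0) (pd (0, Y1 0) (pd (0, Y1 0) f)) (X s, y)
          + pd (X1 s, 0) (pd (0, Y2 0) f) (X s, y) := by
      filter_upwards [e.eventuallyEq_nhds, hev] with s hs hs'
      rw [hs.deriv_eq, (e1 s (I hs')).deriv]
    have e3 := (curve_fst2 h.oUV (h.pd2 (0, Y1 0) (0, Y1 0)) (hmy 0 hI) (hX 0 hI).h1 (hX 0 hI).h2).add
      (curve_fst2 h.oUV ((h.pd1 (0, Y2 0)).of_le (by norm_num)) (hmy 0 hI) (hX 0 hI).h1 (hX 0 hI).h2)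
    have e4 := (hX 0 hI).c2 (Y2 0)
    rw [crossDiff4, e2.deriv_eq]
    refine e3.deriv.trans ?_
    rw [e4, hX0, add_zero]
  rw [c4, hX10, hY10, hX20, show ((0, ρ • w) : Euc n × Euc n) = ρ • (0, w) by simp,
      show ((ρ • v, 0) : Euc n × Euc n) = ρ • (v, 0) by simp,
      show (((ρ * ρ) • a, 0) : Euc n × Euc n) = (ρ * ρ) • (a, 0) by simp] at hB4
  simp only [pd_smul_vec, pd_const_mul] at hB4
  have hp : 0 < ρ * ρ * (ρ * ρ) := by positivity
  by_contra hcon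
  push Not at hcon
  nlinarith [mul_pos hp hcon]
end

section
variable {n : ℕ} {f : Euc n × Euc n → ℝ} {U V : Set (Euc n)} {B μ : ℝ}

noncomputable def C0 (B μ : ℝ) : ℝ := Real.exp (-Ckey B μ)
theorem C0_pos : 0 < C0 B μ := Real.exp_pos _
theorem C0_le (h : Pre n f U V B μ) : C0 B μ ≤ 1 := by
  have := Ckey_nonneg h
  exact Real.exp_le_one_iff.2 (by linarith)

theorem Good.three (h : Good n f U V B μ) {x0 x1 y0 y1 : Euc n} (hx0 : x0 ∈ U) (hx1 : x1 ∈ U)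
    (hy0 : y0 ∈ V) (hy1 : y1 ∈ V) {t : ℝ} (ht0 : 0 < t) (ht1 : t < 1)
    (hlt : f (x0, y0) - f (x0, y1) < f (segX f U y0 x0 x1 t, y0) - f (segX f U y0 x0 x1 t, y1)) :
    C0 B μ * (1 - t) * ((f (segX f U y0 x0 x1 t, y0) - f (segX f U y0 x0 x1 t, y1))
      - (f (x0, y0) - f (x0, y1)))
    ≤ t * ((f (x1, y0) - f (x1, y1))
      - (f (segX f U y0 x0 x1 t, y0) - f (segX f U y0 x0 x1 t, y1))) := by
  obtain ⟨k1, k2, h1, h2, h3⟩ := h.key hx0 hx1 hy0 hy1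
  have e0 := h.toPre.segX_zero (x1 := x1) hx0 hy0
  have e1 := h.toPre.segX_one (x0 := x0) hx1 hy0
  have := one_dim_three_point h1 h2 h3 (Ckey_nonneg h.toPre) ht0 ht1 (by simpa [e0] using hlt)
  simpa [e0, e1, C0] using this

theorem Pre.segX_mem (h : Pre n f U V B μ) {x0 x1 y : Euc n} (hx0 : x0 ∈ U) (hx1 : x1 ∈ U)
    (hy : y ∈ V) {s : ℝ} (hs : s ∈ Icc (0:ℝ) 1) : segX f U y x0 x1 s ∈ U :=
  (h.segX_isSeg hx0 hx1 hy hs).mem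

theorem Pre.gY_segX (h : Pre n f U V B μ) {x0 x1 y : Euc n} (hx0 : x0 ∈ U) (hx1 : x1 ∈ U)
    (hy : y ∈ V) {s : ℝ} (hs : s ∈ Icc (0:ℝ) 1) :
    gY f (segX f U y x0 x1 s) y = gY f x0 y + s • (gY f x1 y - gY f x0 y) :=
  (h.segX_isSeg hx0 hx1 hy hs).eq

theorem Good.max_le (h : Good n f U V B μ) {x0 x1 y0 y1 : Euc n} (hx0 : x0 ∈ U) (hx1 : x1 ∈ U)
    (hy0 : y0 ∈ V) (hy1 : y1 ∈ V) {t : ℝ} (ht : t ∈ Icc (0:ℝ) 1) {K : ℝ}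
    (h0 : f (x0, y0) - f (x0, y1) ≤ K) (h1 : f (x1, y0) - f (x1, y1) ≤ K) :
    f (segX f U y0 x0 x1 t, y0) - f (segX f U y0 x0 x1 t, y1) ≤ K := by
  rcases ht.1.eq_or_lt with h' | ht0
  · rw [← h', h.toPre.segX_zero hx0 hy0]; exact h0
  rcases ht.2.eq_or_lt with h' | ht1
  · rw [h', h.toPre.segX_one hx1 hy0]; exact h1
  by_contra hcon
  push Not at hcon
  have := h.three hx0 hx1 hy0 hy1 ht0 ht1 (lt_of_le_of_lt h0 hcon)
  have hC := C0_pos (B := B) (μ := μ)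
  have h2 : 0 < C0 B μ * (1 - t) * ((f (segX f U y0 x0 x1 t, y0) - f (segX f U y0 x0 x1 t, y1))
      - (f (x0, y0) - f (x0, y1))) :=
    mul_pos (mul_pos hC (by linarith)) (by linarith)
  nlinarith

/-- Contraction estimate along a segment. -/
theorem Good.contract (h : Good n f U V B μ) {x0 x1 y0 y1 : Euc n} (hx0 : x0 ∈ U) (hx1 : x1 ∈ U)
    (hy0 : y0 ∈ V) (hy1 : y1 ∈ V) {t : ℝ} (ht0 : 0 < t) (ht1 : t ≤ 1 / 2) {A : ℝ} (hA : 0 ≤ A)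
    (h1 : (f (x1, y0) - f (x1, y1)) - (f (x0, y0) - f (x0, y1)) ≤ A) :
    (f (segX f U y0 x0 x1 t, y0) - f (segX f U y0 x0 x1 t, y1)) - (f (x0, y0) - f (x0, y1))
      ≤ 2 * t / C0 B μ * A := by
  have hC := C0_pos (B := B) (μ := μ)
  rcases le_or_gt (f (segX f U y0 x0 x1 t, y0) - f (segX f U y0 x0 x1 t, y1))
    (f (x0, y0) - f (x0, y1)) with hle | hlt
  · have : 0 ≤ 2 * t / C0 B μ * A := by positivity
    linarith
  · have h3 := h.three hx0 hx1 hy0 hy1 ht0 (by linarith) hlt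
    set a := f (segX f U y0 x0 x1 t, y0) - f (segX f U y0 x0 x1 t, y1) with ha
    set b := f (x0, y0) - f (x0, y1) with hb
    rw [div_mul_eq_mul_div, le_div_iff₀ hC]
    have h4 : t * ((f (x1, y0) - f (x1, y1)) - a) ≤ t * A :=
      mul_le_mul_of_nonneg_left (by linarith) ht0.le
    have h5 : C0 B μ * (1 / 2) * (a - b) ≤ C0 B μ * (1 - t) * (a - b) := by
      have : 0 < a - b := by linarith
      have h6 : C0 B μ * (1 / 2) ≤ C0 B μ * (1 - t) := mul_le_mul_of_nonneg_left (by linarith) hC.le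
      exact mul_le_mul_of_nonneg_right h6 this.le
    linarith

/-- A `κ`-deep point: one can extend segments through it. -/
def Deep {n : ℕ} (κ : ℝ) (Q : Set (Euc n)) (z : Euc n) : Prop := ∀ q ∈ Q, z + κ • (z - q) ∈ Q

theorem Good.deep (h : Good n f U V B μ) {y0 y1 : Euc n} (hy0 : y0 ∈ V) (hy1 : y1 ∈ V)
    {Z : Set (Euc n)} (hZ : Z ⊆ U) {κ : ℝ} (hκ : 0 < κ) {z : Euc n} (hz : z ∈ U)
    (hd : Deep κ ((fun x => gY f x y0) '' Z) (gY f z y0)) {A : ℝ}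
    (hA : ∀ q ∈ Z, (f (q, y0) - f (q, y1)) - (f (z, y0) - f (z, y1)) ≤ A) (hA0 : 0 ≤ A)
    {q : Euc n} (hq : q ∈ Z) :
    (f (z, y0) - f (z, y1)) - (f (q, y0) - f (q, y1)) ≤ A / (C0 B μ * κ) := by
  have hC := C0_pos (B := B) (μ := μ)
  obtain ⟨q', hq', he⟩ := hd _ (mem_image_of_mem _ hq)
  simp only at he
  have hk1 : 0 < 1 + κ := by linarith
  have hseg : segX f U y0 q q' (1 / (1 + κ)) = z := by
    refine h.injY y0 hy0 (h.toPre.segX_mem (hZ hq) (hZ hq') hy0 ⟨by positivity, ?_⟩) hz ?_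
    · rw [div_le_one hk1]; linarith
    · simp only
      rw [h.toPre.gY_segX (hZ hq) (hZ hq') hy0 ⟨by positivity, by rw [div_le_one hk1]; linarith⟩, he]
      match_scalars <;> field_simp <;> ring
  rcases le_or_gt (f (z, y0) - f (z, y1)) (f (q, y0) - f (q, y1)) with hle | hlt
  · have : 0 ≤ A / (C0 B μ * κ) := by positivity
    linarith
  · have h3 := h.three (hZ hq) (hZ hq') hy0 hy1 (t := 1 / (1 + κ)) (by positivity)
      (by rw [div_lt_one hk1]; linarith) (by rw [hseg]; exact hlt)
    rw [hseg] at h3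
    have h4 := hA q' hq'
    rw [le_div_iff₀ (by positivity)]
    have e : 1 - 1 / (1 + κ) = κ * (1 / (1 + κ)) := by field_simp; ring
    rw [e] at h3
    have hp : 0 < 1 / (1 + κ) := by positivity
    have h5 : (1 / (1 + κ)) * (C0 B μ * κ * (f (z, y0) - f (z, y1) - (f (q, y0) - f (q, y1)))) ≤
      (1 / (1 + κ)) * (f (q', y0) - f (q', y1) - (f (z, y0) - f (z, y1))) := by linarith
    have := le_of_mul_le_mul_left h5 hp
    linarith

theorem Pre.Xi_lip (h : Pre n f U V B μ) {y : Euc n} (hy : y ∈ V) {q q' : Euc n}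
    (hq : q ∈ (fun x => gY f x y) '' U) (hq' : q' ∈ (fun x => gY f x y) '' U) :
    ‖Xi f U y q - Xi f U y q'‖ ≤ μ⁻¹ * ‖q - q'‖ :=
  (h.convY y hy).norm_image_sub_le_of_norm_fderiv_le (𝕜 := ℝ)
    (fun p hp => ((h.Xi_contDiff hy).contDiffAt ((h.open_image hy).mem_nhds hp)).differentiableAt
      (by norm_num)) (h.Xi_fderiv hy) hq' hq

theorem Pre.gY_expand (h : Pre n f U V B μ) {x x' y : Euc n} (hx : x ∈ U) (hx' : x' ∈ U) (hy : y ∈ V) :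
    μ * ‖x - x'‖ ≤ ‖gY f x y - gY f x' y‖ := by
  have := h.Xi_lip hy (mem_image_of_mem _ hx) (mem_image_of_mem _ hx')
  simp only [h.Xi_gY hx hy, h.Xi_gY hx' hy] at this
  rwa [← div_eq_inv_mul, le_div_iff₀ h.hμ, mul_comm] at this

theorem Pre.gY_change (h : Pre n f U V B μ) {x x' y y' : Euc n} (hx : x ∈ U) (hx' : x' ∈ U)
    (hy : y ∈ V) (hy' : y' ∈ V) :
    ‖gY f x y - gY f x' y‖ ≤ B * μ⁻¹ * ‖gY f x y' - gY f x' y'‖ := by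
  have hd : ∀ p ∈ (fun x => gY f x y') '' U, DifferentiableAt ℝ (Xi f U y') p := fun p hp =>
    ((h.Xi_contDiff hy').contDiffAt ((h.open_image hy').mem_nhds hp)).differentiableAt (by norm_num)
  have hd2 : ∀ p ∈ (fun x => gY f x y') '' U, DifferentiableAt ℝ (fun x => gY f x y) (Xi f U y' p) :=
    fun p hp => ((h.gY_contDiff hy).contDiffAt (h.oU.mem_nhds (Xi_mem hp))).differentiableAt
      (by norm_num)
  have := (h.convY y' hy').norm_image_sub_le_of_norm_fderiv_le (𝕜 := ℝ) (C := B * μ⁻¹)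
    (f := fun p => gY f (Xi f U y' p) y) (fun p hp => (hd2 p hp).comp p (hd p hp)) (fun p hp => by
      have e := fderiv_comp p (hd2 p hp) (hd p hp)
      have e' : fderiv ℝ (fun p => gY f (Xi f U y' p) y) p = _ := e
      rw [e']
      refine (ContinuousLinearMap.opNorm_comp_le _ _).trans ?_
      exact mul_le_mul (h.gY_upper (Xi_mem hp) hy) (h.Xi_fderiv hy' p hp) (norm_nonneg _) h.hB.le)
      (mem_image_of_mem _ hx') (mem_image_of_mem _ hx)
  simpa only [h.Xi_gY hx hy', h.Xi_gY hx' hy'] using this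
end

section
variable {n : ℕ} {f : Euc n × Euc n → ℝ} {U V : Set (Euc n)} {B μ : ℝ}

theorem exists_deep (hn : 1 ≤ n) {Q : Set (Euc n)} (hQ : IsCompact Q) (hc : Convex ℝ Q)
    (hne : Q.Nonempty) : ∃ c ∈ Q, Deep (1 / (n:ℝ)) Q c := by
  have hn0 : (0:ℝ) < n := by exact_mod_cast hn
  set κ : ℝ := 1 / n with hκ
  have hκ0 : 0 < κ := by positivity
  have himg : ∀ q : Q, {c : Euc n | c + κ • (c - q) ∈ Q}
      = (fun r => (1 + κ)⁻¹ • (r + κ • (q : Euc n))) '' Q := by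
    intro q
    ext c
    constructor
    · intro hcq
      refine ⟨_, hcq, ?_⟩
      simp only
      match_scalars <;> field_simp <;> ring
    · rintro ⟨r, hr, rfl⟩
      simp only [mem_setOf_eq]
      convert hr using 1
      match_scalars <;> field_simp <;> ring
  have key : (⋂ q : Q, {c : Euc n | c + κ • (c - q) ∈ Q}).Nonempty := by
    apply Convex.helly_theorem_compact' (𝕜 := ℝ)
    · intro q x hx y hy a b ha hb hab
      have := hc hx hy ha hb hab
      simp only [mem_setOf_eq]
      convert this using 1
      have hb' : b = 1 - a := by linarith
      subst hb'
      module
    · intro q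
      rw [himg]
      exact hQ.image (by fun_prop)
    · intro I hI
      rw [finrank_euclideanSpace_fin] at hI
      rcases I.eq_empty_or_nonempty with rfl | hIne
      · simp
      set k : ℝ := ((I.card : ℕ) : ℝ) with hk
      have hk0 : 0 < k := by rw [hk]; exact_mod_cast hIne.card_pos
      have hkn : k ≤ n + 1 := by rw [hk]; exact_mod_cast hI
      refine ⟨k⁻¹ • ∑ q ∈ I, (q : Euc n), ?_⟩
      simp only [mem_iInter, mem_setOf_eq]
      intro q hq
      classical
      have := hc.sum_mem (t := I) (w := fun j => (1 + κ) * k⁻¹ - if j = q then κ else 0)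
        (z := fun j => (j : Euc n)) (fun j hj => by
          have h1 : κ ≤ (1 + κ) * k⁻¹ := by
            rw [← div_eq_mul_inv, le_div_iff₀ hk0]
            have : κ * k ≤ κ * (n + 1) := mul_le_mul_of_nonneg_left hkn hκ0.le
            have e : κ * n = 1 := by rw [hκ]; field_simp
            nlinarith
          split_ifs <;> linarith) (by
          rw [Finset.sum_sub_distrib, Finset.sum_const, nsmul_eq_mul, Finset.sum_ite_eq' I q, if_pos hq,
            ← hk]
          field_simp; ring) (fun j _ => j.2)
      convert this using 1
      simp only [sub_smul, Finset.sum_sub_distrib, ← Finset.smul_sum, ite_smul, zero_smul,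
        Finset.sum_ite_eq' I q, if_pos hq]
      module
  obtain ⟨c, hcm⟩ := key
  simp only [mem_iInter, mem_setOf_eq] at hcm
  refine ⟨c, ?_, fun q hq => hcm ⟨q, hq⟩⟩
  obtain ⟨q, hq⟩ := hne
  have := hc (hcm ⟨q, hq⟩) hq (a := 1 / (1 + κ)) (b := κ / (1 + κ)) (by positivity) (by positivity)
    (by field_simp)
  convert this using 1
  match_scalars <;> field_simp <;> ring

theorem convex_four {Q : Set (Euc n)} (hc : Convex ℝ Q) {a b c d : Euc n} (ha : a ∈ Q) (hb : b ∈ Q)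
    (hcc : c ∈ Q) (hd : d ∈ Q) {α β γ δ : ℝ} (h1 : 0 ≤ α) (h2 : 0 ≤ β) (h3 : 0 ≤ γ) (h4 : 0 ≤ δ)
    (hs : α + β + γ + δ = 1) : α • a + β • b + γ • c + δ • d ∈ Q := by
  have := hc.sum_mem (t := Finset.univ) (w := ![α, β, γ, δ]) (z := ![a, b, c, d])
    (by intro i _; fin_cases i <;> simpa) (by simp [Fin.sum_univ_four, hs])
    (by intro i _; fin_cases i <;> simpa)
  simpa [Fin.sum_univ_four] using this

theorem deep_shrink {Q : Set (Euc n)} (hQ : Convex ℝ Q) {c q0 z : Euc n} {κ η : ℝ} (hκ : 0 < κ)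
    (hκ1 : κ ≤ 1) (hη : 0 < η) (hη1 : η ≤ 1) (hc : c ∈ Q) (hd : Deep κ Q c) (hq0 : q0 ∈ Q) (hz : z ∈ Q) :
    (1 - η) • q0 + (η / 2) • (c + z) ∈ Q ∧ Deep (η * κ / 4) Q ((1 - η) • q0 + (η / 2) • (c + z)) := by
  constructor
  · have := convex_four hQ hq0 hc hz hz (α := 1 - η) (β := η / 2) (γ := η / 2) (δ := 0) (by linarith)
      (by linarith) (by linarith) le_rfl (by ring)
    convert this using 1
    module
  · intro q hq
    have hr := hd q hq
    have hηκ : 0 < η * κ := by positivity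
    have := convex_four hQ hq0 hz hc hr (α := (1 + η * κ / 4) * (1 - η)) (β := (1 + η * κ / 4) * (η / 2))
      (γ := (1 + η * κ / 4) * (η / 2) - η / 4 * (1 + κ)) (δ := η / 4)
      (mul_nonneg (by linarith) (by linarith)) (by positivity) (by nlinarith) (by linarith) (by ring)
    convert this using 1
    module

/-- A bound on pure second derivatives gives a Lipschitz bound on the derivative. -/
theorem fderiv_lip {O : Set (Euc n)} (oO : IsOpen O) (cO : Convex ℝ O) {F : Euc n → ℝ}
    (hF : ContDiffOn ℝ 2 F O) {K : ℝ} (hK : 0 ≤ K)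
    (hb : ∀ p ∈ O, ∀ d, |pd d (pd d F) p| ≤ K * ‖d‖ ^ 2) {p p' : Euc n} (hp : p ∈ O) (hp' : p' ∈ O) :
    ‖fderiv ℝ F p - fderiv ℝ F p'‖ ≤ K * ‖p - p'‖ := by
  have hd : ∀ p ∈ O, DifferentiableAt ℝ (fderiv ℝ F) p := fun p hp =>
    ((hF.fderiv_of_isOpen oO (m := 1) (by norm_num)).contDiffAt (oO.mem_nhds hp)).differentiableAt
      (by norm_num)
  refine cO.norm_image_sub_le_of_norm_fderiv_le (𝕜 := ℝ) hd (fun p hp => ?_) hp' hp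
  have hq : ∀ a b, |fderiv ℝ (fderiv ℝ F) p a b| ≤ K * ((‖a‖ ^ 2 + ‖b‖ ^ 2) / 2) := by
    intro a b
    have hs := ((hF.contDiffAt (oO.mem_nhds hp)).isSymmSndFDerivAt (by simp)).eq a b
    have h1 := hb p hp (a + b)
    have h2 := hb p hp (a - b)
    rw [pd_eq_snd oO hF hp] at h1 h2
    simp only [map_add, map_sub, add_apply, sub_apply] at h1 h2
    rw [abs_le] at h1 h2 ⊢
    have := parallelogram_law_with_norm ℝ a b
    constructor <;> nlinarith
  refine ContinuousLinearMap.opNorm_le_bound₂ _ hK fun a b => ?_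
  rcases eq_or_ne a 0 with rfl | ha
  · simp
  rcases eq_or_ne b 0 with rfl | hb0
  · simp
  have hap := norm_pos_iff.2 ha
  have hbp := norm_pos_iff.2 hb0
  have := hq (‖a‖⁻¹ • a) (‖b‖⁻¹ • b)
  simp only [map_smul, ContinuousLinearMap.smul_apply, norm_smul, norm_inv, norm_norm, smul_eq_mul,
    abs_mul, abs_inv, abs_norm] at this
  rw [inv_mul_cancel₀ hap.ne', inv_mul_cancel₀ hbp.ne'] at this
  rw [Real.norm_eq_abs]
  have e : |fderiv ℝ (fderiv ℝ F) p a b|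
      = ‖a‖ * ‖b‖ * (‖a‖⁻¹ * (‖b‖⁻¹ * |fderiv ℝ (fderiv ℝ F) p a b|)) := by
    field_simp
  have h3 : ‖a‖⁻¹ * (‖b‖⁻¹ * |fderiv ℝ (fderiv ℝ F) p a b|) ≤ K := by
    have e2 : K * ((1 ^ 2 + 1 ^ 2) / 2) = K := by ring
    rw [e2] at this
    first | exact this | (refine le_trans (le_of_eq ?_) this; ring)
  rw [e]
  calc _ ≤ ‖a‖ * ‖b‖ * K := mul_le_mul_of_nonneg_left h3 (by positivity)
    _ = _ := by ring

theorem taylor_of_fderiv_lip {O : Set (Euc n)} (oO : IsOpen O) (cO : Convex ℝ O) {F : Euc n → ℝ}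
    (hF : DifferentiableOn ℝ F O) {K : ℝ}
    (hb : ∀ p ∈ O, ∀ p' ∈ O, ‖fderiv ℝ F p - fderiv ℝ F p'‖ ≤ K * ‖p - p'‖) (hK : 0 ≤ K)
    {p p' : Euc n} (hp : p ∈ O) (hp' : p' ∈ O) :
    |F p' - F p - fderiv ℝ F p (p' - p)| ≤ K * ‖p' - p‖ ^ 2 := by
  have hs : segment ℝ p p' ⊆ O := cO.segment_subset hp hp'
  have := (convex_segment p p').norm_image_sub_le_of_norm_hasFDerivWithin_le' (𝕜 := ℝ) (f := F)
    (f' := fderiv ℝ F) (φ := fderiv ℝ F p) (C := K * ‖p' - p‖)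
    (fun x hx => ((hF x (hs hx)).differentiableAt (oO.mem_nhds (hs hx))).hasFDerivAt.hasFDerivWithinAt)
    (fun x hx => (hb x (hs hx) p hp).trans (mul_le_mul_of_nonneg_left (by
      obtain ⟨a, b, ha, hb, hab, rfl⟩ := hx
      have e : a • p + b • p' - p = b • (p' - p) := by
        have : a = 1 - b := by linarith
        subst this; module
      rw [e, norm_smul, Real.norm_of_nonneg hb]
      exact mul_le_of_le_one_left (norm_nonneg _) (by linarith)) hK))
    (left_mem_segment ℝ p p') (right_mem_segment ℝ p p')
  rw [Real.norm_eq_abs] at this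
  linarith
end

section
variable {n : ℕ} {f : Euc n × Euc n → ℝ} {U V : Set (Euc n)} {B μ : ℝ}

/-- Second derivative bound in cost-exponential coordinates. -/
noncomputable def Kf (B μ : ℝ) : ℝ := B * μ⁻¹ ^ 2 + B ^ 2 * μ⁻¹ ^ 3

theorem Kf_nonneg (h : Pre n f U V B μ) : 0 ≤ Kf B μ := by
  have := h.hB; have := h.hμ
  unfold Kf; positivity

theorem Pre.F_contDiff (h : Pre n f U V B μ) {y y' : Euc n} (hy : y ∈ V) (hy' : y' ∈ V) :
    ContDiffOn ℝ 3 (fun q => f (Xi f U y q, y')) ((fun x => gY f x y) '' U) := by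
  have h1 : ContDiffOn ℝ 3 (fun q => (Xi f U y q, y')) ((fun x => gY f x y) '' U) :=
    (h.Xi_contDiff hy).prodMk contDiffOn_const
  exact (h.sm.of_le (by norm_num)).comp h1 (fun q hq => ⟨Xi_mem hq, hy'⟩)

theorem Pre.F_fderiv_apply (h : Pre n f U V B μ) {y y' : Euc n} (hy : y ∈ V) (hy' : y' ∈ V)
    {q : Euc n} (hq : q ∈ (fun x => gY f x y) '' U) (d : Euc n) :
    fderiv ℝ (fun q => f (Xi f U y q, y')) q d
      = inner ℝ (gX f (Xi f U y q) y') (fderiv ℝ (Xi f U y) q d) := by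
  have h1 : HasFDerivAt (Xi f U y) (fderiv ℝ (Xi f U y) q) q :=
    (((h.Xi_contDiff hy).contDiffAt ((h.open_image hy).mem_nhds hq)).differentiableAt
      (by norm_num)).hasFDerivAt
  have h2 : HasFDerivAt f (fderiv ℝ f (Xi f U y q, y')) (Xi f U y q, y') :=
    ((h.sm.contDiffAt (h.oUV.mem_nhds ⟨Xi_mem hq, hy'⟩)).differentiableAt (by norm_num)).hasFDerivAt
  have h3 := (h2.comp (f := fun q => (Xi f U y q, y')) q (h1.prodMk (hasFDerivAt_const y' q))).fderiv
  rw [inner_gX, pd]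
  have h4 := congrArg (fun L : Euc n →L[ℝ] ℝ => L d) h3
  simpa [Function.comp_def] using h4

theorem Pre.F_second (h : Pre n f U V B μ) {y y' : Euc n} (hy : y ∈ V) (hy' : y' ∈ V)
    {q : Euc n} (hq : q ∈ (fun x => gY f x y) '' U) (d : Euc n) :
    |pd d (pd d (fun q => f (Xi f U y q, y'))) q| ≤ Kf B μ * ‖d‖ ^ 2 := by
  set F : Euc n → ℝ := fun q => f (Xi f U y q, y') with hFd
  set O := (fun x => gY f x y) '' U with hO
  have oO : IsOpen O := h.open_image hy
  have hF : ContDiffOn ℝ 3 F O := h.F_contDiff hy hy'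
  set X : ℝ → Euc n := fun s => Xi f U y (q + s • d) with hX
  have hz0 : q + (0:ℝ) • d ∈ O := by simpa using hq
  have hev : ∀ᶠ s : ℝ in nhds 0, q + s • d ∈ O := by
    have : Continuous (fun s : ℝ => q + s • d) := by fun_prop
    exact this.continuousAt.preimage_mem_nhds (oO.mem_nhds hz0)
  have hseg : ∀ s : ℝ, q + s • d ∈ O → IsSeg f U y q d X (deriv X) (deriv (deriv X)) s :=
    fun s hs => h.isSeg hy q d s hs
  have hdz : ∀ s : ℝ, HasDerivAt (fun s : ℝ => q + s • d) d s := fun s => by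
    simpa using ((hasDerivAt_id s).smul_const d).const_add q
  have e1 := curve_deriv2 oO (hF.of_le (by norm_num)) (z := fun s : ℝ => q + s • d)
    (z1 := fun _ => d) (z2 := fun _ => 0) (s := 0) hz0 (hdz 0) (hasDerivAt_const 0 d)
  have s0 := hseg 0 hz0
  have e2 := curve_fst2 h.oUV (h.sm.of_le (by norm_num)) (y := y') (X := X) (s := 0)
    ⟨s0.mem, hy'⟩ s0.h1 s0.h2
  have e3 : (fun r : ℝ => pd d F (q + r • d)) =ᶠ[nhds 0] (fun r => pd (deriv X r, 0) f (X r, y')) := by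
    filter_upwards [hev] with r hr
    have a1 := curve_deriv1 oO (hF.of_le (by norm_num)) (z := fun s : ℝ => q + s • d)
      (z1 := fun _ => d) hr (hdz r)
    have sr := hseg r hr
    have a2 := curve_fst h.oUV (h.sm.of_le (by norm_num)) (y := y') (X := X) (s := r)
      ⟨sr.mem, hy'⟩ sr.h1
    exact a1.unique a2
  have e4 := e1.unique (e2.congr_of_eventuallyEq e3)
  have e5 : pd d (pd d F) q = pd (deriv X 0, 0) (pd (deriv X 0, 0) f) (X 0, y')
      + pd (deriv (deriv X) 0, 0) f (X 0, y') := by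
    rw [← e4]; simp [pd]
  have hμ := h.hμ
  have hB := h.hB
  have n1 : ‖deriv X 0‖ ≤ μ⁻¹ * ‖d‖ := by
    have := s0.norm_X1 h hy
    rw [← div_eq_inv_mul, le_div_iff₀ hμ, mul_comm]; exact this
  have n2 : ‖deriv (deriv X) 0‖ ≤ μ⁻¹ * (B * (μ⁻¹ * ‖d‖) * (μ⁻¹ * ‖d‖)) := by
    have := h.norm_corr (z := (X 0, y)) ⟨s0.mem, hy⟩ s0.c2
    rw [← div_eq_inv_mul, le_div_iff₀ hμ, mul_comm]
    refine this.trans ?_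
    gcongr
  have b2 := h.b2 (X 0, y') ⟨s0.mem, hy'⟩ (deriv X 0, 0) (deriv X 0, 0)
  have b1 := h.b1 (X 0, y') ⟨s0.mem, hy'⟩ (deriv (deriv X) 0, 0)
  rw [norm_inl_pair] at b1 b2
  rw [e5]
  calc _ ≤ _ := abs_add_le _ _
    _ ≤ B * ‖deriv X 0‖ * ‖deriv X 0‖ + B * ‖deriv (deriv X) 0‖ := add_le_add b2 b1
    _ ≤ B * (μ⁻¹ * ‖d‖) * (μ⁻¹ * ‖d‖) + B * (μ⁻¹ * (B * (μ⁻¹ * ‖d‖) * (μ⁻¹ * ‖d‖))) := by gcongr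
    _ = _ := by unfold Kf; ring

theorem Pre.F_lip (h : Pre n f U V B μ) {y y' : Euc n} (hy : y ∈ V) (hy' : y' ∈ V) :
    ∀ p ∈ (fun x => gY f x y) '' U, ∀ p' ∈ (fun x => gY f x y) '' U,
      ‖fderiv ℝ (fun q => f (Xi f U y q, y')) p - fderiv ℝ (fun q => f (Xi f U y q, y')) p'‖
        ≤ Kf B μ * ‖p - p'‖ := fun _ hp _ hp' =>
  fderiv_lip (h.open_image hy) (h.convY y hy) ((h.F_contDiff hy hy').of_le (by norm_num))
    (Kf_nonneg h) (fun _ hp d => h.F_second hy hy' hp d) hp hp'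

/-- The derivatives for distinct parameters are quantitatively different. -/
theorem Pre.F_diff_lower (h : Pre n f U V B μ) {y ya yb : Euc n} (hy : y ∈ V) (ha : ya ∈ V)
    (hb : yb ∈ V) {q : Euc n} (hq : q ∈ (fun x => gY f x y) '' U) :
    μ * ‖ya - yb‖ ≤ B * ‖fderiv ℝ (fun q => f (Xi f U y q, ya)) q
      - fderiv ℝ (fun q => f (Xi f U y q, yb)) q‖ := by
  set x := Xi f U y q with hx
  have hxU : x ∈ U := Xi_mem hq
  set e := gX f x ya - gX f x yb with he
  have h1 : μ * ‖ya - yb‖ ≤ ‖e‖ := h.swap.gY_expand ha hb hxU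
  set d := fderiv ℝ (fun x => gY f x y) x e with hd
  have hde : fderiv ℝ (Xi f U y) q d = e := by
    have a1 : HasFDerivAt (Xi f U y) (fderiv ℝ (Xi f U y) q) (gY f x y) := by
      rw [hx, gY_Xi hq]
      exact (((h.Xi_contDiff hy).contDiffAt ((h.open_image hy).mem_nhds hq)).differentiableAt
        (by norm_num)).hasFDerivAt
    have a2 : HasFDerivAt (fun x => gY f x y) (fderiv ℝ (fun x => gY f x y) x) x :=
      (((h.gY_contDiff hy).contDiffAt (h.oU.mem_nhds hxU)).differentiableAt
        (by norm_num)).hasFDerivAt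
    have a3 := HasFDerivAt.comp (g := Xi f U y) (f := fun x => gY f x y) x a1 a2
    have a4 : HasFDerivAt (Xi f U y ∘ fun x => gY f x y) (ContinuousLinearMap.id ℝ (Euc n)) x := by
      refine (hasFDerivAt_id x).congr_of_eventuallyEq ?_
      filter_upwards [h.oU.mem_nhds hxU] with z hz
      exact h.Xi_gY hz hy
    have := congrArg (fun L : Euc n →L[ℝ] Euc n => L e) (a3.unique a4)
    simpa using this
  set D := fderiv ℝ (fun q => f (Xi f U y q, ya)) q - fderiv ℝ (fun q => f (Xi f U y q, yb)) q with hD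
  have h2 : D d = ‖e‖ ^ 2 := by
    rw [hD, sub_apply, h.F_fderiv_apply hy ha hq, h.F_fderiv_apply hy hb hq, hde,
      ← inner_sub_left, ← real_inner_self_eq_norm_sq]
  have h3 : ‖d‖ ≤ B * ‖e‖ := (ContinuousLinearMap.le_opNorm _ _).trans
    (mul_le_mul_of_nonneg_right (h.gY_upper hxU hy) (norm_nonneg _))
  have h4 : ‖e‖ ^ 2 ≤ ‖D‖ * (B * ‖e‖) := by
    rw [← h2]
    exact (le_abs_self _).trans ((D.le_opNorm d).trans (mul_le_mul_of_nonneg_left h3 (norm_nonneg _)))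
  rcases (norm_nonneg e).eq_or_lt with h0 | h0
  · rw [← h0] at h1
    exact h1.trans (mul_nonneg h.hB.le (norm_nonneg _))
  · refine h1.trans ?_
    nlinarith

/-- Limits of Lipschitz maps at boundary points. -/
theorem exists_lip_limit {W : Type*} [NormedAddCommGroup W] [CompleteSpace W] {O : Set (Euc n)}
    {D : Euc n → W} {K : ℝ} (hK : 0 ≤ K) (hD : ∀ p ∈ O, ∀ p' ∈ O, ‖D p - D p'‖ ≤ K * ‖p - p'‖)
    {pb : Euc n} {a : ℕ → Euc n} (ha : ∀ k, a k ∈ O)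
    (hlim : Filter.Tendsto a Filter.atTop (nhds pb)) :
    ∃ L, Filter.Tendsto (fun k => D (a k)) Filter.atTop (nhds L) ∧
      ∀ p ∈ O, ‖D p - L‖ ≤ K * ‖p - pb‖ := by
  have hc : CauchySeq (fun k => D (a k)) := by
    have h1 := hlim.cauchySeq
    have hl : LipschitzOnWith ⟨K, hK⟩ D O := LipschitzOnWith.of_dist_le_mul (fun p hp p' hp' => by
      rw [dist_eq_norm, dist_eq_norm]; exact hD p hp p' hp')
    rw [Metric.cauchySeq_iff] at h1 ⊢
    intro ε hε
    obtain ⟨N, hN⟩ := h1 (ε / (K + 1)) (by positivity)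
    refine ⟨N, fun m hm k hk => ?_⟩
    have h2 := hN m hm k hk
    have h3 := hD _ (ha m) _ (ha k)
    rw [dist_eq_norm] at h2 ⊢
    rw [lt_div_iff₀ (by positivity)] at h2
    nlinarith [norm_nonneg (a m - a k)]
  obtain ⟨L, hL⟩ := cauchySeq_tendsto_of_complete hc
  refine ⟨L, hL, fun p hp => ?_⟩
  have t1 : Filter.Tendsto (fun k => ‖D p - D (a k)‖) Filter.atTop (nhds ‖D p - L‖) :=
    (tendsto_const_nhds.sub hL).norm
  have t2 : Filter.Tendsto (fun k => K * ‖p - a k‖) Filter.atTop (nhds (K * ‖p - pb‖)) :=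
    ((tendsto_const_nhds.sub hlim).norm).const_mul K
  exact le_of_tendsto_of_tendsto' t1 t2 (fun k => hD p hp _ (ha k))
end

section
variable {n : ℕ} {f : Euc n × Euc n → ℝ} {U V : Set (Euc n)} {B μ : ℝ}

theorem Pre.curve (h : Pre n f U V B μ) (cf : ContinuousOn f (closure U ×ˢ closure V))
    {y0 xb ya yb : Euc n} (hy0 : y0 ∈ V) (hxb : xb ∈ closure U) (hya : ya ∈ V) (hyb : yb ∈ V)
    (hab : ya ≠ yb) :
    ∃ (γ : ℝ → Euc n) (E : Euc n → ℝ) (K : ℝ), 0 ≤ K ∧ (∀ ε ∈ Ioc (0:ℝ) 1, γ ε ∈ U) ∧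
      (∀ ε ∈ Ioc (0:ℝ) 1, ∀ ε' ∈ Ioc (0:ℝ) 1, ∀ y ∈ V,
        ‖gY f (γ ε) y - gY f (γ ε') y‖ ≤ K * |ε - ε'|) ∧
      (∀ ε ∈ Ioc (0:ℝ) 1, ‖γ ε - xb‖ ≤ K * ε) ∧
      (∀ ε ∈ Ioc (0:ℝ) 1, ∀ y ∈ V, |f (γ ε, y) - f (xb, y) - ε * E y| ≤ K * ε ^ 2) ∧
      ContinuousOn E V ∧ E ya ≠ E yb := by
  have hB := h.hB
  have hμ := h.hμ
  set O := (fun x => gY f x y0) '' U with hO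
  have oO : IsOpen O := h.open_image hy0
  have cO : Convex ℝ O := h.convY y0 hy0
  -- boundary point
  obtain ⟨xs, hxs, hxl⟩ := mem_closure_iff_seq_limit.1 hxb
  obtain ⟨pb, -, φ, hφ, hlim⟩ := (isCompact_closedBall (0 : Euc n) B).tendsto_subseq
    (x := fun k => gY f (xs k) y0) (fun k => by simpa using h.norm_gY_le (hxs k) hy0)
  set a : ℕ → Euc n := fun k => gY f (xs (φ k)) y0 with hadef
  have ha : ∀ k, a k ∈ O := fun k => mem_image_of_mem _ (hxs _)
  have hlim : Filter.Tendsto a Filter.atTop (nhds pb) := hlim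
  have hXa : ∀ k, Xi f U y0 (a k) = xs (φ k) := fun k => h.Xi_gY (hxs _) hy0
  have hxl' : Filter.Tendsto (fun k => xs (φ k)) Filter.atTop (nhds xb) :=
    hxl.comp hφ.tendsto_atTop
  have hpb : pb ∈ closure O := mem_closure_of_tendsto hlim (Filter.Eventually.of_forall ha)
  -- limits of derivatives
  have hL : ∀ y : Euc n, ∃ L : Euc n →L[ℝ] ℝ, y ∈ V →
      Filter.Tendsto (fun k => fderiv ℝ (fun q => f (Xi f U y0 q, y)) (a k)) Filter.atTop (nhds L) ∧
      ∀ p ∈ O, ‖fderiv ℝ (fun q => f (Xi f U y0 q, y)) p - L‖ ≤ Kf B μ * ‖p - pb‖ := by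
    intro y
    by_cases hy : y ∈ V
    · obtain ⟨L, hL⟩ := exists_lip_limit (Kf_nonneg h) (h.F_lip hy0 hy) ha hlim
      exact ⟨L, fun _ => hL⟩
    · exact ⟨0, fun h => absurd h hy⟩
  choose L hL using hL
  -- choice of direction
  have hζ : L ya - L yb ≠ 0 := by
    intro h0
    have t1 := ((((hL ya hya).1.sub (hL yb hyb).1)).norm).const_mul B
    have t2 := ge_of_tendsto' t1 (fun k => h.F_diff_lower hy0 hya hyb (ha k))
    rw [h0, norm_zero, mul_zero] at t2
    have : 0 < ‖ya - yb‖ := norm_pos_iff.2 (sub_ne_zero.2 hab)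
    nlinarith [mul_pos hμ this]
  obtain ⟨p1, hp1, hp1n⟩ : ∃ p1 ∈ O, (L ya - L yb) (p1 - pb) ≠ 0 := by
    by_contra hcon
    push Not at hcon
    apply hζ
    ext v
    have e0 := hcon _ (ha 0)
    have hev : ∀ᶠ s : ℝ in nhds 0, a 0 + s • v ∈ O := by
      have hc : Continuous (fun s : ℝ => a 0 + s • v) := by fun_prop
      exact hc.continuousAt.preimage_mem_nhds (oO.mem_nhds (by simpa using ha 0))
    obtain ⟨δ, hδ, hball⟩ := Metric.eventually_nhds_iff.1 hev
    have e1 := hcon _ (hball (y := δ / 2) (by simp [abs_of_pos hδ]; linarith))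
    have : a 0 + (δ / 2) • v - pb = (a 0 - pb) + (δ / 2) • v := by abel
    rw [this, map_add, e0, map_smul, zero_add, smul_eq_mul] at e1
    have := (mul_eq_zero.1 e1).resolve_left (by positivity)
    simpa using this
  set d := p1 - pb with hd
  have hpε : ∀ ε ∈ Ioc (0:ℝ) 1, pb + ε • d ∈ O := by
    intro ε hε
    have := cO.add_smul_sub_mem_interior' hpb (by rwa [oO.interior_eq]) hε
    rwa [oO.interior_eq] at this
  set K : ℝ := max (Kf B μ * ‖d‖ ^ 2) (max (B * μ⁻¹ * ‖d‖) (μ⁻¹ * ‖d‖)) with hK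
  have hK1 : Kf B μ * ‖d‖ ^ 2 ≤ K := le_max_left _ _
  have hK2 : B * μ⁻¹ * ‖d‖ ≤ K := (le_max_left _ _).trans (le_max_right _ _)
  have hK3 : μ⁻¹ * ‖d‖ ≤ K := (le_max_right _ _).trans (le_max_right _ _)
  have hmain : ∀ ε ∈ Ioc (0:ℝ) 1, ∀ y ∈ V,
      |f (Xi f U y0 (pb + ε • d), y) - f (xb, y) - ε * L y d| ≤ K * ε ^ 2 := by
    intro ε hε y hy
    have hk : ∀ k, |f (Xi f U y0 (pb + ε • d), y) - f (xs (φ k), y)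
        - fderiv ℝ (fun q => f (Xi f U y0 q, y)) (a k) (pb + ε • d - a k)|
        ≤ Kf B μ * ‖pb + ε • d - a k‖ ^ 2 := by
      intro k
      have := taylor_of_fderiv_lip oO cO ((h.F_contDiff hy0 hy).differentiableOn (by norm_num))
        (h.F_lip hy0 hy) (Kf_nonneg h) (ha k) (hpε ε hε)
      simpa only [hXa] using this
    have t1 : Filter.Tendsto (fun k => f (xs (φ k), y)) Filter.atTop (nhds (f (xb, y))) := by
      have c1 : ContinuousWithinAt f (closure U ×ˢ closure V) (xb, y) :=
        cf _ ⟨hxb, subset_closure hy⟩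
      refine c1.tendsto.comp (tendsto_nhdsWithin_iff.2 ⟨?_, ?_⟩)
      · exact hxl'.prodMk_nhds tendsto_const_nhds
      · exact Filter.Eventually.of_forall fun k => ⟨subset_closure (hxs _), subset_closure hy⟩
    have t2 : Filter.Tendsto (fun k => pb + ε • d - a k) Filter.atTop (nhds (pb + ε • d - pb)) :=
      tendsto_const_nhds.sub hlim
    have t3 : Filter.Tendsto (fun k => fderiv ℝ (fun q => f (Xi f U y0 q, y)) (a k) (pb + ε • d - a k))
        Filter.atTop (nhds (L y (pb + ε • d - pb))) := by
      have hcont : Continuous (fun z : (Euc n →L[ℝ] ℝ) × Euc n => z.1 z.2) := by fun_prop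
      exact (hcont.tendsto (L y, pb + ε • d - pb)).comp ((hL y hy).1.prodMk_nhds t2)
    have t4 := ((tendsto_const_nhds (x := f (Xi f U y0 (pb + ε • d), y))).sub t1).sub t3 |>.abs
    have t5 := ((t2.norm).pow 2).const_mul (Kf B μ)
    have t6 := le_of_tendsto_of_tendsto' t4 t5 hk
    rw [add_sub_cancel_left, map_smul, smul_eq_mul, norm_smul, mul_pow, Real.norm_of_nonneg hε.1.le] at t6
    refine t6.trans ?_
    calc _ = (Kf B μ * ‖d‖ ^ 2) * ε ^ 2 := by ring
      _ ≤ _ := by gcongr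
  refine ⟨fun ε => Xi f U y0 (pb + ε • d), fun y => L y d, K, ?_, ?_, ?_, ?_, hmain, ?_, ?_⟩
  · exact le_trans (by positivity) hK3
  · exact fun ε hε => Xi_mem (hpε ε hε)
  · intro ε hε ε' hε' y hy
    have := h.gY_change (Xi_mem (hpε ε hε)) (Xi_mem (hpε ε' hε')) hy hy0
    refine this.trans ?_
    rw [gY_Xi (hpε ε hε), gY_Xi (hpε ε' hε'), show pb + ε • d - (pb + ε' • d) = (ε - ε') • d by module,
      norm_smul, Real.norm_eq_abs]
    calc _ = (B * μ⁻¹ * ‖d‖) * |ε - ε'| := by ring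
      _ ≤ _ := by gcongr
  · intro ε hε
    have hk : ∀ k, ‖Xi f U y0 (pb + ε • d) - xs (φ k)‖ ≤ μ⁻¹ * ‖pb + ε • d - a k‖ := by
      intro k
      have := h.Xi_lip hy0 (hpε ε hε) (ha k)
      rwa [hXa] at this
    have t1 := (tendsto_const_nhds (x := Xi f U y0 (pb + ε • d))).sub hxl' |>.norm
    have t2 := ((tendsto_const_nhds (x := pb + ε • d)).sub hlim |>.norm).const_mul μ⁻¹
    have t3 := le_of_tendsto_of_tendsto' t1 t2 hk
    rw [add_sub_cancel_left, norm_smul, Real.norm_of_nonneg hε.1.le] at t3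
    refine t3.trans ?_
    calc _ = (μ⁻¹ * ‖d‖) * ε := by ring
      _ ≤ _ := mul_le_mul_of_nonneg_right hK3 hε.1.le
  · apply continuousOn_of_uniform_approx_of_continuousOn
    intro s hs
    obtain ⟨r, hr, hrs⟩ := Metric.mem_uniformity_dist.1 hs
    have hK0 : 0 ≤ K := le_trans (by positivity) hK3
    set ε : ℝ := min 1 (r / (2 * (K + 1))) with hε
    have hε0 : 0 < ε := lt_min one_pos (by positivity)
    have hεr : ε * (K + 1) ≤ r / 2 := by
      have : ε ≤ r / (2 * (K + 1)) := min_le_right _ _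
      rw [le_div_iff₀ (by positivity)] at this
      linarith
    have hεm : ε ∈ Ioc (0:ℝ) 1 := ⟨hε0, min_le_left _ _⟩
    refine ⟨fun y => (f (Xi f U y0 (pb + ε • d), y) - f (xb, y)) / ε, ?_, ?_⟩
    · apply ContinuousOn.div_const
      apply ContinuousOn.sub
      · exact cf.comp (by fun_prop) (fun y hy => ⟨subset_closure (Xi_mem (hpε ε hεm)), subset_closure hy⟩)
      · exact cf.comp (by fun_prop) (fun y hy => ⟨hxb, subset_closure hy⟩)
    · intro y hy
      apply hrs
      have h1 := hmain ε hεm y hy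
      rw [Real.dist_eq, abs_sub_comm]
      have h2 : (f (Xi f U y0 (pb + ε • d), y) - f (xb, y)) / ε - L y d
        = (f (Xi f U y0 (pb + ε • d), y) - f (xb, y) - ε * L y d) / ε := by field_simp
      rw [h2, abs_div, abs_of_pos hε0, div_lt_iff₀ hε0]
      nlinarith
  · intro he
    apply hp1n
    rw [sub_apply]; simpa [sub_eq_zero] using he
end

/-- A cost together with a `c`-convex potential `u` and its transform `us`. -/
structure MA (n : ℕ) (f : Euc n × Euc n → ℝ) (U V : Set (Euc n)) (B μ : ℝ)
    (u us : Euc n → ℝ) : Prop extends Good n f U V B μ where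
  bU : IsBounded U
  bV : IsBounded V
  cf : ContinuousOn f (closure U ×ˢ closure V)
  uc : ContinuousOn u (closure U)
  hus : ∀ x ∈ closure U, ∀ y ∈ closure V, 0 ≤ u x + us y + f (x, y)
  att : ∀ x ∈ closure U, ∃ y ∈ closure V, u x + us y + f (x, y) = 0
  datt : ∀ y ∈ closure V, ∀ x0 ∈ closure U,
    (∀ x ∈ closure U, u x0 + f (x0, y) ≤ u x + f (x, y)) → u x0 + us y + f (x0, y) = 0

section
variable {n : ℕ} {f : Euc n × Euc n → ℝ} {U V : Set (Euc n)} {B μ : ℝ} {u us : Euc n → ℝ}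

theorem MA.three' (h : MA n f U V B μ u us) {x0 x1 y0 y1 : Euc n} (hx0 : x0 ∈ U) (hx1 : x1 ∈ U)
    (hy0 : y0 ∈ V) (hy1 : y1 ∈ closure V) {t : ℝ} (ht0 : 0 < t) (ht1 : t < 1)
    (hlt : f (x0, y0) - f (x0, y1) < f (segX f U y0 x0 x1 t, y0) - f (segX f U y0 x0 x1 t, y1)) :
    C0 B μ * (1 - t) * ((f (segX f U y0 x0 x1 t, y0) - f (segX f U y0 x0 x1 t, y1))
      - (f (x0, y0) - f (x0, y1)))
    ≤ t * ((f (x1, y0) - f (x1, y1))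
      - (f (segX f U y0 x0 x1 t, y0) - f (segX f U y0 x0 x1 t, y1))) := by
  obtain ⟨ys, hys, hyl⟩ := mem_closure_iff_seq_limit.1 hy1
  have hxt : segX f U y0 x0 x1 t ∈ U := h.toPre.segX_mem hx0 hx1 hy0 ⟨ht0.le, ht1.le⟩
  have hT : ∀ x ∈ U, Filter.Tendsto (fun k => f (x, ys k)) Filter.atTop (nhds (f (x, y1))) := by
    intro x hx
    have c1 : ContinuousWithinAt f (closure U ×ˢ closure V) (x, y1) :=
      h.cf _ ⟨subset_closure hx, hy1⟩
    refine c1.tendsto.comp (tendsto_nhdsWithin_iff.2 ⟨?_, ?_⟩)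
    · exact tendsto_const_nhds.prodMk_nhds hyl
    · exact Filter.Eventually.of_forall fun k => ⟨subset_closure hx, subset_closure (hys _)⟩
  have t0 := (tendsto_const_nhds (x := f (x0, y0))).sub (hT x0 hx0)
  have t1 := (tendsto_const_nhds (x := f (x1, y0))).sub (hT x1 hx1)
  have t2 := (tendsto_const_nhds (x := f (segX f U y0 x0 x1 t, y0))).sub (hT _ hxt)
  have hev := t0.eventually_lt t2 hlt
  refine le_of_tendsto_of_tendsto ((t2.sub t0).const_mul (C0 B μ * (1 - t)))
    ((t1.sub t2).const_mul t) ?_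
  filter_upwards [hev] with k hk
  exact h.toGood.three hx0 hx1 hy0 (hys k) ht0 ht1 hk

theorem MA.m_three (h : MA n f U V B μ u us) {x0 x1 y : Euc n} (hx0 : x0 ∈ U) (hx1 : x1 ∈ U)
    (hy : y ∈ V) {t : ℝ} (ht0 : 0 < t) (ht1 : t < 1)
    (hlt : u x0 + f (x0, y) < u (segX f U y x0 x1 t) + f (segX f U y x0 x1 t, y)) :
    C0 B μ * (1 - t) * ((u (segX f U y x0 x1 t) + f (segX f U y x0 x1 t, y)) - (u x0 + f (x0, y)))
    ≤ t * ((u x1 + f (x1, y)) - (u (segX f U y x0 x1 t) + f (segX f U y x0 x1 t, y))) := by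
  have hxt : segX f U y x0 x1 t ∈ U := h.toPre.segX_mem hx0 hx1 hy ⟨ht0.le, ht1.le⟩
  obtain ⟨y1, hy1, he⟩ := h.att _ (subset_closure hxt)
  have g0 := h.hus x0 (subset_closure hx0) y1 hy1
  have g1 := h.hus x1 (subset_closure hx1) y1 hy1
  have := h.three' hx0 hx1 hy hy1 ht0 ht1 (by linarith)
  have hC := C0_pos (B := B) (μ := μ)
  refine le_trans (mul_le_mul_of_nonneg_left ?_ (mul_nonneg hC.le (by linarith)))
    (this.trans (mul_le_mul_of_nonneg_left ?_ ht0.le)) <;> linarith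

theorem MA.m_max (h : MA n f U V B μ u us) {x0 x1 y : Euc n} (hx0 : x0 ∈ U) (hx1 : x1 ∈ U)
    (hy : y ∈ V) {t : ℝ} (ht : t ∈ Icc (0:ℝ) 1) {K : ℝ}
    (h0 : u x0 + f (x0, y) ≤ K) (h1 : u x1 + f (x1, y) ≤ K) :
    u (segX f U y x0 x1 t) + f (segX f U y x0 x1 t, y) ≤ K := by
  rcases ht.1.eq_or_lt with h' | ht0
  · rw [← h', h.toPre.segX_zero hx0 hy]; exact h0
  rcases ht.2.eq_or_lt with h' | ht1
  · rw [h', h.toPre.segX_one hx1 hy]; exact h1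
  by_contra hcon
  push Not at hcon
  have hC := C0_pos (B := B) (μ := μ)
  have h3 := h.m_three hx0 hx1 hy ht0 ht1 (by linarith)
  have h4 : 0 < C0 B μ * (1 - t) * ((u (segX f U y x0 x1 t) + f (segX f U y x0 x1 t, y))
    - (u x0 + f (x0, y))) := mul_pos (mul_pos hC (by linarith)) (by linarith)
  have h5 : t * ((u x1 + f (x1, y)) - (u (segX f U y x0 x1 t) + f (segX f U y x0 x1 t, y))) < 0 :=
    mul_neg_of_pos_of_neg ht0 (by linarith)
  linarith

theorem MA.local_min (h : MA n f U V B μ u us) {z y : Euc n} (hz : z ∈ U) (hy : y ∈ V)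
    (hmin : ∀ᶠ x in nhds z, u z + f (z, y) ≤ u x + f (x, y)) :
    ∀ x ∈ closure U, u z + f (z, y) ≤ u x + f (x, y) := by
  have hU : ∀ x ∈ U, u z + f (z, y) ≤ u x + f (x, y) := by
    intro x hx
    by_contra hcon
    push Not at hcon
    have hc : ContinuousAt (segX f U y x z) 1 :=
      (h.toPre.segX_isSeg hx hz hy (s := 1) ⟨zero_le_one, le_rfl⟩).h1.continuousAt
    have e1 : segX f U y x z 1 = z := h.toPre.segX_one hz hy
    have hev : ∀ᶠ t in nhds (1:ℝ), u z + f (z, y) ≤ u (segX f U y x z t) + f (segX f U y x z t, y) := by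
      have hc' : Filter.Tendsto (segX f U y x z) (nhds 1) (nhds z) := by
        have := hc.tendsto
        rwa [e1] at this
      exact hc'.eventually hmin
    have hev1 : ∀ᶠ t in nhdsWithin (1:ℝ) (Iio 1),
        u z + f (z, y) ≤ u (segX f U y x z t) + f (segX f U y x z t, y) := nhdsWithin_le_nhds hev
    have hev2 : ∀ᶠ t in nhdsWithin (1:ℝ) (Iio 1), 0 < t :=
      nhdsWithin_le_nhds (lt_mem_nhds one_pos)
    obtain ⟨t, ⟨h1, h2⟩, h3⟩ := ((hev1.and hev2).and self_mem_nhdsWithin).exists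
    have h4 := h.m_three hx hz hy h2 h3 (by linarith)
    have hC := C0_pos (B := B) (μ := μ)
    have h5 : 0 < C0 B μ * (1 - t) * ((u (segX f U y x z t) + f (segX f U y x z t, y))
      - (u x + f (x, y))) := mul_pos (mul_pos hC (by have : t < 1 := h3; linarith)) (by linarith)
    have h6 : t * ((u z + f (z, y)) - (u (segX f U y x z t) + f (segX f U y x z t, y))) ≤ 0 :=
      mul_nonpos_of_nonneg_of_nonpos h2.le (by linarith)
    linarith
  intro x hx
  have c1 : ContinuousOn (fun x => u x + f (x, y)) (closure U) :=
    h.uc.add (h.cf.comp (by fun_prop) (fun x hx => ⟨hx, subset_closure hy⟩))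
  exact ContinuousWithinAt.closure_le hx continuousWithinAt_const
    ((c1 x hx).mono subset_closure) hU

/-- Sections of the potential. -/
def sect (f : Euc n × Euc n → ℝ) (U : Set (Euc n)) (u : Euc n → ℝ) (y0 : Euc n) (τ : ℝ) : Set (Euc n) :=
  {x ∈ closure U | u x + f (x, y0) ≤ τ}

theorem MA.sect_compact (h : MA n f U V B μ u us) {y0 : Euc n} (hy0 : y0 ∈ V) (τ : ℝ) :
    IsCompact (sect f U u y0 τ) := by
  have c1 : ContinuousOn (fun x => u x + f (x, y0)) (closure U) :=
    h.uc.add (h.cf.comp (by fun_prop) (fun x hx => ⟨hx, subset_closure hy0⟩))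
  have hc : IsCompact (closure U) := h.bU.isCompact_closure
  exact hc.of_isClosed_subset (c1.preimage_isClosed_of_isClosed isClosed_closure isClosed_Iic)
    (fun x hx => hx.1)

theorem MA.sect_img_compact (h : MA n f U V B μ u us) {y0 : Euc n} (hy0 : y0 ∈ V) (τ : ℝ)
    (hZ : sect f U u y0 τ ⊆ U) : IsCompact ((fun x => gY f x y0) '' sect f U u y0 τ) :=
  (h.sect_compact hy0 τ).image_of_continuousOn ((h.toPre.gY_contDiff hy0).continuousOn.mono hZ)

theorem MA.sect_img_convex (h : MA n f U V B μ u us) {y0 : Euc n} (hy0 : y0 ∈ V) (τ : ℝ)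
    (hZ : sect f U u y0 τ ⊆ U) : Convex ℝ ((fun x => gY f x y0) '' sect f U u y0 τ) := by
  rintro _ ⟨x0, h0, rfl⟩ _ ⟨x1, h1, rfl⟩ a b ha hb hab
  have hbm : b ∈ Icc (0:ℝ) 1 := ⟨hb, by linarith⟩
  refine ⟨segX f U y0 x0 x1 b, ⟨subset_closure (h.toPre.segX_mem (hZ h0) (hZ h1) hy0 hbm),
    h.m_max (hZ h0) (hZ h1) hy0 hbm h0.2 h1.2⟩, ?_⟩
  simp only
  rw [h.toPre.gY_segX (hZ h0) (hZ h1) hy0 hbm]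
  have : a = 1 - b := by linarith
  subst this; module
end

section
variable {n : ℕ} {f : Euc n × Euc n → ℝ} {U V : Set (Euc n)} {B μ : ℝ} {u us : Euc n → ℝ}

/-- The set of slopes with small oscillation on `Z`. -/
def Wset (f : Euc n × Euc n → ℝ) (V Z : Set (Euc n)) (x0 y0 : Euc n) (hh σ : ℝ) : Set (Euc n) :=
  {y ∈ V | (∀ z ∈ Z, ∀ z' ∈ Z, (f (z, y0) - f (z, y)) - (f (z', y0) - f (z', y)) ≤ hh / 2) ∧
    ‖gX f x0 y - gX f x0 y0‖ ≤ σ}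

/-- Image of the subdifferential. -/
def dS (f : Euc n × Euc n → ℝ) (V : Set (Euc n)) (u us : Euc n → ℝ) (X : Set (Euc n)) : Set (Euc n) :=
  {y ∈ closure V | ∃ x ∈ X, u x + us y + f (x, y) = 0}

theorem MA.lemA_osc (h : MA n f U V B μ u us) {y0 x0 xc z' y : Euc n} {τ hh κ κ' t σ : ℝ}
    (hy0 : y0 ∈ V) (hZ : sect f U u y0 τ ⊆ U) (hhh : 0 < hh)
    (hH : ∀ x ∈ sect f U u y0 τ, τ - (u x + f (x, y0)) ≤ 3 * hh) (hx0 : x0 ∈ sect f U u y0 τ)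
    (hκ : 0 < κ) (hκ' : 0 < κ') (hxc : xc ∈ sect f U u y0 τ)
    (hdc : Deep κ ((fun x => gY f x y0) '' sect f U u y0 τ) (gY f xc y0))
    (hz' : z' ∈ sect f U u y0 τ)
    (hdz : Deep κ' ((fun x => gY f x y0) '' sect f U u y0 τ) (gY f z' y0))
    (hy : y ∈ V) (he : u z' + us y + f (z', y) = 0) (ht0 : 0 < t) (ht : t ≤ 1 / 2)
    (ht1 : 2 * t / C0 B μ * (3 + 3 / (C0 B μ * κ')) * (1 + 1 / (C0 B μ * κ)) ≤ 1 / 2)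
    (ht2 : B * μ⁻¹ * (t * (2 * B)) ≤ σ) :
    segX (f ∘ sw n) V xc y0 y t ∈ Wset f V (sect f U u y0 τ) x0 y0 hh σ := by
  set Z := sect f U u y0 τ with hZd
  have hC := C0_pos (B := B) (μ := μ)
  have hB := h.hB
  have hμ := h.hμ
  set yt := segX (f ∘ sw n) V xc y0 y t with hyt
  have htI : t ∈ Icc (0:ℝ) 1 := ⟨ht0.le, by linarith⟩
  have hytV : yt ∈ V := h.toGood.swap.toPre.segX_mem hy0 hy (hZ hxc) htI
  have s1 : ∀ q ∈ Z, (f (q, y0) - f (q, y)) - (f (z', y0) - f (z', y)) ≤ 3 * hh := by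
    intro q hq
    have a1 := h.hus q hq.1 y (subset_closure hy)
    have a2 := hH z' hz'
    have a3 := hq.2
    linarith
  have s2 : ∀ q ∈ Z, (f (z', y0) - f (z', y)) - (f (q, y0) - f (q, y)) ≤ 3 * hh / (C0 B μ * κ') :=
    fun q hq => h.toGood.deep hy0 hy hZ hκ' (hZ hz') hdz s1 (by positivity) hq
  set A1 : ℝ := (3 + 3 / (C0 B μ * κ')) * hh with hA1
  have hA10 : 0 < A1 := by positivity
  have s3 : ∀ z ∈ Z, (f (xc, y) - f (z, y)) - (f (xc, y0) - f (z, y0)) ≤ A1 := by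
    intro z hz
    have a1 := s1 z hz
    have a2 := s2 xc hxc
    have : A1 = 3 * hh + 3 * hh / (C0 B μ * κ') := by rw [hA1]; ring
    linarith
  set A2 : ℝ := 2 * t / C0 B μ * A1 with hA2
  have hA20 : 0 ≤ A2 := by positivity
  have s4 : ∀ z ∈ Z, (f (z, y0) - f (z, yt)) - (f (xc, y0) - f (xc, yt)) ≤ A2 := by
    intro z hz
    have := h.toGood.swap.contract hy0 hy (hZ hxc) (hZ hz) ht0 ht hA10.le (s3 z hz)
    simp only [Function.comp, sw_mk] at this
    have e : (f (xc, yt) - f (z, yt)) - (f (xc, y0) - f (z, y0)) ≤ A2 := this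
    linarith
  have s5 : ∀ q ∈ Z, (f (xc, y0) - f (xc, yt)) - (f (q, y0) - f (q, yt)) ≤ A2 / (C0 B μ * κ) :=
    fun q hq => h.toGood.deep hy0 hytV hZ hκ (hZ hxc) hdc s4 hA20 hq
  refine ⟨hytV, ?_, ?_⟩
  · intro z hz z1 hz1
    have a1 := s4 z hz
    have a2 := s5 z1 hz1
    have e : A2 + A2 / (C0 B μ * κ)
        = (2 * t / C0 B μ * (3 + 3 / (C0 B μ * κ')) * (1 + 1 / (C0 B μ * κ))) * hh := by
      rw [hA2, hA1]; ring
    have := mul_le_mul_of_nonneg_right ht1 hhh.le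
    linarith
  · have a1 : ‖gX f x0 yt - gX f x0 y0‖ ≤ B * μ⁻¹ * ‖gX f xc yt - gX f xc y0‖ :=
      h.toPre.swap.gY_change hytV hy0 (hZ hx0) (hZ hxc)
    have a2 : gX f xc yt = gX f xc y0 + t • (gX f xc y - gX f xc y0) :=
      h.toPre.swap.gY_segX hy0 hy (hZ hxc) htI
    have a3 : ‖gX f xc y‖ ≤ B := h.toPre.swap.norm_gY_le hy (hZ hxc)
    have a4 : ‖gX f xc y0‖ ≤ B := h.toPre.swap.norm_gY_le hy0 (hZ hxc)
    rw [a2, add_sub_cancel_left, norm_smul, Real.norm_of_nonneg ht0.le] at a1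
    refine a1.trans (le_trans ?_ ht2)
    gcongr
    exact (norm_sub_le _ _).trans (by linarith)

theorem MA.lemA (hn : 1 ≤ n) (h : MA n f U V B μ u us) (hVf : volume (frontier V) = 0)
    {Ulam : Set (Euc n)} {lam : ℝ} (hlam : 0 < lam)
    (hge : ∀ X : Set (Euc n), X ⊆ Ulam → MeasurableSet X →
      ENNReal.ofReal lam * volume X ≤ volume (dS f V u us X))
    {xbar : Euc n} {r : ℝ} (hr : 0 < r) (hball : ball xbar r ⊆ Ulam) {σ : ℝ} (hσ : 0 < σ) :
    ∃ CA : ℝ≥0∞, CA ≠ ⊤ ∧ ∀ (y0 x0 : Euc n) (τ hh : ℝ), y0 ∈ V → sect f U u y0 τ ⊆ U → 0 < hh →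
      (∀ x ∈ sect f U u y0 τ, τ - (u x + f (x, y0)) ≤ 3 * hh) → x0 ∈ sect f U u y0 τ →
      xbar ∈ sect f U u y0 τ →
      volume ((fun x => gY f x y0) '' sect f U u y0 τ)
        ≤ CA * volume (Wset f V (sect f U u y0 τ) x0 y0 hh σ) := by
  have hC := C0_pos (B := B) (μ := μ)
  have hB := h.hB
  have hμ := h.hμ
  obtain ⟨D1, -, hD1⟩ := exists_vol_bound n B
  obtain ⟨D2, -, hD2⟩ := exists_vol_bound n μ⁻¹
  have hn0 : (0:ℝ) < n := by exact_mod_cast hn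
  set κ : ℝ := 1 / n with hκd
  have hκ : 0 < κ := by positivity
  have hκ1 : κ ≤ 1 := by
    rw [hκd, div_le_one hn0]; exact_mod_cast hn
  set η : ℝ := min 1 (r * μ / (4 * B)) with hηd
  have hη : 0 < η := lt_min one_pos (by positivity)
  have hη1 : η ≤ 1 := min_le_left _ _
  have hηr : μ⁻¹ * (η * (2 * B)) < r := by
    have : η ≤ r * μ / (4 * B) := min_le_right _ _
    rw [le_div_iff₀ (by positivity)] at this
    rw [inv_mul_lt_iff₀ hμ]
    nlinarith [mul_pos hr hμ]
  set κ' : ℝ := η * κ / 4 with hκ'd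
  have hκ' : 0 < κ' := by positivity
  set T : ℝ := 2 / C0 B μ * (3 + 3 / (C0 B μ * κ')) * (1 + 1 / (C0 B μ * κ)) with hT
  have hT0 : 0 < T := by positivity
  set t : ℝ := min (1 / 2) (min (1 / (2 * T)) (σ / (2 * B * (B * μ⁻¹)))) with htd
  have ht0 : 0 < t := lt_min (by norm_num) (lt_min (by positivity) (by positivity))
  have ht : t ≤ 1 / 2 := min_le_left _ _
  have ht1 : 2 * t / C0 B μ * (3 + 3 / (C0 B μ * κ')) * (1 + 1 / (C0 B μ * κ)) ≤ 1 / 2 := by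
    have a : t ≤ 1 / (2 * T) := (min_le_right _ _).trans (min_le_left _ _)
    rw [le_div_iff₀ (by positivity)] at a
    have e : 2 * t / C0 B μ * (3 + 3 / (C0 B μ * κ')) * (1 + 1 / (C0 B μ * κ)) = t * T := by
      rw [hT]; ring
    rw [e]; linarith
  have ht2 : B * μ⁻¹ * (t * (2 * B)) ≤ σ := by
    have a : t ≤ σ / (2 * B * (B * μ⁻¹)) := (min_le_right _ _).trans (min_le_right _ _)
    rw [le_div_iff₀ (by positivity)] at a
    linarith
  clear_value t η
  set e : ℝ≥0∞ := ENNReal.ofReal ((η / 2) ^ n) with hed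
  have he0 : e ≠ 0 := by rw [hed]; simp only [ne_eq, ENNReal.ofReal_eq_zero, not_le]; positivity
  have heT : e ≠ ⊤ := ENNReal.ofReal_ne_top
  set s : ℝ≥0∞ := ENNReal.ofReal (t ^ n) with hsd
  have hs0 : s ≠ 0 := by rw [hsd]; simp only [ne_eq, ENNReal.ofReal_eq_zero, not_le]; positivity
  have hsT : s ≠ ⊤ := ENNReal.ofReal_ne_top
  set a : ℝ≥0∞ := ENNReal.ofReal lam with had
  have ha0 : a ≠ 0 := by rw [had]; simpa using hlam
  have haT : a ≠ ⊤ := ENNReal.ofReal_ne_top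
  refine ⟨e⁻¹ * (D1 * (a⁻¹ * (D2 * (s⁻¹ * D1)))), ?_, ?_⟩
  · refine ENNReal.mul_ne_top (ENNReal.inv_ne_top.2 he0) (ENNReal.mul_ne_top ENNReal.coe_ne_top
      (ENNReal.mul_ne_top (ENNReal.inv_ne_top.2 ha0) (ENNReal.mul_ne_top ENNReal.coe_ne_top
      (ENNReal.mul_ne_top (ENNReal.inv_ne_top.2 hs0) ENNReal.coe_ne_top))))
  intro y0 x0 τ hh hy0 hZ hhh hH hx0 hxbar
  set Z := sect f U u y0 τ with hZd
  set Q := (fun x => gY f x y0) '' Z with hQd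
  set O := (fun x => gY f x y0) '' U with hOd
  have hQO : Q ⊆ O := image_mono hZ
  have hQc : IsCompact Q := h.sect_img_compact hy0 τ hZ
  have hQv : Convex ℝ Q := h.sect_img_convex hy0 τ hZ
  obtain ⟨c, hcQ, hcd⟩ := exists_deep hn hQc hQv ⟨_, mem_image_of_mem _ hxbar⟩
  obtain ⟨xc, hxc, rfl⟩ := hcQ
  simp only at hcd
  set qb := gY f xbar y0 with hqb
  have hqbQ : qb ∈ Q := mem_image_of_mem _ hxbar
  have hcQ : gY f xc y0 ∈ Q := mem_image_of_mem _ hxc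
  set ψ : Euc n → Euc n := fun z => (1 - η) • qb + (η / 2) • (gY f xc y0 + z) with hψ
  have hψc : Continuous ψ := by fun_prop
  set Q' := ψ '' Q with hQ'
  have hQ'Q : ∀ q ∈ Q', q ∈ Q ∧ Deep κ' Q q := by
    rintro _ ⟨z, hz, rfl⟩
    exact deep_shrink hQv hκ hκ1 hη hη1 hcQ hcd hqbQ hz
  have hQ'c : IsCompact Q' := hQc.image hψc
  set Z' := Xi f U y0 '' Q' with hZ'
  have hZ'c : IsCompact Z' := hQ'c.image_of_continuousOn
    ((h.toPre.Xi_contDiff hy0).continuousOn.mono (fun q hq => hQO (hQ'Q q hq).1))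
  have hZ'Z : ∀ z ∈ Z', z ∈ Z ∧ Deep κ' Q (gY f z y0) := by
    rintro _ ⟨q, hq, rfl⟩
    obtain ⟨h1, h2⟩ := hQ'Q q hq
    refine ⟨?_, by rwa [gY_Xi (hQO h1)]⟩
    obtain ⟨z, hz, rfl⟩ := h1
    simp only
    rw [h.toPre.Xi_gY (hZ hz) hy0]; exact hz
  have hnQ : ∀ q ∈ Q, ‖q‖ ≤ B := by
    rintro _ ⟨z, hz, rfl⟩
    exact h.toPre.norm_gY_le (hZ hz) hy0
  have hZ'U : Z' ⊆ Ulam := by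
    refine Subset.trans ?_ hball
    rintro _ ⟨_, ⟨z, hz, rfl⟩, rfl⟩
    have hq : ψ z ∈ O := hQO (hQ'Q _ (mem_image_of_mem _ hz)).1
    have h1 := h.toPre.Xi_lip hy0 hq (hQO hqbQ)
    rw [hqb, h.toPre.Xi_gY (hZ hxbar) hy0] at h1
    rw [mem_ball, dist_eq_norm]
    refine lt_of_le_of_lt (h1.trans ?_) hηr
    have e1 : ψ z - gY f xbar y0 = (η / 2) • ((gY f xc y0 - qb) + (z - qb)) := by
      rw [hψ, ← hqb]; module
    rw [e1, norm_smul, Real.norm_of_nonneg (by positivity)]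
    have n1 := hnQ _ hqbQ
    have n2 := hnQ _ hcQ
    have n3 := hnQ _ hz
    have : ‖(gY f xc y0 - qb) + (z - qb)‖ ≤ 4 * B := by
      refine (norm_add_le _ _).trans ?_
      have := norm_sub_le (gY f xc y0) qb
      have := norm_sub_le z qb
      linarith
    refine mul_le_mul_of_nonneg_left ?_ (by positivity)
    nlinarith
  -- volume of Q'
  have v1 : volume Q' = e * volume Q := by
    have : Q' = ((1 - η) • qb + (η / 2) • gY f xc y0) +ᵥ ((η / 2) • Q) := by
      ext q
      simp only [hQ', hψ, mem_image, mem_vadd_set, mem_smul_set, vadd_eq_add]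
      constructor
      · rintro ⟨z, hz, rfl⟩
        exact ⟨_, ⟨z, hz, rfl⟩, by module⟩
      · rintro ⟨_, ⟨z, hz, rfl⟩, rfl⟩
        exact ⟨z, hz, by module⟩
    rw [this, measure_vadd, Measure.addHaar_smul, finrank_euclideanSpace_fin, abs_of_pos (by positivity)]
  have v2 : volume Q' ≤ D1 * volume Z' := by
    have e1 : Q' = (fun x => gY f x y0) '' Z' := by
      rw [hZ', image_image]
      ext q
      constructor
      · intro hq
        exact ⟨q, hq, gY_Xi (hQO (hQ'Q q hq).1)⟩
      · rintro ⟨p, hp, rfl⟩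
        simp only
        rwa [gY_Xi (hQO (hQ'Q p hp).1)]
    rw [e1]
    exact hD1 _ U Z' h.oU (fun z hz => hZ (hZ'Z z hz).1)
      ((h.toPre.gY_contDiff hy0).differentiableOn (by norm_num)) (fun x hx => h.toPre.gY_upper hx hy0)
  set A := dS f V u us Z' ∩ V with hA
  have v3 : a * volume Z' ≤ volume A := by
    refine (hge Z' hZ'U hZ'c.isClosed.measurableSet).trans ?_
    have : dS f V u us Z' ⊆ A ∪ frontier V := by
      intro y hy
      by_cases hyV : y ∈ V
      · exact Or.inl ⟨hy, hyV⟩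
      · refine Or.inr ?_
        rw [h.oV.frontier_eq]; exact ⟨hy.1, hyV⟩
    calc _ ≤ volume (A ∪ frontier V) := measure_mono this
      _ ≤ _ := measure_union_le _ _
      _ = _ := by rw [hVf, add_zero]
  have hxcU : xc ∈ U := hZ hxc
  set P : Euc n → Euc n := fun y => gX f xc y with hP
  have hsw := h.toPre.swap
  have v4 : volume A ≤ D2 * volume (P '' A) := by
    have e1 : A = Xi (f ∘ sw n) V xc '' (P '' A) := by
      rw [image_image]
      ext y
      constructor
      · intro hy
        exact ⟨y, hy, hsw.Xi_gY hy.2 hxcU⟩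
      · rintro ⟨p, hp, rfl⟩
        have : Xi (f ∘ sw n) V xc (P p) = p := hsw.Xi_gY hp.2 hxcU
        change Xi (f ∘ sw n) V xc (P p) ∈ A
        rwa [this]
    conv_lhs => rw [e1]
    exact hD2 _ (P '' V) (P '' A) (hsw.open_image hxcU) (image_mono inter_subset_right)
      ((hsw.Xi_contDiff hxcU).differentiableOn (by norm_num)) (hsw.Xi_fderiv hxcU)
  have v5 : s * volume (P '' A) ≤ D1 * volume (Wset f V Z x0 y0 hh σ) := by
    have e1 := Measure.addHaar_image_homothety (volume : Measure (Euc n)) (P y0) t (P '' A)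
    rw [finrank_euclideanSpace_fin, abs_of_pos (by positivity)] at e1
    rw [hsd, ← e1]
    have hsub : AffineMap.homothety (P y0) t '' (P '' A) ⊆ P '' (Wset f V Z x0 y0 hh σ) := by
      rintro _ ⟨_, ⟨y, hy, rfl⟩, rfl⟩
      obtain ⟨⟨_, z', hz', hez⟩, hyV⟩ := hy
      obtain ⟨h1, h2⟩ := hZ'Z z' hz'
      refine ⟨segX (f ∘ sw n) V xc y0 y t, ?_, ?_⟩
      · exact h.lemA_osc hy0 hZ hhh hH hx0 hκ hκ' hxc hcd h1 h2 hyV hez ht0 ht ht1 ht2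
      · have : P (segX (f ∘ sw n) V xc y0 y t) = P y0 + t • (P y - P y0) :=
          hsw.gY_segX hy0 hyV hxcU ⟨ht0.le, by linarith⟩
        rw [this, AffineMap.homothety_apply, vsub_eq_sub, vadd_eq_add, add_comm]
    refine (measure_mono hsub).trans ?_
    exact hD1 _ V _ h.oV (fun y hy => hy.1)
      ((hsw.gY_contDiff hxcU).differentiableOn (by norm_num)) (fun y hy => hsw.gY_upper hy hxcU)
  have cancel : ∀ (b w : ℝ≥0∞), b ≠ 0 → b ≠ ⊤ → w = b⁻¹ * (b * w) := fun b w h0 hT => by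
    rw [← mul_assoc, ENNReal.inv_mul_cancel h0 hT, one_mul]
  calc volume Q = e⁻¹ * volume Q' := by rw [v1]; exact cancel e _ he0 heT
    _ ≤ e⁻¹ * (D1 * volume Z') := by gcongr
    _ = e⁻¹ * (D1 * (a⁻¹ * (a * volume Z'))) := by rw [← cancel a _ ha0 haT]
    _ ≤ e⁻¹ * (D1 * (a⁻¹ * (D2 * volume (P '' A)))) := 
        mul_le_mul' le_rfl (mul_le_mul' le_rfl (mul_le_mul' le_rfl (v3.trans v4)))
    _ = e⁻¹ * (D1 * (a⁻¹ * (D2 * (s⁻¹ * (s * volume (P '' A)))))) := by rw [← cancel s _ hs0 hsT]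
    _ ≤ e⁻¹ * (D1 * (a⁻¹ * (D2 * (s⁻¹ * (D1 * volume (Wset f V Z x0 y0 hh σ)))))) := by gcongr
    _ = _ := by ring
end

section
variable {n : ℕ} {f : Euc n × Euc n → ℝ} {U V : Set (Euc n)} {B μ : ℝ} {u us : Euc n → ℝ}

/-- Slopes whose supporting function is not larger than at `x0` by more than `hh/2`. -/
def Cset (f : Euc n × Euc n → ℝ) (V Z : Set (Euc n)) (x0 y0 : Euc n) (hh : ℝ) : Set (Euc n) :=
  {y ∈ V | ∀ z ∈ Z, (f (z, y0) - f (z, y)) - (f (x0, y0) - f (x0, y)) ≤ hh / 2}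

theorem MA.Cset_convex (h : MA n f U V B μ u us) {Z : Set (Euc n)} {x0 y0 : Euc n} {hh : ℝ}
    (hZ : Z ⊆ U) (hx0 : x0 ∈ U) : Convex ℝ ((fun y => gX f x0 y) '' Cset f V Z x0 y0 hh) := by
  rintro _ ⟨y, hy, rfl⟩ _ ⟨y', hy', rfl⟩ a b ha hb hab
  have hbm : b ∈ Icc (0:ℝ) 1 := ⟨hb, by linarith⟩
  refine ⟨segX (f ∘ sw n) V x0 y y' b, ⟨h.toPre.swap.segX_mem hy.1 hy'.1 hx0 hbm, fun z hz => ?_⟩, ?_⟩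
  · have h1 := hy.2 z hz
    have h2 := hy'.2 z hz
    have := h.toGood.swap.max_le hy.1 hy'.1 hx0 (hZ hz) hbm (K := hh / 2 + (f (x0, y0) - f (z, y0)))
      (by simp only [Function.comp, sw_mk]; linarith) (by simp only [Function.comp, sw_mk]; linarith)
    simp only [Function.comp, sw_mk] at this
    have e : f (x0, segX (f ∘ sw n) V x0 y y' b) - f (z, segX (f ∘ sw n) V x0 y y' b)
      ≤ hh / 2 + (f (x0, y0) - f (z, y0)) := this
    linarith
  · have : gX f x0 (segX (f ∘ sw n) V x0 y y' b) = gX f x0 y + b • (gX f x0 y' - gX f x0 y) :=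
      h.toPre.swap.gY_segX hy.1 hy'.1 hx0 hbm
    simp only [this]
    have : a = 1 - b := by linarith
    subst this; module

theorem MA.Cset_sub (h : MA n f U V B μ u us) {x0 y0 : Euc n} {τ hh : ℝ} (hy0 : y0 ∈ V)
    (hZ : sect f U u y0 τ ⊆ U) (hhh : 0 < hh) (hx0 : x0 ∈ sect f U u y0 τ)
    (hx0h : hh ≤ τ - (u x0 + f (x0, y0))) :
    Cset f V (sect f U u y0 τ) x0 y0 hh ⊆ dS f V u us (sect f U u y0 τ) := by
  intro y hy
  have hm : ∀ y ∈ V, ContinuousOn (fun x => u x + f (x, y)) (closure U) := fun y hy =>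
    h.uc.add (h.cf.comp (by fun_prop) (fun x hx => ⟨hx, subset_closure hy⟩))
  obtain ⟨z, hz, hzm⟩ := (h.sect_compact hy0 τ).exists_isMinOn ⟨x0, hx0⟩
    ((hm y hy.1).mono (fun x hx => hx.1))
  have hzm' : ∀ x ∈ sect f U u y0 τ, u z + f (z, y) ≤ u x + f (x, y) := fun x hx => hzm hx
  refine ⟨subset_closure hy.1, z, hz, ?_⟩
  have h1 := hy.2 z hz
  have h2 := hzm' x0 hx0
  have hlt : u z + f (z, y0) < τ := by linarith
  apply h.datt y (subset_closure hy.1) z hz.1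
  apply h.local_min (hZ hz) hy.1
  have hca : ContinuousAt (fun x => u x + f (x, y0)) z :=
    (hm y0 hy0).continuousAt (Filter.mem_of_superset (h.oU.mem_nhds (hZ hz)) subset_closure)
  filter_upwards [hca.eventually_lt continuousAt_const hlt, h.oU.mem_nhds (hZ hz)] with x hx1 hx2
  exact hzm' x ⟨subset_closure hx2, hx1.le⟩

theorem MA.Wset_meas (h : MA n f U V B μ u us) {Z : Set (Euc n)} {x0 y0 : Euc n} {hh σ : ℝ}
    (hZ : Z ⊆ U) (hx0 : x0 ∈ U) : MeasurableSet (Wset f V Z x0 y0 hh σ) := by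
  have e : Wset f V Z x0 y0 hh σ = Subtype.val '' {y : V |
      (∀ z ∈ Z, ∀ z' ∈ Z, (f (z, y0) - f (z, y)) - (f (z', y0) - f (z', y)) ≤ hh / 2) ∧
      ‖gX f x0 y - gX f x0 y0‖ ≤ σ} := by
    ext y
    constructor
    · intro hy; exact ⟨⟨y, hy.1⟩, hy.2, rfl⟩
    · rintro ⟨⟨y, hyV⟩, hy, rfl⟩; exact ⟨hyV, hy⟩
  rw [e]
  apply h.oV.measurableSet.subtype_image
  apply IsClosed.measurableSet
  have hfc : ∀ z ∈ U, Continuous (fun y : V => f (z, (y : Euc n))) := by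
    intro z hz
    have : ContinuousOn (fun y => f (z, y)) V :=
      h.cf.comp (by fun_prop) (fun y hy => ⟨subset_closure hz, subset_closure hy⟩)
    exact this.restrict
  have hgc : Continuous (fun y : V => gX f x0 (y : Euc n)) :=
    ((h.toPre.swap.gY_contDiff hx0).continuousOn).restrict
  have e2 : {y : V |
      (∀ z ∈ Z, ∀ z' ∈ Z, (f (z, y0) - f (z, y)) - (f (z', y0) - f (z', y)) ≤ hh / 2) ∧
      ‖gX f x0 y - gX f x0 y0‖ ≤ σ} = (⋂ z ∈ Z, ⋂ z' ∈ Z,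
        {y : V | (f (z, y0) - f (z, y)) - (f (z', y0) - f (z', y)) ≤ hh / 2}) ∩
        {y : V | ‖gX f x0 y - gX f x0 y0‖ ≤ σ} := by
    ext y
    simp only [mem_inter_iff, mem_iInter, mem_setOf_eq]
  rw [e2]
  apply IsClosed.inter
  · refine isClosed_biInter fun z hz => isClosed_biInter fun z' hz' => ?_
    have c1 := hfc z (hZ hz)
    have c2 := hfc z' (hZ hz')
    exact isClosed_le ((continuous_const.sub c1).sub (continuous_const.sub c2)) continuous_const
  · exact isClosed_le (by fun_prop) continuous_const

/-- Translates of `W` are disjoint. -/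
theorem MA.lemB_sep (h : MA n f U V B μ u us) {x0 x1 y0 y1 : Euc n} {Z : Set (Euc n)} {hh σ g dd : ℝ}
    (hZ : Z ⊆ U) (hx0 : x0 ∈ Z) (hx1 : x1 ∈ Z) (hy0 : y0 ∈ V) (hy1 : y1 ∈ V) (hh0 : 0 < hh)
    {N : ℕ} (hN : 1 ≤ N)
    (hg : g = (f (x0, y0) - f (x1, y0)) - (f (x0, y1) - f (x1, y1)))
    (hdd : ‖gX f x0 y1 - gX f x0 y0‖ ≤ dd)
    (hsep : N * hh < g - 2 * Kf B μ * dd * (2 * dd + σ))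
    {y y' : Euc n} (hy : y ∈ Wset f V Z x0 y0 hh σ) (hy' : y' ∈ Wset f V Z x0 y0 hh σ)
    {a : ℝ} (ha : 1 / (N : ℝ) ≤ a) (ha1 : a ≤ 1)
    (he : gX f x0 y' = gX f x0 y + a • (gX f x0 y1 - gX f x0 y0)) : False := by
  have hsw := h.toPre.swap
  have hx0U := hZ hx0
  have hx1U := hZ hx1
  set P : Euc n → Euc n := fun y => gY (f ∘ sw n) y x0 with hP
  set O := P '' V with hO
  have oO : IsOpen O := hsw.open_image hx0U
  have cO : Convex ℝ O := hsw.convY x0 hx0U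
  set F0 : Euc n → ℝ := fun q => (f ∘ sw n) (Xi (f ∘ sw n) V x0 q, x0) with hF0
  set F1 : Euc n → ℝ := fun q => (f ∘ sw n) (Xi (f ∘ sw n) V x0 q, x1) with hF1
  have hd0 : DifferentiableOn ℝ F0 O := (hsw.F_contDiff hx0U hx0U).differentiableOn (by norm_num)
  have hd1 : DifferentiableOn ℝ F1 O := (hsw.F_contDiff hx0U hx1U).differentiableOn (by norm_num)
  have hK := Kf_nonneg h.toPre
  set Γ : Euc n → ℝ := fun q => F0 q - F1 q with hΓ
  have hdΓ : DifferentiableOn ℝ Γ O := hd0.sub hd1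
  have hfd : ∀ p ∈ O, fderiv ℝ Γ p = fderiv ℝ F0 p - fderiv ℝ F1 p := fun p hp =>
    fderiv_fun_sub ((hd0 p hp).differentiableAt (oO.mem_nhds hp))
      ((hd1 p hp).differentiableAt (oO.mem_nhds hp))
  have hlip : ∀ p ∈ O, ∀ p' ∈ O, ‖fderiv ℝ Γ p - fderiv ℝ Γ p'‖ ≤ (2 * Kf B μ) * ‖p - p'‖ := by
    intro p hp p' hp'
    rw [hfd p hp, hfd p' hp']
    have a1 := hsw.F_lip hx0U hx0U p hp p' hp'
    have a2 := hsw.F_lip hx0U hx1U p hp p' hp'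
    have : fderiv ℝ F0 p - fderiv ℝ F1 p - (fderiv ℝ F0 p' - fderiv ℝ F1 p')
      = (fderiv ℝ F0 p - fderiv ℝ F0 p') - (fderiv ℝ F1 p - fderiv ℝ F1 p') := by abel
    rw [this]
    refine (norm_sub_le _ _).trans ?_
    refine (add_le_add a1 a2).trans (le_of_eq ?_)
    ring
  have hval : ∀ w ∈ V, Γ (P w) = f (x0, w) - f (x1, w) := by
    intro w hw
    have : Xi (f ∘ sw n) V x0 (P w) = w := hsw.Xi_gY hw hx0U
    simp only [hΓ, hF0, hF1, this, Function.comp, sw_mk]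
  set d := P y1 - P y0 with hd
  have hdd' : ‖d‖ ≤ dd := hdd
  have hPy' : P y' = P y + a • d := he
  have hK2 : 0 ≤ 2 * Kf B μ := by positivity
  have mO : ∀ w ∈ V, P w ∈ O := fun w hw => mem_image_of_mem _ hw
  have t1 := taylor_of_fderiv_lip oO cO hdΓ hlip hK2 (mO y0 hy0) (mO y1 hy1)
  have t2 := taylor_of_fderiv_lip oO cO hdΓ hlip hK2 (mO y hy.1) (mO y' hy'.1)
  have hN0 : (0:ℝ) < N := by exact_mod_cast hN
  have ha0 : 0 < a := lt_of_lt_of_le (by positivity) ha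
  rw [hPy', add_sub_cancel_left, ← hPy', map_smul, smul_eq_mul, norm_smul, Real.norm_of_nonneg ha0.le,
    hval y hy.1, hval y' hy'.1] at t2
  rw [← hd, hval y0 hy0, hval y1 hy1] at t1
  have t3 : |fderiv ℝ Γ (P y) d - fderiv ℝ Γ (P y0) d| ≤ 2 * Kf B μ * σ * dd := by
    have b1 := hlip _ (mO y hy.1) _ (mO y0 hy0)
    have b2 : ‖P y - P y0‖ ≤ σ := hy.2.2
    have hσ0 : 0 ≤ σ := (norm_nonneg _).trans b2
    have b3 := (fderiv ℝ Γ (P y) - fderiv ℝ Γ (P y0)).le_opNorm d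
    rw [sub_apply, Real.norm_eq_abs] at b3
    refine b3.trans ?_
    refine mul_le_mul (b1.trans (mul_le_mul_of_nonneg_left b2 hK2)) hdd' (norm_nonneg _) (by positivity)
  have o1 := hy.2.1 x0 hx0 x1 hx1
  have o2 := hy'.2.1 x1 hx1 x0 hx0
  have o1' := hy.2.1 x1 hx1 x0 hx0
  have o2' := hy'.2.1 x0 hx0 x1 hx1
  have hdsq : ‖d‖ ^ 2 ≤ dd ^ 2 := by gcongr
  have q1 : 2 * Kf B μ * ‖d‖ ^ 2 ≤ 2 * Kf B μ * dd ^ 2 := by gcongr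
  have q2 : 2 * Kf B μ * (a * ‖d‖) ^ 2 ≤ a * (2 * Kf B μ * dd ^ 2) := by
    calc _ = a * (a * (2 * Kf B μ * ‖d‖ ^ 2)) := by ring
      _ ≤ a * (1 * (2 * Kf B μ * dd ^ 2)) := by gcongr
      _ = _ := by ring
  rw [abs_le] at t1 t2 t3
  set L0 := fderiv ℝ Γ (P y0) d
  set L1 := fderiv ℝ Γ (P y) d
  have r1 : L0 ≤ -g + 2 * Kf B μ * dd ^ 2 := by linarith [t1.1]
  have r2 : L1 ≤ -g + 2 * Kf B μ * dd ^ 2 + 2 * Kf B μ * σ * dd := by linarith [t3.2]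
  have r3 : a * L1 ≤ a * (-g + 2 * Kf B μ * dd ^ 2 + 2 * Kf B μ * σ * dd) :=
    mul_le_mul_of_nonneg_left r2 ha0.le
  have r4 : a * (N * hh) < a * (g - 2 * Kf B μ * dd * (2 * dd + σ)) :=
    mul_lt_mul_of_pos_left hsep ha0
  have r5 : hh ≤ a * (N * hh) := by
    have : 1 ≤ a * N := by rwa [div_le_iff₀ hN0] at ha
    nlinarith
  nlinarith [t2.2, t2.1]
end

section
variable {n : ℕ} {f : Euc n × Euc n → ℝ} {U V : Set (Euc n)} {B μ : ℝ} {u us : Euc n → ℝ}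

theorem MA.lemB (h : MA n f U V B μ u us) {Lam : ℝ}
    (hle : ∀ X : Set (Euc n), X ⊆ closure U → MeasurableSet X →
      volume (dS f V u us X) ≤ ENNReal.ofReal Lam * volume X) :
    ∃ CB : ℝ≥0∞, CB ≠ ⊤ ∧ ∀ (x0 x1 y0 y1 : Euc n) (τ hh σ g dd : ℝ) (N : ℕ), y0 ∈ V → y1 ∈ V →
      sect f U u y0 τ ⊆ U → 0 < hh → x0 ∈ sect f U u y0 τ → x1 ∈ sect f U u y0 τ →
      hh ≤ τ - (u x0 + f (x0, y0)) → 1 ≤ N →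
      g = (f (x0, y0) - f (x1, y0)) - (f (x0, y1) - f (x1, y1)) →
      ‖gX f x0 y1 - gX f x0 y0‖ ≤ dd → N * hh < g - 2 * Kf B μ * dd * (2 * dd + σ) →
      (∀ z ∈ sect f U u y0 τ, (f (z, y0) - f (z, y1)) - (f (x0, y0) - f (x0, y1)) ≤ hh / 2) →
      ((N + 1 : ℕ) : ℝ≥0∞) * volume (Wset f V (sect f U u y0 τ) x0 y0 hh σ)
        ≤ CB * volume ((fun x => gY f x y0) '' sect f U u y0 τ) := by
  obtain ⟨D1, -, hD1⟩ := exists_vol_bound n B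
  obtain ⟨D2, -, hD2⟩ := exists_vol_bound n μ⁻¹
  set e : ℝ≥0∞ := ENNReal.ofReal ((1 / 2 : ℝ) ^ n) with hed
  have he0 : e ≠ 0 := by rw [hed]; simp only [ne_eq, ENNReal.ofReal_eq_zero, not_le]; positivity
  have heT : e ≠ ⊤ := ENNReal.ofReal_ne_top
  refine ⟨D2 * (e⁻¹ * (D1 * (ENNReal.ofReal Lam * D2))), ?_, ?_⟩
  · exact ENNReal.mul_ne_top ENNReal.coe_ne_top (ENNReal.mul_ne_top (ENNReal.inv_ne_top.2 he0)
      (ENNReal.mul_ne_top ENNReal.coe_ne_top (ENNReal.mul_ne_top ENNReal.ofReal_ne_top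
      ENNReal.coe_ne_top)))
  intro x0 x1 y0 y1 τ hh σ g dd N hy0 hy1 hZ hhh hx0 hx1 hx0h hN hg hdd hsep hC1
  set Z := sect f U u y0 τ with hZd
  set W := Wset f V Z x0 y0 hh σ with hWd
  set C := Cset f V Z x0 y0 hh with hCd
  set P : Euc n → Euc n := fun y => gX f x0 y with hP
  have hx0U := hZ hx0
  have hsw := h.toPre.swap
  have hN0 : (0:ℝ) < N := by exact_mod_cast hN
  have hWC : W ⊆ C := fun y hy => ⟨hy.1, fun z hz => hy.2.1 z hz x0 hx0⟩
  have hy0C : y0 ∈ C := ⟨hy0, fun z _ => by simp only [sub_self]; positivity⟩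
  have hy1C : y1 ∈ C := ⟨hy1, hC1⟩
  have hconv : Convex ℝ (P '' C) := h.Cset_convex hZ hx0U
  have hWm : MeasurableSet W := h.Wset_meas hZ hx0U
  have hPc : ContinuousOn P V := (hsw.gY_contDiff hx0U).continuousOn
  have hinj : InjOn P V := by
    intro a ha b hb hab
    have e1 : Xi (f ∘ sw n) V x0 (P a) = a := hsw.Xi_gY ha hx0U
    have e2 : Xi (f ∘ sw n) V x0 (P b) = b := hsw.Xi_gY hb hx0U
    rw [← e1, ← e2, hab]
  have hWV : W ⊆ V := fun y hy => hy.1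
  have hPWm : MeasurableSet (P '' W) :=
    hWm.image_of_continuousOn_injOn (hPc.mono hWV) (hinj.mono hWV)
  set d := P y1 - P y0 with hd
  set T : ℕ → Set (Euc n) := fun j => ((1 / 2 : ℝ) • (P y0 + ((j : ℝ) / N) • d)) +ᵥ ((1 / 2 : ℝ) • (P '' W))
    with hT
  have hTm : ∀ j, MeasurableSet (T j) := fun j => (hPWm.const_smul₀ _).const_vadd _
  have hTv : ∀ j, volume (T j) = e * volume (P '' W) := by
    intro j
    rw [hT]
    simp only
    rw [measure_vadd, Measure.addHaar_smul, finrank_euclideanSpace_fin, abs_of_pos (by positivity)]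
  have hTmem : ∀ j p, p ∈ T j ↔ ∃ y ∈ W, p = (1 / 2 : ℝ) • (P y0 + ((j : ℝ) / N) • d) + (1 / 2 : ℝ) • P y := by
    intro j p
    simp only [hT, mem_vadd_set, mem_smul_set, vadd_eq_add, exists_exists_and_eq_and, mem_image]
    constructor
    · rintro ⟨y, hy, rfl⟩; exact ⟨y, hy, rfl⟩
    · rintro ⟨y, hy, rfl⟩; exact ⟨y, hy, rfl⟩
  have hdis : ∀ j k : ℕ, j < k → k ≤ N → Disjoint (T j) (T k) := by
    intro j k hjk hkN
    rw [Set.disjoint_left]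
    intro p hpj hpk
    obtain ⟨y, hy, rfl⟩ := (hTmem _ _).1 hpj
    obtain ⟨y', hy', he⟩ := (hTmem _ _).1 hpk
    have hjk' : (j:ℝ) + 1 ≤ k := by exact_mod_cast hjk
    have hkN' : (k:ℝ) ≤ N := by exact_mod_cast hkN
    have hj0 : (0:ℝ) ≤ j := by positivity
    refine h.lemB_sep hZ hx0 hx1 hy0 hy1 hhh hN hg hdd hsep hy' hy (a := ((k:ℝ) - j) / N) ?_ ?_ ?_
    · gcongr; linarith
    · rw [div_le_one hN0]; linarith
    · have e1 : P y = (2:ℝ) • ((1 / 2 : ℝ) • (P y0 + ((j : ℝ) / N) • d) + (1 / 2 : ℝ) • P y)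
          - (P y0 + ((j : ℝ) / N) • d) := by module
      rw [he] at e1
      change P y = P y' + _ • d
      rw [e1, sub_div]; module
  have hpd : (↑(Finset.range (N + 1)) : Set ℕ).PairwiseDisjoint T := by
    intro j hj k hk hne
    have hj' : j < N + 1 := Finset.mem_range.1 (Finset.mem_coe.1 hj)
    have hk' : k < N + 1 := Finset.mem_range.1 (Finset.mem_coe.1 hk)
    rcases lt_or_gt_of_ne hne with hlt | hlt
    · exact hdis j k hlt (by omega)
    · exact (hdis k j hlt (by omega)).symm
  have hsub : (⋃ j ∈ Finset.range (N + 1), T j) ⊆ P '' C := by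
    intro p hp
    simp only [mem_iUnion] at hp
    obtain ⟨j, hj, hp⟩ := hp
    obtain ⟨y, hy, rfl⟩ := (hTmem _ _).1 hp
    have hj' : (j:ℝ) ≤ N := by
      have := Finset.mem_range.1 hj
      exact_mod_cast (by omega : j ≤ N)
    have h1 : (j:ℝ) / N ≤ 1 := by rw [div_le_one hN0]; exact hj'
    have m1 : (1 - (j:ℝ) / N) • P y0 + ((j:ℝ) / N) • P y1 ∈ P '' C :=
      hconv (mem_image_of_mem _ hy0C) (mem_image_of_mem _ hy1C) (by linarith) (by positivity) (by ring)
    have m2 := hconv m1 (mem_image_of_mem P (hWC hy)) (a := 1 / 2) (b := 1 / 2) (by norm_num)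
      (by norm_num) (by norm_num)
    convert m2 using 2
    rw [hd]; module
  have v1 : ((N + 1 : ℕ) : ℝ≥0∞) * (e * volume (P '' W)) ≤ volume (P '' C) := by
    refine le_trans (le_of_eq ?_) (measure_mono hsub)
    rw [measure_biUnion_finset hpd (fun j _ => hTm j), Finset.sum_congr rfl (fun j _ => hTv j),
      Finset.sum_const, Finset.card_range, nsmul_eq_mul]
  have v2 : volume (P '' C) ≤ D1 * volume C :=
    hD1 _ V _ h.oV (fun y hy => hy.1)
      ((hsw.gY_contDiff hx0U).differentiableOn (by norm_num)) (fun y hy => hsw.gY_upper hy hx0U)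
  have v3 : volume C ≤ ENNReal.ofReal Lam * volume Z :=
    (measure_mono (h.Cset_sub hy0 hZ hhh hx0 hx0h)).trans
      (hle Z (fun z hz => hz.1) (h.sect_compact hy0 τ).isClosed.measurableSet)
  have v4 : volume Z ≤ D2 * volume ((fun x => gY f x y0) '' Z) := by
    have e1 : Z = Xi f U y0 '' ((fun x => gY f x y0) '' Z) := by
      rw [image_image]
      ext z
      constructor
      · intro hz
        exact ⟨z, hz, h.toPre.Xi_gY (hZ hz) hy0⟩
      · rintro ⟨p, hp, rfl⟩
        simp only
        rwa [h.toPre.Xi_gY (hZ hp) hy0]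
    conv_lhs => rw [e1]
    exact hD2 _ ((fun x => gY f x y0) '' U) _ (h.toPre.open_image hy0) (image_mono hZ)
      ((h.toPre.Xi_contDiff hy0).differentiableOn (by norm_num)) (h.toPre.Xi_fderiv hy0)
  have v5 : volume W ≤ D2 * volume (P '' W) := by
    have e1 : W = Xi (f ∘ sw n) V x0 '' (P '' W) := by
      rw [image_image]
      ext y
      constructor
      · intro hy
        exact ⟨y, hy, hsw.Xi_gY hy.1 hx0U⟩
      · rintro ⟨p, hp, rfl⟩
        have : Xi (f ∘ sw n) V x0 (P p) = p := hsw.Xi_gY hp.1 hx0U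
        change Xi (f ∘ sw n) V x0 (P p) ∈ W
        rwa [this]
    conv_lhs => rw [e1]
    exact hD2 _ (P '' V) (P '' W) (hsw.open_image hx0U) (image_mono hWV)
      ((hsw.Xi_contDiff hx0U).differentiableOn (by norm_num)) (hsw.Xi_fderiv hx0U)
  calc ((N + 1 : ℕ) : ℝ≥0∞) * volume W ≤ ((N + 1 : ℕ) : ℝ≥0∞) * (D2 * volume (P '' W)) :=
        mul_le_mul' le_rfl v5
    _ = ((N + 1 : ℕ) : ℝ≥0∞) * (D2 * ((e⁻¹ * e) * volume (P '' W))) := by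
        rw [ENNReal.inv_mul_cancel he0 heT, one_mul]
    _ = D2 * (e⁻¹ * (((N + 1 : ℕ) : ℝ≥0∞) * (e * volume (P '' W)))) := by ring
    _ ≤ D2 * (e⁻¹ * (D1 * (ENNReal.ofReal Lam * (D2 * volume ((fun x => gY f x y0) '' Z))))) := by
        refine mul_le_mul' le_rfl (mul_le_mul' le_rfl (v1.trans (v2.trans (mul_le_mul' le_rfl
          (v3.trans (mul_le_mul' le_rfl v4))))))
    _ = _ := by ring
end

section
variable {n : ℕ}

theorem sup_cont {A B : Set (Euc n)} (hA : IsCompact A) (hB : IsCompact B) (hBne : B.Nonempty)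
    {k : Euc n × Euc n → ℝ} (hk : ContinuousOn k (A ×ˢ B)) (v w : Euc n → ℝ)
    (hw : ∀ x ∈ A, w x = sSup ((fun y => -k (x, y) - v y) '' B))
    (hb : ∀ x ∈ A, BddAbove ((fun y => -k (x, y) - v y) '' B)) : ContinuousOn w A := by
  have huc := (hA.prod hB).uniformContinuousOn_of_continuous hk
  rw [Metric.uniformContinuousOn_iff] at huc
  rw [Metric.continuousOn_iff]
  intro x hx ε hε
  obtain ⟨δ, hδ, hδ'⟩ := huc (ε / 2) (by positivity)
  have key : ∀ x ∈ A, ∀ x' ∈ A, dist x x' < δ → w x ≤ w x' + ε / 2 := by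
    intro x hx x' hx' hd
    rw [hw x hx]
    refine csSup_le (hBne.image _) ?_
    rintro _ ⟨y, hy, rfl⟩
    have h1 : -k (x', y) - v y ≤ w x' := by
      rw [hw x' hx']; exact le_csSup (hb x' hx') (mem_image_of_mem _ hy)
    have h2 := hδ' (x, y) ⟨hx, hy⟩ (x', y) ⟨hx', hy⟩ (by simpa [Prod.dist_eq, hδ] using hd)
    rw [Real.dist_eq, abs_lt] at h2
    simp only
    linarith [h2.1]
  refine ⟨δ, hδ, fun x' hx' hd => ?_⟩
  have a1 := key x' hx' x hx hd
  have a2 := key x hx x' hx' (by rwa [dist_comm])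
  rw [Real.dist_eq, abs_lt]
  constructor <;> linarith

theorem ma_of_hyp {c : Euc n → Euc n → ℝ} {U V : Set (Euc n)} {u : Euc n → ℝ} {B μ : ℝ}
    (hB0 : B0cond n c U V) (hg : Good n (Function.uncurry c) U V B μ)
    (hu : CConvexOn n c (closure U) (closure V) u) (hUne : U.Nonempty) (hVne : V.Nonempty) :
    MA n (Function.uncurry c) U V B μ u (cStarT n c (closure U) u) := by
  obtain ⟨oU, bU, oV, bV, hc⟩ := hB0
  have cA : IsCompact (closure U) := bU.isCompact_closure
  have cB : IsCompact (closure V) := bV.isCompact_closure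
  have nA : (closure U).Nonempty := hUne.closure
  have nB : (closure V).Nonempty := hVne.closure
  have cf := hc.continuousOn
  set f := Function.uncurry c with hf
  have hfc : ∀ x y, c x y = f (x, y) := fun x y => rfl
  obtain ⟨M, hM⟩ := (cA.prod cB).exists_bound_of_continuousOn cf
  have hM' : ∀ x ∈ closure U, ∀ y ∈ closure V, |f (x, y)| ≤ M := fun x hx y hy =>
    hM (x, y) ⟨hx, hy⟩
  set us := cStarT n c (closure U) u with husd
  have hus0 : ∀ y, us y = sSup ((fun x => -f (x, y) - u x) '' closure U) := fun y => rfl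
  have hu0 : ∀ x ∈ closure U, u x = sSup ((fun y => -f (x, y) - us y) '' closure V) := hu
  -- boundedness below
  have hbd : ∃ m, ∀ x ∈ closure U, m ≤ u x := by
    by_contra hcon
    push Not at hcon
    have hz : ∀ y ∈ closure V, us y = 0 := by
      intro y hy
      rw [hus0]
      apply Real.sSup_of_not_bddAbove
      rintro ⟨K, hK⟩
      obtain ⟨x, hx, hlt⟩ := hcon (-M - K)
      have h1 := hK (mem_image_of_mem _ hx)
      have h2 := abs_le.1 (hM' x hx y hy)
      linarith [h2.2]
    obtain ⟨x, hx, hlt⟩ := hcon (-M)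
    obtain ⟨y, hy⟩ := nB
    have hb : BddAbove ((fun y => -f (x, y) - us y) '' closure V) := by
      refine ⟨M, ?_⟩
      rintro _ ⟨y, hy, rfl⟩
      have h2 := abs_le.1 (hM' x hx y hy)
      simp only [hz y hy]; linarith [h2.1]
    have h1 := le_csSup hb (mem_image_of_mem _ hy)
    rw [← hu0 x hx] at h1
    have h2 := abs_le.1 (hM' x hx y hy)
    simp only [hz y hy] at h1
    linarith [h2.2]
  obtain ⟨m, hm⟩ := hbd
  have hbI : ∀ y ∈ closure V, BddAbove ((fun x => -f (x, y) - u x) '' closure U) := by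
    intro y hy
    refine ⟨M - m, ?_⟩
    rintro _ ⟨x, hx, rfl⟩
    have h2 := abs_le.1 (hM' x hx y hy)
    have := hm x hx
    simp only; linarith [h2.1]
  have hus : ∀ x ∈ closure U, ∀ y ∈ closure V, 0 ≤ u x + us y + f (x, y) := by
    intro x hx y hy
    have h1 := le_csSup (hbI y hy) (mem_image_of_mem _ hx)
    rw [← hus0] at h1
    linarith
  have hbJ : ∀ x ∈ closure U, BddAbove ((fun y => -f (x, y) - us y) '' closure V) := by
    intro x hx
    refine ⟨u x, ?_⟩
    rintro _ ⟨y, hy, rfl⟩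
    have := hus x hx y hy
    simp only; linarith
  have uc : ContinuousOn u (closure U) := sup_cont cA cB nB cf us u hu0 hbJ
  have cf' : ContinuousOn (fun p : Euc n × Euc n => f (p.2, p.1)) (closure V ×ˢ closure U) :=
    cf.comp (by fun_prop) (fun p hp => ⟨hp.2, hp.1⟩)
  have usc : ContinuousOn us (closure V) :=
    sup_cont cB cA nA (k := fun p => f (p.2, p.1)) cf' u us (fun y _ => hus0 y) hbI
  refine { hg with bU := bU, bV := bV, cf := cf, uc := uc, hus := hus, att := ?_, datt := ?_ }
  · intro x hx
    have hcx : ContinuousOn (fun y => -f (x, y) - us y) (closure V) :=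
      ((cf.comp (by fun_prop) (fun y hy => ⟨hx, hy⟩)).neg).sub usc
    obtain ⟨y, hy, hmax⟩ := cB.exists_isMaxOn nB hcx
    refine ⟨y, hy, ?_⟩
    have : u x ≤ -f (x, y) - us y := by
      rw [hu0 x hx]
      refine csSup_le (nB.image _) ?_
      rintro _ ⟨z, hz, rfl⟩
      exact hmax hz
    have := hus x hx y hy
    linarith
  · intro y hy x0 hx0 hmin
    have : us y ≤ -f (x0, y) - u x0 := by
      rw [hus0 y]
      refine csSup_le (nA.image _) ?_
      rintro _ ⟨z, hz, rfl⟩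
      have := hmin z hz
      simp only; linarith
    have := hus x0 hx0 y hy
    linarith

theorem dS_eq {c : Euc n → Euc n → ℝ} {U V : Set (Euc n)} {u : Euc n → ℝ} {X : Set (Euc n)}
    (hX : X ⊆ closure U) :
    dS (Function.uncurry c) V u (cStarT n c (closure U) u) X
      = cSubdiffImg n c (closure U) (closure V) u X := by
  ext y
  simp only [dS, cSubdiffImg, cSubdiffAt, cSubdiff, mem_iUnion, Set.mem_setOf_eq]
  constructor
  · rintro ⟨hy, x, hx, he⟩
    exact ⟨x, hx, hX hx, hy, he⟩
  · rintro ⟨x, hx, _, hy, he⟩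
    exact ⟨hy, x, hx, he⟩
end

section
variable {n : ℕ} {f : Euc n × Euc n → ℝ} {U V : Set (Euc n)} {B μ : ℝ} {u us : Euc n → ℝ}

theorem small_ev (a b : ℝ) (hb : 0 < b) : ∀ᶠ ε in nhdsWithin (0:ℝ) (Ioi 0), a * ε < b := by
  have : ContinuousAt (fun ε : ℝ => a * ε) 0 := by fun_prop
  have h := this.eventually_lt (continuousAt_const (y := b)) (by simpa using hb)
  exact h.filter_mono nhdsWithin_le_nhds

theorem MA.vol_sect_pos (h : MA n f U V B μ u us) {y0 x0 : Euc n} {τ : ℝ} (hy0 : y0 ∈ V)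
    (hZ : sect f U u y0 τ ⊆ U) (hx0 : x0 ∈ U) (hlt : u x0 + f (x0, y0) < τ) :
    volume ((fun x => gY f x y0) '' sect f U u y0 τ) ≠ 0 := by
  intro hz
  obtain ⟨D2, -, hD2⟩ := exists_vol_bound n μ⁻¹
  set Z := sect f U u y0 τ with hZd
  have v4 : volume Z ≤ D2 * volume ((fun x => gY f x y0) '' Z) := by
    have e1 : Z = Xi f U y0 '' ((fun x => gY f x y0) '' Z) := by
      rw [image_image]
      ext z
      constructor
      · intro hz
        exact ⟨z, hz, h.toPre.Xi_gY (hZ hz) hy0⟩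
      · rintro ⟨p, hp, rfl⟩
        simp only
        rwa [h.toPre.Xi_gY (hZ hp) hy0]
    conv_lhs => rw [e1]
    exact hD2 _ ((fun x => gY f x y0) '' U) _ (h.toPre.open_image hy0) (image_mono hZ)
      ((h.toPre.Xi_contDiff hy0).differentiableOn (by norm_num)) (h.toPre.Xi_fderiv hy0)
  rw [hz, mul_zero] at v4
  have hm : ContinuousOn (fun x => u x + f (x, y0)) (closure U) :=
    h.uc.add (h.cf.comp (by fun_prop) (fun x hx => ⟨hx, subset_closure hy0⟩))
  have hca : ContinuousAt (fun x => u x + f (x, y0)) x0 :=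
    hm.continuousAt (Filter.mem_of_superset (h.oU.mem_nhds hx0) subset_closure)
  have hnb : Z ∈ nhds x0 := by
    filter_upwards [hca.eventually_lt continuousAt_const hlt, h.oU.mem_nhds hx0] with x hx1 hx2
    exact ⟨subset_closure hx2, hx1.le⟩
  have := Measure.measure_pos_of_mem_nhds volume hnb
  exact absurd v4 (not_le.2 this)

set_option maxHeartbeats 2000000 in
theorem MA.main (hn : 1 ≤ n) (h : MA n f U V B μ u us) (hVf : volume (frontier V) = 0)
    {Ulam : Set (Euc n)} {lam Lam : ℝ} (hlam : 0 < lam)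
    (hge : ∀ X : Set (Euc n), X ⊆ Ulam → MeasurableSet X →
      ENNReal.ofReal lam * volume X ≤ volume (dS f V u us X))
    (hle : ∀ X : Set (Euc n), X ⊆ closure U → MeasurableSet X →
      volume (dS f V u us X) ≤ ENNReal.ofReal Lam * volume X)
    {xbar ybar xa : Euc n} {r : ℝ} (hr : 0 < r) (hball : ball xbar r ⊆ Ulam)
    (hyb : ybar ∈ closure V) (hxb : xbar ∈ U) (hxa : xa ∈ U) (hab : xa ≠ xbar)
    (heb : u xbar + us ybar + f (xbar, ybar) = 0) (hea : u xa + us ybar + f (xa, ybar) = 0)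
    (hno : ∀ x ∈ closure U, u x + us ybar + f (x, ybar) = 0 → x ∈ U) : False := by
  have cU : IsCompact (closure U) := h.bU.isCompact_closure
  have cV : IsCompact (closure V) := h.bV.isCompact_closure
  set v : Euc n → ℝ := fun x => u x + us ybar + f (x, ybar) with hv
  have vc : ContinuousOn v (closure U) :=
    (h.uc.add continuousOn_const).add (h.cf.comp (by fun_prop) (fun x hx => ⟨hx, hyb⟩))
  have v0 : ∀ x ∈ closure U, 0 ≤ v x := fun x hx => h.hus x hx ybar hyb
  have hUs : ∀ x ∈ U, x ∈ closure U := fun x hx => subset_closure hx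
  obtain ⟨γ, G, K, hK, hγV, hγgX', hγn, hγf', hGc, hGne⟩ :=
    h.toPre.swap.curve (y0 := xbar) (xb := ybar) (ya := xa) (yb := xbar)
      (h.cf.comp (sw n).continuous.continuousOn (fun p hp => ⟨hp.2, hp.1⟩)) hxb hyb hxa hxb hab
  have hγgX : ∀ ε ∈ Ioc (0:ℝ) 1, ∀ ε' ∈ Ioc (0:ℝ) 1, ∀ x ∈ U,
      ‖gX f x (γ ε) - gX f x (γ ε')‖ ≤ K * |ε - ε'| := hγgX'
  have hγf : ∀ ε ∈ Ioc (0:ℝ) 1, ∀ x ∈ U, |f (x, γ ε) - f (x, ybar) - ε * G x| ≤ K * ε ^ 2 := hγf'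
  clear hγgX' hγf'
  -- contact set
  set S : Set (Euc n) := {x ∈ closure U | v x ≤ 0} with hSd
  have hScl : IsClosed S := vc.preimage_isClosed_of_isClosed cU.isClosed isClosed_Iic
  have hSc : IsCompact S := cU.of_isClosed_subset hScl (fun x hx => hx.1)
  have hSU : S ⊆ U := fun x hx => hno x hx.1 (le_antisymm hx.2 (v0 x hx.1))
  have hxaS : xa ∈ S := ⟨hUs _ hxa, hea.le⟩
  have hxbS : xbar ∈ S := ⟨hUs _ hxb, heb.le⟩
  obtain ⟨x0, hx0S, hx0m⟩ := hSc.exists_isMinOn ⟨xa, hxaS⟩ (hGc.mono hSU)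
  obtain ⟨x1, hx1S, hx1m⟩ := hSc.exists_isMaxOn ⟨xa, hxaS⟩ (hGc.mono hSU)
  have hmin : ∀ x ∈ S, G x0 ≤ G x := fun x hx => hx0m hx
  have hmax : ∀ x ∈ S, G x ≤ G x1 := fun x hx => hx1m hx
  obtain ⟨w, hw⟩ : ∃ w, w = G x1 - G x0 := ⟨_, rfl⟩
  have hw0 : 0 < w := by
    rw [hw]
    rcases lt_or_gt_of_ne hGne with hlt | hlt
    · linarith [hmin _ hxaS, hmax _ hxbS]
    · linarith [hmin _ hxbS, hmax _ hxaS]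
  have hKf := Kf_nonneg h.toPre
  set σ : ℝ := w / (16 * (Kf B μ * K + 1)) with hσd
  have hKK : 0 ≤ Kf B μ * K := mul_nonneg hKf hK
  have hσ : 0 < σ := by positivity
  have hσ' : 2 * Kf B μ * K * σ ≤ w / 8 := by
    have : σ * (16 * (Kf B μ * K + 1)) = w := by rw [hσd]; field_simp
    nlinarith
  clear_value σ
  obtain ⟨CA, hCA, hA⟩ := h.lemA hn hVf hlam hge hr hball hσ
  obtain ⟨CB, hCB, hBB⟩ := h.lemB hle
  obtain ⟨N0, hN0⟩ := ENNReal.exists_nat_gt (ENNReal.mul_ne_top hCB hCA)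
  set N := N0 + 1 with hNd
  have hN1 : 1 ≤ N := by omega
  have hNR : (1:ℝ) ≤ N := by exact_mod_cast hN1
  obtain ⟨M, hM⟩ : ∃ M : ℝ, M = 2 * N + 2 := ⟨_, rfl⟩
  have hM4 : 4 ≤ M := by linarith
  have hM0 : 0 < M := by linarith
  obtain ⟨θ, hθ⟩ : ∃ θ : ℝ, θ = w / (4 * M) := ⟨_, rfl⟩
  have hθ0 : 0 < θ := by rw [hθ]; positivity
  have hθM : M * θ = w / 4 := by rw [hθ]; field_simp
  have hθ1 : (M - 1) * θ ≤ w / 4 := by linarith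
  have hθ2 : θ ≤ w / 2 := by nlinarith
  -- neighbourhood of the contact set
  set O : Set (Euc n) := U ∩ G ⁻¹' (Ioi (G x0 - θ)) with hOd
  have hOo : IsOpen O := hGc.isOpen_inter_preimage h.oU isOpen_Ioi
  have hSO : S ⊆ O := fun x hx => ⟨hSU hx, by
    have := hmin x hx
    change G x0 - θ < G x
    linarith⟩
  have hv1 : ∃ m : ℝ, 0 < m ∧ ∀ x ∈ closure U, x ∉ O → m ≤ v x := by
    have hcc : IsCompact (closure U \ O) := cU.diff hOo
    rcases (closure U \ O).eq_empty_or_nonempty with he | hne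
    · exact ⟨1, one_pos, fun x hx hxO => absurd (show x ∈ closure U \ O from ⟨hx, hxO⟩) (by simp [he])⟩
    · obtain ⟨z, hz, hzm⟩ := hcc.exists_isMinOn hne (vc.mono diff_subset)
      refine ⟨v z, ?_, fun x hx hxO => hzm ⟨hx, hxO⟩⟩
      by_contra hcon
      exact hz.2 (hSO ⟨hz.1, not_lt.1 hcon⟩)
  obtain ⟨m, hm0, hm⟩ := hv1
  have huc := (cU.prod cV).uniformContinuousOn_of_continuous h.cf
  rw [Metric.uniformContinuousOn_iff] at huc
  obtain ⟨δ, hδ, hδ'⟩ := huc (m / 2) (by positivity)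
  -- choice of ε
  have hev := (((((small_ev M 1 one_pos).and (small_ev K (w / 2) (by positivity))).and
    (small_ev (4 * K * M ^ 2) (w / 4) (by positivity))).and
    (small_ev (4 * Kf B μ * K ^ 2 * (M - 1) ^ 2) (w / 8) (by positivity))).and
    (small_ev K δ hδ)).and (small_ev (G x1 + w) (m / 2) (by positivity))
  obtain ⟨ε, ⟨⟨⟨⟨⟨e1, e2⟩, e3⟩, e4⟩, e5⟩, e6⟩, hε⟩ := (hev.and self_mem_nhdsWithin).exists
  have hε : 0 < ε := hε
  have hεI : ε ∈ Ioc (0:ℝ) 1 := ⟨hε, by nlinarith⟩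
  have hMεI : M * ε ∈ Ioc (0:ℝ) 1 := ⟨by positivity, e1.le⟩
  have q2 : K * ε ^ 2 ≤ ε * (w / 2) := by nlinarith
  have q3 : 4 * K * M ^ 2 * ε ^ 2 ≤ ε * (w / 4) := by nlinarith
  have q4 : 4 * Kf B μ * K ^ 2 * (M - 1) ^ 2 * ε ^ 2 ≤ ε * (w / 8) := by nlinarith
  set y0 := γ ε with hy0d
  set y1 := γ (M * ε) with hy1d
  have hy0 : y0 ∈ V := hγV ε hεI
  have hy1 : y1 ∈ V := hγV _ hMεI
  have F0 : ∀ x ∈ U, |f (x, y0) - f (x, ybar) - ε * G x| ≤ K * ε ^ 2 := hγf ε hεI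
  have F1 : ∀ x ∈ U, |f (x, y1) - f (x, ybar) - (M * ε) * G x| ≤ K * (M * ε) ^ 2 := hγf _ hMεI
  set τ : ℝ := ε * (G x1 + w) - us ybar with hτ
  set Z := sect f U u y0 τ with hZd
  have hZO : Z ⊆ O := by
    intro x hx
    by_contra hxO
    have a1 := hm x hx.1 hxO
    have a2 : u x + f (x, y0) ≤ τ := hx.2
    have a3 := hδ' (x, y0) ⟨hx.1, subset_closure hy0⟩ (x, ybar) ⟨hx.1, hyb⟩ (by
      have : dist y0 ybar < δ := by
        rw [dist_eq_norm]
        exact lt_of_le_of_lt (hγn ε hεI) e5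
      simpa [Prod.dist_eq, hδ] using this)
    rw [Real.dist_eq, abs_lt] at a3
    simp only [hv] at a1
    linarith [a3.1, a3.2]
  have hZU : Z ⊆ U := fun x hx => (hZO hx).1
  have hGZ : ∀ x ∈ Z, G x0 - θ < G x := fun x hx => (hZO hx).2
  have hSZ : ∀ x ∈ S, ε * w / 2 ≤ τ - (u x + f (x, y0)) := by
    intro x hx
    have a1 := abs_le.1 (F0 x (hSU hx))
    have a2 : u x + us ybar + f (x, ybar) ≤ 0 := hx.2
    have a3 := mul_le_mul_of_nonneg_left (hmax x hx) hε.le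
    rw [hτ]
    linarith [a1.2]
  have hεw : 0 < ε * w := by positivity
  have hSZ' : S ⊆ Z := fun x hx => ⟨hx.1, by
    have := hSZ x hx
    linarith⟩
  have hx0Z := hSZ' hx0S
  have hx1Z := hSZ' hx1S
  have hxbZ := hSZ' hxbS
  have hx0U := hZU hx0Z
  have hx1U := hZU hx1Z
  have hhx0 : w * ε ≤ τ - (u x0 + f (x0, y0)) := by
    have a1 := abs_le.1 (F0 x0 hx0U)
    have a2 : u x0 + us ybar + f (x0, ybar) ≤ 0 := hx0S.2
    have a3 : ε * G x1 - ε * G x0 = ε * w := by rw [hw]; ring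
    rw [hτ]
    linarith [a1.2]
  have hh3 : ∀ x ∈ Z, τ - (u x + f (x, y0)) ≤ 3 * (w * ε) := by
    intro x hx
    have a1 := abs_le.1 (F0 x (hZU hx))
    have a2 : 0 ≤ u x + us ybar + f (x, ybar) := v0 x hx.1
    have a3 : ε * G x1 - ε * G x0 = ε * w := by rw [hw]; ring
    have a4 := mul_le_mul_of_nonneg_left (hGZ x hx).le hε.le
    have a5 := mul_le_mul_of_nonneg_left hθ2 hε.le
    rw [hτ]
    linarith [a1.1]
  have hwε : 0 < w * ε := by positivity
  have Aineq := hA y0 x0 τ (w * ε) hy0 hZU hwε hh3 hx0Z hxbZ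
  have hKM : K * ε ^ 2 + K * (M * ε) ^ 2 ≤ ε * (w / 8) := by
    have : K * ε ^ 2 ≤ K * (M * ε) ^ 2 := by
      rw [mul_pow]
      have : 1 ≤ M ^ 2 := by nlinarith
      have h2 : 0 ≤ K * ε ^ 2 := by positivity
      nlinarith
    linarith
  have hdd : ‖gX f x0 y1 - gX f x0 y0‖ ≤ K * ((M - 1) * ε) := by
    have := hγgX (M * ε) hMεI ε hεI x0 hx0U
    rwa [show M * ε - ε = (M - 1) * ε by ring, abs_of_pos (by nlinarith)] at this
  have hC1 : ∀ z ∈ Z, (f (z, y0) - f (z, y1)) - (f (x0, y0) - f (x0, y1)) ≤ w * ε / 2 := by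
    intro z hz
    have a1 := abs_le.1 (F0 z (hZU hz))
    have a2 := abs_le.1 (F1 z (hZU hz))
    have a3 := abs_le.1 (F0 x0 hx0U)
    have a4 := abs_le.1 (F1 x0 hx0U)
    have a5 : ((M - 1) * ε) * (G x0 - G z) ≤ ((M - 1) * ε) * θ :=
      mul_le_mul_of_nonneg_left (by linarith [hGZ z hz]) (by nlinarith)
    have a6 : ((M - 1) * ε) * θ ≤ ε * (w / 4) := by
      have := mul_le_mul_of_nonneg_left hθ1 hε.le
      linarith
    linarith [a1.2, a2.1, a3.1, a4.2]
  have hsep : (N:ℝ) * (w * ε) < ((f (x0, y0) - f (x1, y0)) - (f (x0, y1) - f (x1, y1)))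
      - 2 * Kf B μ * (K * ((M - 1) * ε)) * (2 * (K * ((M - 1) * ε)) + σ) := by
    have a1 := abs_le.1 (F0 x1 hx1U)
    have a2 := abs_le.1 (F1 x1 hx1U)
    have a3 := abs_le.1 (F0 x0 hx0U)
    have a4 := abs_le.1 (F1 x0 hx0U)
    have a5 : ((M - 1) * ε) * (G x1 - G x0) = (2 * N + 1) * (w * ε) := by rw [← hw, hM]; ring
    have a6 : 2 * Kf B μ * (K * ((M - 1) * ε)) * (2 * (K * ((M - 1) * ε)) + σ)
        = 4 * Kf B μ * K ^ 2 * (M - 1) ^ 2 * ε ^ 2 + ((M - 1) * ε) * (2 * Kf B μ * K * σ) := by ring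
    have a7 : ((M - 1) * ε) * (2 * Kf B μ * K * σ) ≤ ((M - 1) * ε) * (w / 8) :=
      mul_le_mul_of_nonneg_left hσ' (by nlinarith)
    have a8 : ((M - 1) * ε) * (w / 8) = (2 * N + 1) * (w * ε) / 8 := by rw [hM]; ring
    have a9 : w * ε ≤ N * (w * ε) := by nlinarith
    rw [a6]
    linarith [a1.1, a2.2, a3.2, a4.1, a1.2, a2.1, a3.1, a4.2]
  have Bineq := hBB x0 x1 y0 y1 τ (w * ε) σ _ (K * ((M - 1) * ε)) N hy0 hy1 hZU hwε hx0Z hx1Z hhx0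
    hN1 rfl hdd hsep hC1
  have hpos : volume ((fun x => gY f x y0) '' Z) ≠ 0 :=
    h.vol_sect_pos hy0 hZU hx0U (by linarith)
  set W := Wset f V Z x0 y0 (w * ε) σ with hWd
  have hW0 : volume W ≠ 0 := by
    intro hz
    rw [hz, mul_zero] at Aineq
    exact hpos (le_antisymm Aineq zero_le)
  have hWT : volume W ≠ ⊤ :=
    ((h.bV.subset (fun y hy => hy.1 : W ⊆ V)).measure_lt_top).ne
  have fin : ((N + 1 : ℕ) : ℝ≥0∞) * volume W ≤ (CB * CA) * volume W := by
    refine Bineq.trans ?_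
    rw [mul_assoc]
    exact mul_le_mul' le_rfl Aineq
  rw [ENNReal.mul_le_mul_iff_left hW0 hWT] at fin
  have : (N0 : ℝ≥0∞) ≤ ((N + 1 : ℕ) : ℝ≥0∞) := by
    exact_mod_cast (by omega : N0 ≤ N + 1)
  exact absurd (hN0.trans_le this) (not_lt.2 fin)
end

/-- Theorem 7.1: the contact set is either a single point or crosses
the domain. -/
theorem contact_set_singleton_or_crosses (n : ℕ) (c : Euc n → Euc n → ℝ)
    (U V Ulam : Set (Euc n)) (u : Euc n → ℝ) (lam Lam : ℝ) (xbar ybar : Euc n)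
    (S : Set (Euc n))
    (hB0 : B0cond n c U V) (hB1 : B1cond n c U V) (hB2 : B2cond n c U V)
    (hB3 : B3cond n c U V)
    (hUlamOpen : IsOpen Ulam) (hUlam : Ulam ⊆ U)
    (hu : CConvexOn n c (closure U) (closure V) u)
    (hlam : 0 < lam) (hLam : 0 < Lam)
    (hge : MAge n c (closure U) (closure V) u lam Ulam)
    (hle : MAle n c (closure U) (closure V) u (1 / lam) Ulam)
    (hleU : MAle n c (closure U) (closure V) u Lam (closure U))
    (hx : xbar ∈ Ulam)
    (hy : ybar ∈ cSubdiffAt n c (closure U) (closure V) u xbar)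
    (hS : S = {x ∈ closure U | u x = u xbar - c x ybar + c xbar ybar})
    (hne : S ≠ {xbar}) :
    (S ∩ frontier U).Nonempty := by
  classical
  have hxU : xbar ∈ U := hUlam hx
  have hUne : U.Nonempty := ⟨xbar, hxU⟩
  obtain ⟨-, hyV, hey⟩ := hy
  have hVne : V.Nonempty := closure_nonempty_iff.1 ⟨_, hyV⟩
  have hxbS : xbar ∈ S := by
    rw [hS]; exact ⟨subset_closure hxU, by ring⟩
  obtain ⟨xa, hxaS, hab⟩ : ∃ xa ∈ S, xa ≠ xbar := by
    by_contra hcon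
    push Not at hcon
    apply hne
    ext x
    constructor
    · intro hx'; exact hcon x hx'
    · rintro rfl; exact hxbS
  have hn : 1 ≤ n := by
    rcases Nat.eq_zero_or_pos n with h0 | h0
    · subst h0
      exact absurd (Subsingleton.elim xa xbar) hab
    · exact h0
  by_contra hcon
  obtain ⟨⟨B, μ, hpre⟩, hVf⟩ := exists_pre n hn c U V hB0 hB1 hB2 hUne hVne
  have hgood : Good n (Function.uncurry c) U V B μ := ⟨hpre, T1_of_B3 n c U V hpre hB3⟩
  have hma := ma_of_hyp hB0 hgood hu hUne hVne
  have hSU : S ⊆ U := by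
    intro x hxS
    by_contra hxn
    apply hcon
    refine ⟨x, hxS, ?_⟩
    rw [hB0.1.frontier_eq]
    rw [hS] at hxS
    exact ⟨hxS.1, hxn⟩
  obtain ⟨r, hr, hball⟩ := Metric.isOpen_iff.1 hUlamOpen xbar hx
  have hey' : u xbar + cStarT n c (closure U) u ybar + c xbar ybar = 0 := hey
  refine hma.main hn hVf (Ulam := Ulam) (Lam := Lam) hlam ?_ ?_ hr hball hyV hxU (hSU hxaS) hab hey' ?_ ?_
  · intro X hX hXm
    rw [dS_eq ((hX.trans hUlam).trans subset_closure)]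
    exact hge X hX hXm
  · intro X hX hXm
    rw [dS_eq hX]
    exact hleU X hX hXm
  · rw [hS] at hxaS
    have : u xa = u xbar - c xa ybar + c xbar ybar := hxaS.2
    change u xa + cStarT n c (closure U) u ybar + c xa ybar = 0
    linarith
  · intro x hxc hex
    apply hSU
    rw [hS]
    refine ⟨hxc, ?_⟩
    have : u x + cStarT n c (closure U) u ybar + c x ybar = 0 := hex
    linarith
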